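/- Let X ⊆ P^r_K be a non-degenerate variety of degree 5 and codimension 3 which is not a cone, with codepth A_X = 1. Then dim X ≤ 4 and the Betti diagram of I_X has exactly the entries β_{1,1} = 4, β_{2,1} = 2, β_{1,2} = 1, β_{2,2} = 6, β_{3,2} = 5, β_{4,2} = 1, with all other entries β_{i,j} (i ≥ 1) equal to zero. -/

import Mathlib

noncomputable section

open MvPolynomial

/-- The polynomial ring `S = K[x_0, …, x_r]`, the homogeneous coordinate ring of `ℙ^r_K`. -/
abbrev PS (K : Type) [Field K] (r : ℕ) : Type := MvPolynomial (Fin (r + 1)) K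

namespace AMD

variable (K : Type) [Field K] (r : ℕ)

/-- `I` is a homogeneous ideal of `S = K[x_0, …, x_r]`. -/
def IsHomIdeal (I : Ideal (PS K r)) : Prop :=
  ∀ p ∈ I, ∀ n : ℕ, homogeneousComponent n p ∈ I

/-- `X = V_+(I)` is non-degenerate: `I` contains no nonzero linear form. -/
def Nondeg (I : Ideal (PS K r)) : Prop :=
  ∀ p ∈ I, p.IsHomogeneous 1 → p = 0

/-- The irrelevant maximal ideal of the homogeneous coordinate ring `A_X = S/I`. -/
def maxIdl (I : Ideal (PS K r)) : Ideal (PS K r ⧸ I) :=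
  (Ideal.span (Set.range (X : Fin (r + 1) → PS K r))).map (Ideal.Quotient.mk I)

/-- `dim X = d`, i.e. the Krull dimension of `A_X = S/I` equals `d + 1`. -/
def DimEq (I : Ideal (PS K r)) (d : ℕ) : Prop :=
  ringKrullDim (PS K r ⧸ I) = (((d : ℕ∞) + 1 : ℕ∞) : WithBot ℕ∞)

/-- The degree-`n` homogeneous component of `A_X = S/I`, as a `K`-subspace. -/
def quotComponent (I : Ideal (PS K r)) (n : ℕ) : Submodule K (PS K r ⧸ I) :=
  (homogeneousSubmodule (Fin (r + 1)) K n).map (Ideal.Quotient.mkₐ K I).toLinearMap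

/-- The Hilbert series of the graded algebra `A_X = S/I`. -/
def hilbSeries (I : Ideal (PS K r)) : PowerSeries ℤ :=
  PowerSeries.mk fun n => (Module.finrank K (quotComponent K r I n) : ℤ)

/-- `deg X = e`, where `d = dim X`:  the numerator polynomial of the Hilbert series of
`A_X` with respect to the denominator `(1 - λ)^(d+1)` takes the value `e` at `λ = 1`. -/
def DegreeEq (I : Ideal (PS K r)) (d e : ℕ) : Prop :=
  ∃ h : Polynomial ℤ,
    hilbSeries K r I * (1 - PowerSeries.X) ^ (d + 1) = PowerSeries.mk (fun n => h.coeff n) ∧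
    h.eval 1 = (e : ℤ)

/-- A graded automorphism of `S`, i.e. a linear change of coordinates of `ℙ^r_K`. -/
def IsGrAut (φ : PS K r ≃ₐ[K] PS K r) : Prop :=
  ∀ i, (φ (X i)).IsHomogeneous 1

/-- `X = V_+(I) ⊆ ℙ^r_K` is a cone (over a variety lying in some hyperplane): after a
linear change of coordinates, `I` is generated by polynomials not involving the last
variable. -/
def IsConeIdeal (I : Ideal (PS K r)) : Prop :=
  ∃ φ : PS K r ≃ₐ[K] PS K r, IsGrAut K r φ ∧
    ∃ J : Ideal (MvPolynomial (Fin r) K),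
      Ideal.map φ I = Ideal.map (rename (Fin.castSucc : Fin r → Fin (r + 1))) J

/-- A (weakly) regular sequence on the ring `A`. -/
def IsRegSeq {A : Type} [CommRing A] (rs : List A) : Prop :=
  ∀ (i : Fin rs.length) (y : A),
    rs.get i * y ∈ Ideal.span {x | x ∈ rs.take i.1} → y ∈ Ideal.span {x | x ∈ rs.take i.1}

/-- `depth A_X = t`: the maximal length of a regular sequence on `A_X = S/I` consisting
of elements of the irrelevant maximal ideal is `t`. -/
def DepthEq (I : Ideal (PS K r)) (t : ℕ) : Prop :=
  (∃ rs : List (PS K r ⧸ I), rs.length = t ∧ (∀ x ∈ rs, x ∈ maxIdl K r I) ∧ IsRegSeq rs) ∧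
  ∀ rs : List (PS K r ⧸ I), (∀ x ∈ rs, x ∈ maxIdl K r I) → IsRegSeq rs → rs.length ≤ t

/-- `X` is arithmetically Cohen-Macaulay: `depth A_X = dim A_X`. -/
def IsACM (I : Ideal (PS K r)) : Prop :=
  ∃ t : ℕ, ringKrullDim (PS K r ⧸ I) = ((t : ℕ∞) : WithBot ℕ∞) ∧ DepthEq K r I t

/-- The socle `{y | m·y = 0}` of `B`, as a `K`-subspace of `B`. -/
def socle (B : Type) [CommRing B] [Algebra K B] (m : Ideal B) : Submodule K B where
  carrier := {y | ∀ z ∈ m, z * y = 0}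
  add_mem' := by
    intro a b ha hb z hz
    rw [mul_add, ha z hz, hb z hz, add_zero]
  zero_mem' := by
    intro z hz
    rw [mul_zero]
  smul_mem' := by
    intro c y hy z hz
    rw [mul_smul_comm, hy z hz, smul_zero]

/-- `X` is arithmetically Gorenstein: `A_X = S/I` is Cohen-Macaulay and its Artinian
reduction by a maximal regular sequence has a one-dimensional socle. -/
def IsArithGorenstein (I : Ideal (PS K r)) : Prop :=
  ∃ (t : ℕ) (rs : List (PS K r ⧸ I)),
    ringKrullDim (PS K r ⧸ I) = ((t : ℕ∞) : WithBot ℕ∞) ∧ rs.length = t ∧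
    (∀ x ∈ rs, x ∈ maxIdl K r I) ∧ IsRegSeq rs ∧
    Module.finrank K
      (socle K ((PS K r ⧸ I) ⧸ Ideal.span {x | x ∈ rs})
        (Ideal.map (Ideal.Quotient.mk (Ideal.span {x | x ∈ rs})) (maxIdl K r I))) = 1

/-- The graded free `S`-module with `β j` generators in "row `j`" for each `j : ℕ`. -/
abbrev FreeGr (β : ℕ → ℕ) : Type := ((j : ℕ) × Fin (β j)) →₀ PS K r

/-- `φ` is a minimal graded homomorphism of graded free modules, where the generator
`(j, t)` of the source has degree `m₁ + j` and the generator `(j', t')` of the target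
has degree `m₂ + j'`: every matrix entry of `φ` is either zero or homogeneous of the
appropriate positive degree. -/
def IsMinGrMap (b₁ b₂ : ℕ → ℕ) (m₁ m₂ : ℕ)
    (φ : FreeGr K r b₁ →ₗ[PS K r] FreeGr K r b₂) : Prop :=
  ∀ (j : ℕ) (t : Fin (b₁ j)) (j' : ℕ) (t' : Fin (b₂ j')),
    (φ (Finsupp.single ⟨j, t⟩ 1)) ⟨j', t'⟩ = 0 ∨
      ∃ dd : ℕ, 1 ≤ dd ∧ dd + (m₂ + j') = m₁ + j ∧
        ((φ (Finsupp.single ⟨j, t⟩ 1)) ⟨j', t'⟩).IsHomogeneous dd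

/-- `b` is the Betti diagram of the ideal `I ⊆ S`, i.e.
`b i j = dim_K Tor_i^S(K, S/I)_{i+j}` for all `i ≥ 1`.  This is expressed by the
existence of a minimal graded free resolution `⋯ → F₂ → F₁ → S → S/I → 0` of `S/I`
in which, for `i ≥ 1`, the free module `F_i` has exactly `b i j` generators of degree
`i + j`. -/
def HasBettiDiagram (I : Ideal (PS K r)) (b : ℕ → ℕ → ℕ) : Prop :=
  ∃ (φ : (i : ℕ) → (FreeGr K r (b (i + 2)) →ₗ[PS K r] FreeGr K r (b (i + 1))))
    (ε : FreeGr K r (b 1) →ₗ[PS K r] PS K r),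
    (∀ (j : ℕ) (t : Fin (b 1 j)), (ε (Finsupp.single ⟨j, t⟩ 1)).IsHomogeneous (1 + j)) ∧
    (∀ i, IsMinGrMap K r (b (i + 2)) (b (i + 1)) (i + 2) (i + 1) (φ i)) ∧
    LinearMap.range ε = I ∧
    LinearMap.ker ε = LinearMap.range (φ 0) ∧
    ∀ i, LinearMap.ker (φ i) = LinearMap.range (φ (i + 1))

/-- The Pfaffian of a (skew-symmetric) `4 × 4` matrix. -/
def pfaff4 {R : Type} [CommRing R] (N : Matrix (Fin 4) (Fin 4) R) : R :=
  N 0 1 * N 2 3 - N 0 2 * N 1 3 + N 0 3 * N 1 2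

/-- The five submaximal (`4 × 4`) Pfaffians of a skew-symmetric `5 × 5` matrix. -/
def subPfaffian {R : Type} [CommRing R] (M : Matrix (Fin 5) (Fin 5) R) (i : Fin 5) : R :=
  pfaff4 (M.submatrix i.succAbove i.succAbove)

/-- `X = V_+(I)` is the Pfaffian variety defined by the five `4 × 4` Pfaffians of a
skew-symmetric `5 × 5` matrix of linear forms. -/
def IsPfaffianVariety (I : Ideal (PS K r)) : Prop :=
  ∃ M : Matrix (Fin 5) (Fin 5) (PS K r),
    M.transpose = -M ∧ (∀ i j, (M i j).IsHomogeneous 1) ∧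
    I = Ideal.span (Set.range (subPfaffian M))

/-- The vanishing ideal of the coordinate point `(0 : ⋯ : 0 : 1) ∈ ℙ^{r+1}_K`. -/
def pointIdl : Ideal (PS K (r + 1)) :=
  Ideal.span ((X : Fin (r + 2) → PS K (r + 1)) '' {i : Fin (r + 2) | i ≠ Fin.last (r + 1)})

/-- `X = V_+(I) ⊆ ℙ^r_K` is the image of `Z = V_+(J) ⊆ ℙ^{r+1}_K` under the projection
from a point `P ∈ ℙ^{r+1}_K ∖ Z`: after a linear change of coordinates moving `P` to
`(0 : ⋯ : 0 : 1)`, the ideal `I` is the contraction of `J` to `K[x_0, …, x_r]`. -/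
def IsProjectionOf (I : Ideal (PS K r)) (J : Ideal (PS K (r + 1))) : Prop :=
  ∃ ψ : PS K (r + 1) ≃ₐ[K] PS K (r + 1), IsGrAut K (r + 1) ψ ∧
    ¬ Ideal.map ψ J ≤ pointIdl K r ∧
    I = Ideal.comap (rename (Fin.castSucc : Fin (r + 1) → Fin (r + 2))) (Ideal.map ψ J)

/-- The ideal of the Veronese surface `F ⊆ ℙ^5_K`, generated by the `2 × 2` minors of
the generic symmetric `3 × 3` matrix with rows `(x₀,x₁,x₂), (x₁,x₃,x₄), (x₂,x₄,x₅)`. -/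
def veroneseIdeal : Ideal (PS K 5) :=
  Ideal.span {X 0 * X 3 - X 1 * X 1, X 0 * X 4 - X 1 * X 2, X 1 * X 4 - X 2 * X 3,
    X 0 * X 5 - X 2 * X 2, X 1 * X 5 - X 2 * X 4, X 3 * X 5 - X 4 * X 4}

/-- The determinant of the generic symmetric `3 × 3` matrix defining the Veronese
surface; it cuts out the secant variety of `F ⊆ ℙ^5_K`. -/
def veroneseDet : PS K 5 :=
  X 0 * X 3 * X 5 - X 0 * X 4 * X 4 - X 1 * X 1 * X 5 + 2 * (X 1 * X 2 * X 4) -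
    X 2 * X 2 * X 3

/-- `X = V_+(I) ⊆ ℙ^4_K` is a generic projection of the Veronese surface `F ⊆ ℙ^5_K`,
i.e. the projection of `F` from a point `P ∈ ℙ^5_K ∖ F` at which the generic symmetric
`3 × 3` matrix `M` has rank `3` (equivalently, `P` does not lie on the secant variety
`{det M = 0}` of `F`). -/
def IsGenProjVeronese4 (I : Ideal (PS K 4)) : Prop :=
  ∃ ψ : PS K 5 ≃ₐ[K] PS K 5, IsGrAut K 5 ψ ∧
    ¬ Ideal.map ψ (Ideal.span {veroneseDet K}) ≤ pointIdl K 4 ∧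
    I = Ideal.comap (rename (Fin.castSucc : Fin 5 → Fin 6)) (Ideal.map ψ (veroneseIdeal K))

/-- `X = V_+(I) ⊆ ℙ^r_K` is a generic projection of the Veronese surface (which forces
`r = 4`). -/
def IsGenProjVeronese (I : Ideal (PS K r)) : Prop :=
  ∃ h : r + 1 = 5, IsGenProjVeronese4 K (Ideal.map (rename (Fin.cast h)) I)

/-- `X = V_+(I) ⊆ ℙ^r_K` is a generic projection of (a cone over) the Veronese surface
`F ⊆ ℙ^5_K`:  `X` is the projection of a cone `Z ⊆ ℙ^{r+1}_K` over `F` from a point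
not lying on the (cone over the) secant variety of `F`. -/
def IsGenProjVeroneseCone (I : Ideal (PS K r)) : Prop :=
  ∃ (h : 6 ≤ r + 2) (ψ : PS K (r + 1) ≃ₐ[K] PS K (r + 1)), IsGrAut K (r + 1) ψ ∧
    ¬ Ideal.map ψ (Ideal.map (rename (Fin.castLE h))
        (Ideal.span {veroneseDet K})) ≤ pointIdl K r ∧
    I = Ideal.comap (rename (Fin.castSucc : Fin (r + 1) → Fin (r + 2)))
      (Ideal.map ψ (Ideal.map (rename (Fin.castLE h)) (veroneseIdeal K)))

/-- The ideal of the rational normal scroll `S(a_1, …, a_k)`, generated by the `2 × 2`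
minors of the standard `2 × (Σ a_i)` matrix of indeterminates. -/
def scrollIdeal (k : ℕ) (a : Fin k → ℕ) :
    Ideal (MvPolynomial ((i : Fin k) × Fin (a i + 1)) K) :=
  Ideal.span {p | ∃ (i : Fin k) (j : Fin (a i)) (i' : Fin k) (j' : Fin (a i')),
    p = X ⟨i, j.castSucc⟩ * X ⟨i', j'.succ⟩ - X ⟨i, j.succ⟩ * X ⟨i', j'.castSucc⟩}

/-- The affine cone in `K^{r+2}` of the projective scheme `V_+(J) ⊆ ℙ^{r+1}_K`. -/
def zeroSet (J : Ideal (PS K (r + 1))) : Set (Fin (r + 2) → K) :=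
  {v | ∀ f ∈ J, MvPolynomial.eval v f = 0}

/-- Restriction of polynomials to the plane spanned by the vectors `p` and `q`
(i.e. to the line through the corresponding projective points). -/
def lineRestrict (p q : Fin (r + 2) → K) : PS K (r + 1) →ₐ[K] MvPolynomial (Fin 2) K :=
  aeval fun i => MvPolynomial.C (p i) * X 0 + MvPolynomial.C (q i) * X 1

/-- The line through the (independent) points `p`, `q` is a secant line of
`Z = V_+(J)`: the scheme `Z ∩ L ⊆ L ≅ ℙ^1` has length at least `2`, i.e. the
restriction of `J` to the line is contained in a principal ideal generated by a
form of degree `≥ 2` (or is zero, in which case `L ⊆ Z`). -/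
def IsSecantLine (J : Ideal (PS K (r + 1))) (p q : Fin (r + 2) → K) : Prop :=
  ∃ h : MvPolynomial (Fin 2) K,
    (∀ f ∈ J, lineRestrict K r p q f ∈ Ideal.span {h}) ∧
    (h = 0 ∨ ∃ dd : ℕ, 2 ≤ dd ∧ h.IsHomogeneous dd)

/-- The (affine cone over the) secant cone `Sec_P(Z)` of `Z = V_+(J)` with respect to
the point `P = [p]`: the union of `{P}` and of all secant lines of `Z` through `P`. -/
def secantCone (J : Ideal (PS K (r + 1))) (p : Fin (r + 2) → K) : Set (Fin (r + 2) → K) :=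
  {v | ∃ a : K, v = a • p} ∪
    {v | ∃ q : Fin (r + 2) → K, LinearIndependent K ![p, q] ∧ IsSecantLine K r J p q ∧
      ∃ a b : K, v = a • p + b • q}

/-- The (homogeneous) vanishing ideal of a subset of the affine cone `K^{r+2}`. -/
def vanishingIdl (T : Set (Fin (r + 2) → K)) : Ideal (PS K (r + 1)) where
  carrier := {f | ∀ v ∈ T, MvPolynomial.eval v f = 0}
  add_mem' := by
    intro a b ha hb v hv
    rw [map_add, ha v hv, hb v hv, add_zero]
  zero_mem' := by
    intro v hv
    rw [map_zero]
  smul_mem' := by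
    intro c f hf v hv
    rw [smul_eq_mul, map_mul, hf v hv, mul_zero]

/-- `X = V_+(I) ⊆ ℙ^r_K` is the image of `Z = V_+(J) ⊆ ℙ^{r+1}_K` under the linear
projection `π : ℙ^{r+1}_K ∖ {P} → ℙ^r_K` from the point `P = [p]`:  `I` is the
contraction of `J` along the substitution homomorphism induced by a surjective linear
map `K^{r+2} → K^{r+1}` with kernel `K·p`. -/
def IsProjectionFromPoint (I : Ideal (PS K r)) (J : Ideal (PS K (r + 1)))
    (p : Fin (r + 2) → K) : Prop :=
  ∃ π : (Fin (r + 2) → K) →ₗ[K] (Fin (r + 1) → K),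
    Function.Surjective π ∧ LinearMap.ker π = Submodule.span K {p} ∧
    I = Ideal.comap
      (aeval (fun j : Fin (r + 1) =>
        ∑ i : Fin (r + 2), MvPolynomial.C (π (Pi.single i 1) j) * X i) :
          PS K r →ₐ[K] PS K (r + 1)) J

end AMD

open MvPolynomial
namespace AMDP

/-- Index equivalence for graded free modules concentrated in rows 1 and 2. -/
def idxEquiv (b : ℕ → ℕ) (m k : ℕ) (h1 : b 1 = m) (h2 : b 2 = k)
    (h0 : ∀ j, j ≠ 1 → j ≠ 2 → b j = 0) : ((j : ℕ) × Fin (b j)) ≃ Fin m ⊕ Fin k where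
  toFun x := if h : x.1 = 1 then Sum.inl (Fin.cast (by rw [h, h1]) x.2)
    else if h' : x.1 = 2 then Sum.inr (Fin.cast (by rw [h', h2]) x.2)
    else (Fin.cast (h0 _ h h') x.2).elim0
  invFun s := match s with
    | Sum.inl t => ⟨1, Fin.cast h1.symm t⟩
    | Sum.inr t => ⟨2, Fin.cast h2.symm t⟩
  left_inv := by
    rintro ⟨j, t⟩
    by_cases h : j = 1
    · subst h; simp
    · by_cases h' : j = 2
      · subst h'; simp
      · exact (Fin.cast (h0 _ h h') t).elim0
  right_inv := by
    rintro (t | t) <;> simp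

/-- row of an index -/
def rowOf (m : ℕ) {n : ℕ} (i : Fin n) : ℕ := if i.1 < m then 1 else 2

theorem exists_idx (b : ℕ → ℕ) (m k : ℕ) (h1 : b 1 = m) (h2 : b 2 = k)
    (h0 : ∀ j, j ≠ 1 → j ≠ 2 → b j = 0) :
    ∃ e : ((j : ℕ) × Fin (b j)) ≃ Fin (m + k), ∀ j t, rowOf m (e ⟨j, t⟩) = j := by
  refine ⟨(idxEquiv b m k h1 h2 h0).trans finSumFinEquiv, ?_⟩
  intro j t
  by_cases h : j = 1
  · subst h; simp [idxEquiv, rowOf]; omega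
  · by_cases h' : j = 2
    · subst h'; simp [idxEquiv, rowOf]
    · exact (Fin.cast (h0 _ h h') t).elim0

variable {S : Type} [CommRing S]

def toFun' {σ : Type} {n : ℕ} (e : σ ≃ Fin n) : (σ →₀ S) ≃ₗ[S] (Fin n → S) :=
  (Finsupp.domLCongr e).trans (Finsupp.linearEquivFunOnFinite S S (Fin n))

theorem toFun'_single {σ : Type} {n : ℕ} (e : σ ≃ Fin n) (x : σ) :
    toFun' (S := S) e (Finsupp.single x 1) = Pi.single (e x) 1 := by
  simp [toFun']

theorem toFun'_symm_apply {σ : Type} {n : ℕ} (e : σ ≃ Fin n) (v : Fin n → S) (x : σ) :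
    (toFun' e).symm v x = v (e x) := by
  obtain ⟨w, rfl⟩ := (toFun' e).surjective v
  simp [toFun', Finsupp.equivMapDomain_apply]

def matMap {σ σ' : Type} {n n' : ℕ} (e : σ ≃ Fin n) (e' : σ' ≃ Fin n')
    (M : Matrix (Fin n') (Fin n) S) : (σ →₀ S) →ₗ[S] (σ' →₀ S) :=
  (toFun' e').symm.toLinearMap ∘ₗ M.mulVecLin ∘ₗ (toFun' e).toLinearMap

theorem matMap_single {σ σ' : Type} {n n' : ℕ} (e : σ ≃ Fin n) (e' : σ' ≃ Fin n')
    (M : Matrix (Fin n') (Fin n) S) (x : σ) (y : σ') :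
    matMap e e' M (Finsupp.single x 1) y = M (e' y) (e x) := by
  simp [matMap, toFun'_single, toFun'_symm_apply]

theorem matMap_exact {σ σ' σ'' : Type} {n n' n'' : ℕ} (e : σ ≃ Fin n) (e' : σ' ≃ Fin n')
    (e'' : σ'' ≃ Fin n'')
    (M : Matrix (Fin n') (Fin n) S) (N : Matrix (Fin n'') (Fin n') S)
    (h1 : ∀ v, N.mulVec v = 0 → ∃ w, M.mulVec w = v) (h2 : ∀ w, N.mulVec (M.mulVec w) = 0) :
    LinearMap.ker (matMap e' e'' N) = LinearMap.range (matMap e e' M) := by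
  ext v
  simp only [LinearMap.mem_ker, LinearMap.mem_range, matMap, LinearMap.comp_apply,
    LinearEquiv.coe_coe, LinearEquiv.map_eq_zero_iff, Matrix.mulVecLin_apply]
  constructor
  · intro h
    obtain ⟨w, hw⟩ := h1 _ h
    refine ⟨(toFun' e).symm w, ?_⟩
    simp [hw]
  · rintro ⟨w, rfl⟩
    simp [h2]

/-- The algebraic facts needed for the exactness of the resolution. -/
structure ResData (a b c d e u v w : S) : Prop where
  dom : ∀ x y : S, x * y = 0 → x = 0 ∨ y = 0
  cne : c ≠ 0
  D1ne : a * c - b * b ≠ 0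
  Qne : u * c - b * w - a * v ≠ 0
  ab : ∀ x : S, x * (c * d) ∈ Ideal.span {a, b} → x ∈ Ideal.span {a, b}
  D12 : ∀ x y : S, x * (a * c - b * b) + y * (a * e - b * d) = 0 →
    ∃ z, x = z * (a * e - b * d) ∧ y = - z * (a * c - b * b)
  QD : ∀ x : S, x * (u * c - b * w - a * v) ∈
      Ideal.span {a * c - b * b, a * e - b * d, b * e - c * d} →
    x ∈ Ideal.span {a * c - b * b, a * e - b * d, b * e - c * d}
  CQ : ∀ x : S, x * (u * e * e - d * e * w - d * d * v) ∈
      Ideal.span {a * c - b * b, a * e - b * d, b * e - c * d, u * c - b * w - a * v} →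
    x ∈ Ideal.span {a, b, c}
  kos2 : ∀ x y : S, x * a + y * b = 0 → ∃ z, x = z * b ∧ y = - z * a
  kos3 : ∀ x y z : S, x * a + y * b + z * c = 0 → z ∈ Ideal.span {a, b}

theorem mem2 {a b x : S} : x ∈ Ideal.span {a, b} ↔ ∃ p q, x = p * a + q * b := by
  rw [Ideal.mem_span_pair]; simp [eq_comm]

theorem mem3 {a b c x : S} : x ∈ Ideal.span {a, b, c} ↔ ∃ p q r, x = p * a + q * b + r * c := by
  rw [Ideal.mem_span_insert]
  constructor
  · rintro ⟨p, z, hz, rfl⟩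
    obtain ⟨q, r, rfl⟩ := mem2.1 hz
    exact ⟨p, q, r, by ring⟩
  · rintro ⟨p, q, r, rfl⟩
    exact ⟨p, q * b + r * c, mem2.2 ⟨q, r, rfl⟩, by ring⟩

theorem mem4 {a b c d x : S} : x ∈ Ideal.span {a, b, c, d} ↔
    ∃ p q r s, x = p * a + q * b + r * c + s * d := by
  rw [Ideal.mem_span_insert]
  constructor
  · rintro ⟨p, z, hz, rfl⟩
    obtain ⟨q, r, s, rfl⟩ := mem3.1 hz
    exact ⟨p, q, r, s, by ring⟩
  · rintro ⟨p, q, r, s, rfl⟩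
    exact ⟨p, q * b + r * c + s * d, mem3.2 ⟨q, r, s, rfl⟩, by ring⟩

namespace ResData
variable {a b c d e u v w : S}

theorem syzD (h : ResData a b c d e u v w) (x y z : S)
    (H : x * (a * c - b * b) + y * (a * e - b * d) + z * (b * e - c * d) = 0) :
    ∃ p q, x = p * d + q * e ∧ y = - p * b - q * c ∧ z = p * a + q * b := by
  have h1 : z ∈ Ideal.span {a, b} := by
    apply h.ab
    refine mem2.2 ⟨x * c + y * e, - x * b - y * d + z * e, ?_⟩
    linear_combination -H
  obtain ⟨p, q, rfl⟩ := mem2.1 h1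
  obtain ⟨t, ht1, ht2⟩ := h.D12 (x - p * d - q * e) (y + p * b + q * c) (by linear_combination H)
  exact ⟨p - t * b, q + t * a, by linear_combination ht1, by linear_combination ht2, by ring⟩

theorem koszul3 (h : ResData a b c d e u v w) (x y z : S) (H : a * x + b * y + c * z = 0) :
    ∃ p q r, x = p * b + q * c ∧ y = - p * a + r * c ∧ z = - q * a - r * b := by
  obtain ⟨s, t, rfl⟩ := mem2.1 (h.kos3 x y z (by linear_combination H))
  obtain ⟨m, h1, h2⟩ := h.kos2 (x + s * c) (y + t * c) (by linear_combination H)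
  exact ⟨m, - s, - t, by linear_combination h1, by linear_combination h2, by ring⟩

end ResData

def mat1 (a b c d e u v w : S) : Matrix (Fin 1) (Fin 5) S :=
  !![a * c - b * b, a * e - b * d, b * e - c * d, u * c - b * w - a * v,
     u * e * e - d * e * w - d * d * v]

/-- columns are r1 r2 k1 k2 k3 g1 g2 g3 -/
def mat2 (a b c d e u v w : S) : Matrix (Fin 5) (Fin 8) S :=
  !![d, e, u * c - b * w - a * v, 0, 0, 0, 0, 0;
     -b, -c, 0, u * c - b * w - a * v, 0, u * e - w * d, d * v, v * e;
     a, b, 0, 0, u * c - b * w - a * v, u * d, u * e, e * w + v * d;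
     0, 0, -(a * c - b * b), -(a * e - b * d), -(b * e - c * d), d * d, d * e, e * e;
     0, 0, 0, 0, 0, -a, -b, -c]

/-- columns are s1 s2 s3 s4 s5 -/
def mat3 (a b c d e u v w : S) : Matrix (Fin 8) (Fin 5) S :=
  !![u * c - b * w - a * v, 0, u * e, w * e, - (v * e);
     0, u * c - b * w - a * v, - (u * d), - (w * d), v * d;
     -d, -e, 0, 0, 0;
     b, c, -d, -e, 0;
     -a, -b, 0, -d, -e;
     0, 0, b, c, 0;
     0, 0, -a, 0, c;
     0, 0, 0, -a, -b]

def mat4 (a b c d e : S) : Matrix (Fin 5) (Fin 1) S :=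
  !![-e; d; c; -b; a]

section
variable {a b c d e u v w : S}

theorem comp12 (x : Fin 8 → S) :
    (mat1 a b c d e u v w).mulVec ((mat2 a b c d e u v w).mulVec x) = 0 := by
  rw [Matrix.mulVec_mulVec]
  have : mat1 a b c d e u v w * mat2 a b c d e u v w = 0 := by
    ext i j
    fin_cases i; fin_cases j <;> simp [mat1, mat2, Matrix.mul_apply, Fin.sum_univ_succ] <;> ring
  rw [this, Matrix.zero_mulVec]

theorem comp23 (x : Fin 5 → S) :
    (mat2 a b c d e u v w).mulVec ((mat3 a b c d e u v w).mulVec x) = 0 := by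
  rw [Matrix.mulVec_mulVec]
  have : mat2 a b c d e u v w * mat3 a b c d e u v w = 0 := by
    ext i j
    fin_cases i <;> fin_cases j <;> simp [mat3, mat2, Matrix.mul_apply, Fin.sum_univ_succ] <;> ring
  rw [this, Matrix.zero_mulVec]

theorem comp34 (x : Fin 1 → S) :
    (mat3 a b c d e u v w).mulVec ((mat4 a b c d e).mulVec x) = 0 := by
  rw [Matrix.mulVec_mulVec]
  have : mat3 a b c d e u v w * mat4 a b c d e = 0 := by
    ext i j
    fin_cases j; fin_cases i <;> simp [mat3, mat4, Matrix.mul_apply, Fin.sum_univ_succ] <;> ring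
  rw [this, Matrix.zero_mulVec]

theorem exact1 (h : ResData a b c d e u v w) (x : Fin 5 → S)
    (hx : (mat1 a b c d e u v w).mulVec x = 0) : ∃ y, (mat2 a b c d e u v w).mulVec y = x := by
  have H := congrFun hx 0
  simp [mat1, Matrix.mulVec, dotProduct, Fin.sum_univ_succ] at H
  obtain ⟨p, q, r, h5⟩ := mem3.1 (h.CQ (x 4) (mem4.2 ⟨-x 0, -x 1, -x 2, -x 3, by
    linear_combination H⟩))
  obtain ⟨s0, s1, s2, h4⟩ := mem3.1 (h.QD (x 3 + p * (d * d) + q * (d * e) + r * (e * e))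
    (mem3.2 ⟨-x 0, -x 1 - (p * (u * e - w * d) + q * (d * v) + r * (v * e)),
      -x 2 - (p * (u * d) + q * (u * e) + r * (e * w + v * d)), by
      rw [h5] at H; linear_combination H⟩))
  obtain ⟨t1, t2, e1, e2, e3⟩ := h.syzD
    (x 0 + s0 * (u * c - b * w - a * v))
    (x 1 + p * (u * e - w * d) + q * (d * v) + r * (v * e) + s1 * (u * c - b * w - a * v))
    (x 2 + p * (u * d) + q * (u * e) + r * (e * w + v * d) + s2 * (u * c - b * w - a * v))
    (by rw [h5] at H; linear_combination H - (u * c - b * w - a * v) * h4)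
  refine ⟨![t1, t2, -s0, -s1, -s2, -p, -q, -r], ?_⟩
  ext i
  fin_cases i <;> simp [mat2, Matrix.mulVec, dotProduct, Fin.sum_univ_succ]
  · linear_combination -e1
  · linear_combination -e2
  · linear_combination -e3
  · linear_combination -h4
  · linear_combination -h5

theorem exact2 (h : ResData a b c d e u v w) (x : Fin 8 → S)
    (hx : (mat2 a b c d e u v w).mulVec x = 0) : ∃ y, (mat3 a b c d e u v w).mulVec y = x := by
  have H0 := congrFun hx 0
  have H1 := congrFun hx 1
  have H2 := congrFun hx 2
  have H3 := congrFun hx 3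
  have H4 := congrFun hx 4
  simp [mat2, Matrix.mulVec, dotProduct, Fin.sum_univ_succ] at H0 H1 H2 H3 H4
  obtain ⟨p, q, r, h5, h6, h7⟩ := h.koszul3 (x 5) (x 6) (x 7) (by linear_combination -H4)
  obtain ⟨t1, t2, e1, e2, e3⟩ := h.syzD (x 2) (x 3 + p * d + q * e) (x 4 + q * d + r * e)
    (by rw [h5, h6, h7] at H3; linear_combination -H3)
  set Q := u * c - b * w - a * v with hQ
  have k0 : (x 0 - u * e * p - w * e * q + v * e * r + t1 * Q) * d +
      (x 1 + u * d * p + w * d * q - v * d * r + t2 * Q) * e = 0 := by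
    linear_combination H0 - Q * e1
  have k1 : (x 0 - u * e * p - w * e * q + v * e * r + t1 * Q) * b +
      (x 1 + u * d * p + w * d * q - v * d * r + t2 * Q) * c = 0 := by
    rw [h5, h6, h7] at H1
    linear_combination -H1 + Q * e2 - (p * d + q * e) * hQ
  have k2 : (x 0 - u * e * p - w * e * q + v * e * r + t1 * Q) * a +
      (x 1 + u * d * p + w * d * q - v * d * r + t2 * Q) * b = 0 := by
    rw [h5, h6, h7] at H2
    linear_combination H2 - Q * e3 + (q * d + r * e) * hQ
  have z1 : x 0 - u * e * p - w * e * q + v * e * r + t1 * Q = 0 := by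
    refine (h.dom _ (a * c - b * b) ?_).resolve_right h.D1ne
    linear_combination c * k2 - b * k1
  have z2 : x 1 + u * d * p + w * d * q - v * d * r + t2 * Q = 0 := by
    refine (h.dom _ (a * c - b * b) ?_).resolve_right h.D1ne
    linear_combination a * k1 - b * k2
  refine ⟨![-t1, -t2, p, q, r], ?_⟩
  ext i
  fin_cases i <;> simp [mat3, Matrix.mulVec, dotProduct, Fin.sum_univ_succ]
  · linear_combination -z1
  · linear_combination -z2
  · linear_combination -e1
  · linear_combination -e2
  · linear_combination -e3
  · linear_combination -h5
  · linear_combination -h6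
  · linear_combination -h7

theorem exact3 (h : ResData a b c d e u v w) (x : Fin 5 → S)
    (hx : (mat3 a b c d e u v w).mulVec x = 0) : ∃ y, (mat4 a b c d e).mulVec y = x := by
  have H0 := congrFun hx 0
  have H1 := congrFun hx 1
  have H5 := congrFun hx 5
  have H6 := congrFun hx 6
  have H7 := congrFun hx 7
  simp [mat3, Matrix.mulVec, dotProduct, Fin.sum_univ_succ] at H0 H1 H5 H6 H7
  obtain ⟨z, h3, h4⟩ := h.kos2 (x 3) (x 4) (by linear_combination -H7)
  rw [h3] at H5
  rw [h4] at H6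
  have h2 : x 2 + c * z = 0 := by
    refine (h.dom _ (a * c - b * b) ?_).resolve_right h.D1ne
    linear_combination -c * H6 - b * H5
  have h0 : x 0 - e * z = 0 := by
    refine (h.dom _ (u * c - b * w - a * v) ?_).resolve_right h.Qne
    rw [h3, h4] at H0
    linear_combination H0 - u * e * h2
  have h1 : x 1 + d * z = 0 := by
    refine (h.dom _ (u * c - b * w - a * v) ?_).resolve_right h.Qne
    rw [h3, h4] at H1
    linear_combination H1 + u * d * h2
  refine ⟨![-z], ?_⟩
  ext i
  fin_cases i <;> simp [mat4, Matrix.mulVec, dotProduct]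
  · linear_combination -h0
  · linear_combination -h1
  · linear_combination -h2
  · linear_combination -h3
  · linear_combination -h4

theorem exact4 (h : ResData a b c d e u v w) (x : Fin 1 → S)
    (hx : (mat4 a b c d e).mulVec x = 0) : x = 0 := by
  have H := congrFun hx 2
  simp [mat4, Matrix.mulVec, dotProduct] at H
  ext i
  fin_cases i
  exact (h.dom _ _ H).resolve_left h.cne

end

/-- The Betti table in the statement. -/
def bt (i j : ℕ) : ℕ := match j, i with
  | 1, 1 => 4 | 1, 2 => 2
  | 2, 1 => 1 | 2, 2 => 6 | 2, 3 => 5 | 2, 4 => 1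
  | _, _ => 0

theorem minGr {K : Type} [Field K] {r : ℕ} {b₁ b₂ : ℕ → ℕ} {n n' k k' : ℕ} (m : ℕ)
    (e : ((j : ℕ) × Fin (b₁ j)) ≃ Fin n) (he : ∀ j t, rowOf k (e ⟨j, t⟩) = j)
    (e' : ((j : ℕ) × Fin (b₂ j)) ≃ Fin n') (he' : ∀ j t, rowOf k' (e' ⟨j, t⟩) = j)
    (M : Matrix (Fin n') (Fin n) (PS K r))
    (hM : ∀ i j, M i j = 0 ∨ ∃ dd, dd = 1 + rowOf k j - rowOf k' i ∧ rowOf k' i < 1 + rowOf k j ∧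
      (M i j).IsHomogeneous dd) :
    AMD.IsMinGrMap K r b₁ b₂ (m + 1) m (matMap e e' M) := by
  intro j t j' t'
  rw [matMap_single]
  rcases hM (e' ⟨j', t'⟩) (e ⟨j, t⟩) with h | ⟨dd, h1, h2, h3⟩
  · exact Or.inl h
  · rw [he, he'] at h1 h2
    exact Or.inr ⟨dd, by omega, by omega, h3⟩

set_option maxHeartbeats 4000000 in
theorem betti_of_resData {K : Type} [Field K] {r : ℕ} {a b c d e u v w : PS K r}
    (ha : a.IsHomogeneous 1) (hb : b.IsHomogeneous 1) (hc : c.IsHomogeneous 1)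
    (hd : d.IsHomogeneous 1) (he : e.IsHomogeneous 1) (hu : u.IsHomogeneous 1)
    (hv : v.IsHomogeneous 1) (hw : w.IsHomogeneous 1)
    (h : ResData a b c d e u v w) (I : Ideal (PS K r))
    (hI : I = Ideal.span {a * c - b * b, a * e - b * d, b * e - c * d, u * c - b * w - a * v,
     u * e * e - d * e * w - d * d * v}) :
    AMD.HasBettiDiagram K r I bt := by
  obtain ⟨e1, he1⟩ := exists_idx (bt 1) 4 1 rfl rfl
    (fun j h1 h2 => by unfold bt; split <;> simp_all)
  obtain ⟨e2, he2⟩ := exists_idx (bt 2) 2 6 rfl rfl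
    (fun j h1 h2 => by unfold bt; split <;> simp_all)
  obtain ⟨e3, he3⟩ := exists_idx (bt 3) 0 5 rfl rfl
    (fun j h1 h2 => by unfold bt; split <;> simp_all)
  obtain ⟨e4, he4⟩ := exists_idx (bt 4) 0 1 rfl rfl
    (fun j h1 h2 => by unfold bt; split <;> simp_all)
  have sub5 : ∀ i, Subsingleton (AMD.FreeGr K r (bt (i + 5))) := by
    intro i
    have : IsEmpty ((j : ℕ) × Fin (bt (i + 5) j)) := by
      refine ⟨fun x => ?_⟩
      have : bt (i + 5) x.1 = 0 := by unfold bt; split <;> simp_all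
      exact (Fin.cast this x.2).elim0
    infer_instance
  let ε : AMD.FreeGr K r (bt 1) →ₗ[PS K r] PS K r :=
    (LinearMap.proj (0 : Fin 1)) ∘ₗ (mat1 a b c d e u v w).mulVecLin ∘ₗ (toFun' e1).toLinearMap
  let φ : (i : ℕ) → (AMD.FreeGr K r (bt (i + 2)) →ₗ[PS K r] AMD.FreeGr K r (bt (i + 1))) :=
    fun i => match i with
      | 0 => matMap e2 e1 (mat2 a b c d e u v w)
      | 1 => matMap e3 e2 (mat3 a b c d e u v w)
      | 2 => matMap e4 e3 (mat4 a b c d e)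
      | (k + 3) => 0
  have hε : ∀ x, ε (Finsupp.single x 1) = mat1 a b c d e u v w 0 (e1 x) := by
    intro x
    simp [ε, toFun'_single]
  have q2 : ∀ {x y : PS K r}, x.IsHomogeneous 1 → y.IsHomogeneous 1 → (x * y).IsHomogeneous 2 :=
    fun hx hy => hx.mul hy
  have q3 : ∀ {x y z : PS K r}, x.IsHomogeneous 1 → y.IsHomogeneous 1 → z.IsHomogeneous 1 →
    (x * y * z).IsHomogeneous 3 :=
    fun hx hy hz => (hx.mul hy).mul hz
  refine ⟨φ, ε, ?_, ?_, ?_, ?_, ?_⟩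
  · intro j t
    rw [hε]
    have := he1 j t
    revert this
    generalize e1 ⟨j, t⟩ = x
    intro hx
    rw [← hx]
    fin_cases x <;> simp [mat1, rowOf]
    · exact (q2 ha hc).sub (q2 hb hb)
    · exact (q2 ha he).sub (q2 hb hd)
    · exact (q2 hb he).sub (q2 hc hd)
    · exact ((q2 hu hc).sub (q2 hb hw)).sub (q2 ha hv)
    · exact ((q3 hu he he).sub (q3 hd he hw)).sub (q3 hd hd hv)
  · have QQ := ((q2 hu hc).sub (q2 hb hw)).sub (q2 ha hv)
    rintro (_ | _ | _ | k)
    · refine minGr _ e2 he2 e1 he1 _ ?_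
      intro i j
      fin_cases i <;> fin_cases j <;> simp [mat2, rowOf, -neg_sub] <;> right <;>
      first
      | assumption
      | exact hb.neg
      | exact hc.neg
      | exact ha.neg
      | exact ((q2 ha hc).sub (q2 hb hb)).neg
      | exact ((q2 ha he).sub (q2 hb hd)).neg
      | exact ((q2 hb he).sub (q2 hc hd)).neg
      | exact (q2 hu he).sub (q2 hw hd)
      | exact (q2 he hw).add (q2 hv hd)
      | (apply q2 <;> assumption)
    · refine minGr _ e3 he3 e2 he2 _ ?_
      intro i j
      fin_cases i <;> fin_cases j <;> simp [mat3, rowOf, -neg_sub] <;> right <;>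
      first
      | assumption
      | exact hb.neg
      | exact hc.neg
      | exact ha.neg
      | exact hd.neg
      | exact he.neg
      | (apply q2 <;> assumption)
      | exact (q2 hv he).neg
      | exact (q2 hu hd).neg
      | exact (q2 hw hd).neg
    · refine minGr _ e4 he4 e3 he3 _ ?_
      intro i j
      fin_cases i <;> fin_cases j <;> simp [mat4, rowOf, -neg_sub] <;> right <;>
      first
      | assumption
      | exact hb.neg
      | exact hc.neg
      | exact ha.neg
      | exact hd.neg
      | exact he.neg
    · intro j t j' t'
      exact Or.inl rfl
  · rw [hI]
    apply le_antisymm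
    · rintro _ ⟨x, rfl⟩
      simp only [ε, LinearMap.comp_apply, LinearMap.proj_apply, Matrix.mulVecLin_apply,
        LinearEquiv.coe_coe]
      generalize (toFun' e1) x = y
      simp [mat1, Matrix.mulVec, dotProduct, Fin.sum_univ_succ]
      refine add_mem ?_ (add_mem ?_ (add_mem ?_ (add_mem ?_ ?_))) <;>
        apply Ideal.mul_mem_right _ _ (Ideal.subset_span _) <;> simp
    · rw [Ideal.span_le]
      rintro x hx
      have key : ∀ k : Fin 5, mat1 a b c d e u v w 0 k ∈ LinearMap.range ε := by
        intro k
        refine ⟨Finsupp.single (e1.symm k) 1, ?_⟩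
        rw [hε]; simp
      simp only [Set.mem_insert_iff, Set.mem_singleton_iff] at hx
      rcases hx with rfl | rfl | rfl | rfl | rfl
      · exact key 0
      · exact key 1
      · exact key 2
      · exact key 3
      · exact key 4
  · have : LinearMap.ker ε = LinearMap.ker (matMap e1 (Equiv.refl (Fin 1)) (mat1 a b c d e u v w)) := by
      ext x
      simp only [ε, matMap, LinearMap.mem_ker, LinearMap.comp_apply, LinearMap.proj_apply,
        Matrix.mulVecLin_apply, LinearEquiv.coe_coe, LinearEquiv.map_eq_zero_iff]
      constructor
      · intro h; funext i; fin_cases i; exact h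
      · intro h; rw [h]; rfl
    rw [this]
    exact matMap_exact _ _ _ _ _ (exact1 h) comp12
  · rintro (_ | _ | _ | k)
    · exact matMap_exact _ _ _ _ _ (exact2 h) comp23
    · exact matMap_exact _ _ _ _ _ (exact3 h) comp34
    · change LinearMap.ker (matMap e4 e3 (mat4 a b c d e)) = LinearMap.range (0 : AMD.FreeGr K r (bt 5) →ₗ[PS K r] AMD.FreeGr K r (bt 4))
      rw [LinearMap.range_zero, LinearMap.ker_eq_bot']
      intro x hx
      simp only [matMap, LinearMap.comp_apply,
        Matrix.mulVecLin_apply, LinearEquiv.coe_coe, LinearEquiv.map_eq_zero_iff] at hx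
      simpa using exact4 h _ hx
    · have := sub5 k
      ext x
      have : x = 0 := Subsingleton.elim _ _
      subst this
      simp

end AMDP

open MvPolynomial
namespace AMDP

section vars
variable {σ K : Type} [Field K]

open Classical in
/-- kill the variables in `s` -/
def kill (s : Set σ) : MvPolynomial σ K →ₐ[K] MvPolynomial σ K :=
  aeval (fun i => if i ∈ s then 0 else X i)

theorem sub_kill_mem (s : Set σ) (f : MvPolynomial σ K) :
    f - kill s f ∈ Ideal.span ((X : σ → MvPolynomial σ K) '' s) := by
  induction f using MvPolynomial.induction_on with
  | C a => simp [kill, algebraMap_eq]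
  | add p q hp hq =>
    rw [map_add]
    convert add_mem hp hq using 1
    ring
  | mul_X p i hp =>
    rw [map_mul]
    by_cases hi : i ∈ s
    · have : kill s (X i : MvPolynomial σ K) = 0 := by simp [kill, hi]
      rw [this, mul_zero, sub_zero]
      exact Ideal.mul_mem_left _ _ (Ideal.subset_span ⟨i, hi, rfl⟩)
    · have : kill s (X i : MvPolynomial σ K) = X i := by simp [kill, hi]
      rw [this, ← sub_mul]
      exact Ideal.mul_mem_right _ _ hp

theorem mem_span_X {s : Set σ} {f : MvPolynomial σ K} :
    f ∈ Ideal.span ((X : σ → MvPolynomial σ K) '' s) ↔ kill s f = 0 := by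
  constructor
  · intro h
    have : Ideal.span ((X : σ → MvPolynomial σ K) '' s) ≤ RingHom.ker (kill (K := K) s) := by
      rw [Ideal.span_le]
      rintro _ ⟨i, hi, rfl⟩
      simp [kill, hi]
    exact this h
  · intro h
    simpa [h] using sub_kill_mem s f

theorem span_X_mul {s : Set σ} {f g : MvPolynomial σ K}
    (h : f * g ∈ Ideal.span ((X : σ → MvPolynomial σ K) '' s))
    (hg : g ∉ Ideal.span ((X : σ → MvPolynomial σ K) '' s)) :
    f ∈ Ideal.span ((X : σ → MvPolynomial σ K) '' s) := by
  rw [mem_span_X] at *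
  rw [map_mul] at h
  exact (mul_eq_zero.1 h).resolve_right hg

theorem X_not_mem {s : Set σ} {i : σ} (hi : i ∉ s) :
    (X i : MvPolynomial σ K) ∉ Ideal.span ((X : σ → MvPolynomial σ K) '' s) := by
  rw [mem_span_X]
  simp [kill, hi]

theorem img1 (i : σ) : ({X i} : Set (MvPolynomial σ K)) = X '' {i} := by simp
theorem img2 (i j : σ) : ({X i, X j} : Set (MvPolynomial σ K)) = X '' {i, j} := by
  simp [Set.image_insert_eq]
theorem img3 (i j k : σ) : ({X i, X j, X k} : Set (MvPolynomial σ K)) = X '' {i, j, k} := by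
  simp [Set.image_insert_eq]

theorem vkos2 {i j : σ} (hij : i ≠ j) (x y : MvPolynomial σ K) (h : x * X i + y * X j = 0) :
    ∃ z, x = z * X j ∧ y = - z * X i := by
  have : y ∈ Ideal.span {(X i : MvPolynomial σ K)} := by
    rw [img1]
    refine span_X_mul (g := X j) ?_ (X_not_mem (by simpa using hij.symm))
    rw [← img1]
    exact Ideal.mem_span_singleton'.2 ⟨-x, by linear_combination -h⟩
  obtain ⟨z, rfl⟩ := Ideal.mem_span_singleton'.1 this
  refine ⟨-z, ?_, by ring⟩
  have hx : X i * (x + z * X j) = 0 := by linear_combination h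
  have := (mul_eq_zero.1 hx).resolve_left (X_ne_zero i)
  linear_combination this

theorem vkos3 {i j k : σ} (hik : k ≠ i) (hjk : k ≠ j) (x y z : MvPolynomial σ K)
    (h : x * X i + y * X j + z * X k = 0) : z ∈ Ideal.span {(X i : MvPolynomial σ K), X j} := by
  rw [img2]
  refine span_X_mul (g := X k) ?_ (X_not_mem (by simp [hik, hjk]))
  rw [← img2]
  exact mem2.2 ⟨-x, -y, by linear_combination h⟩

theorem koszul3' {i j k : σ} (hij : i ≠ j) (hik : k ≠ i) (hjk : k ≠ j) (x y z : MvPolynomial σ K)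
    (H : x * X i + y * X j + z * X k = 0) :
    ∃ p q r, x = p * X j + q * X k ∧ y = - p * X i + r * X k ∧ z = - q * X i - r * X j := by
  obtain ⟨s, t, rfl⟩ := mem2.1 (vkos3 hik hjk x y z H)
  obtain ⟨m, h1, h2⟩ := vkos2 hij (x + s * X k) (y + t * X k) (by linear_combination H)
  exact ⟨m, - s, - t, by linear_combination h1, by linear_combination h2, by ring⟩

variable {a b c d e : σ}

theorem vD12 (hdist : [a, b, c, d, e].Nodup) (x y : MvPolynomial σ K)
    (h : x * (X a * X c - X b * X b) + y * (X a * X e - X b * X d) = 0) :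
    ∃ z, x = z * (X a * X e - X b * X d) ∧ y = - z * (X a * X c - X b * X b) := by
  classical
  simp only [List.nodup_cons, List.mem_cons, List.not_mem_nil, not_or, or_false] at hdist
  obtain ⟨⟨hab, hac, had, hae⟩, ⟨hbc, hbd, hbe⟩, ⟨hcd, hce⟩, hde, -⟩ := hdist
  have hirr : Irreducible (X a * X e + (-(X b * X d)) : MvPolynomial σ K) := by
    apply irreducible_mul_X_add
    · exact X_ne_zero a
    · simp [Ne.symm hae]
    · rw [vars_neg]
      intro hm
      have := vars_mul _ _ hm
      simp at this
      rcases this with h | h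
      · exact hbe h.symm
      · exact hde h.symm
    · rw [IsRelPrime.neg_right_iff]
      refine IsRelPrime.mul_right ?_ ?_
      · rw [(X_prime (R := K) (i := a)).irreducible.isRelPrime_iff_not_dvd]
        rw [X_dvd_X]; simp [hab]
      · rw [(X_prime (R := K) (i := a)).irreducible.isRelPrime_iff_not_dvd]
        rw [X_dvd_X]; simp [had]
  rw [← sub_eq_add_neg] at hirr
  have hpr := hirr.prime
  have hnd : ¬ (X a * X e - X b * X d : MvPolynomial σ K) ∣ (X a * X c - X b * X b) := by
    rintro ⟨q, hq⟩
    have := congrArg (MvPolynomial.eval (fun i => if i = b then (1 : K) else 0)) hq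
    simp [hab, Ne.symm hbd] at this
  have hdx : (X a * X e - X b * X d : MvPolynomial σ K) ∣ x := by
    refine (hpr.dvd_or_dvd (a := x) (b := X a * X c - X b * X b) ⟨-y, ?_⟩).resolve_right hnd
    linear_combination h
  obtain ⟨z, rfl⟩ := hdx
  refine ⟨z, by ring, ?_⟩
  have : (X a * X e - X b * X d) * (y + z * (X a * X c - X b * X b)) = 0 := by
    linear_combination h
  have := (mul_eq_zero.1 this).resolve_left hpr.ne_zero
  linear_combination this

theorem vab (hdist : [a, b, c, d, e].Nodup) (x : MvPolynomial σ K)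
    (h : x * (X c * X d) ∈ Ideal.span {(X a : MvPolynomial σ K), X b}) :
    x ∈ Ideal.span {(X a : MvPolynomial σ K), X b} := by
  simp only [List.nodup_cons, List.mem_cons, List.not_mem_nil, not_or, or_false] at hdist
  obtain ⟨⟨hab, hac, had, hae⟩, ⟨hbc, hbd, hbe⟩, ⟨hcd, hce⟩, hde, -⟩ := hdist
  rw [img2] at *
  rw [← mul_assoc] at h
  refine span_X_mul (span_X_mul h (X_not_mem ?_)) (X_not_mem ?_)
  · simp [Ne.symm had, Ne.symm hbd]
  · simp [Ne.symm hac, Ne.symm hbc]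

theorem va_nzd (hdist : [a, b, c, d, e].Nodup) (f : MvPolynomial σ K)
    (h : X a * f ∈ Ideal.span {(X a * X c - X b * X b : MvPolynomial σ K), X a * X e - X b * X d,
      X b * X e - X c * X d}) :
    f ∈ Ideal.span {(X a * X c - X b * X b : MvPolynomial σ K), X a * X e - X b * X d,
      X b * X e - X c * X d} := by
  have hd' := hdist
  simp only [List.nodup_cons, List.mem_cons, List.not_mem_nil, not_or, or_false] at hdist
  obtain ⟨⟨hab, hac, had, hae⟩, ⟨hbc, hbd, hbe⟩, ⟨hcd, hce⟩, hde, -⟩ := hdist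
  obtain ⟨α, β, γ, H⟩ := mem3.1 h
  have h1 : γ ∈ Ideal.span {(X a : MvPolynomial σ K), X b} := by
    apply vab hd'
    refine mem2.2 ⟨α * X c + β * X e - f, - α * X b - β * X d + γ * X e, ?_⟩
    linear_combination H
  obtain ⟨γ2, γ1, rfl⟩ := mem2.1 h1
  have h2 : ∃ ρ, (α - γ1 * X e - γ2 * X d) * X b + (β + γ1 * X c + γ2 * X b) * X d = ρ * X a := by
    have : (α - γ1 * X e - γ2 * X d) * X b + (β + γ1 * X c + γ2 * X b) * X d ∈
        Ideal.span {(X a : MvPolynomial σ K)} := by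
      rw [img1]
      refine span_X_mul (g := X b) ?_ (X_not_mem (by simpa using Ne.symm hab))
      rw [← img1]
      refine Ideal.mem_span_singleton'.2
        ⟨(α - γ1 * X e - γ2 * X d) * X c + (β + γ1 * X c + γ2 * X b) * X e - f, ?_⟩
      linear_combination -H
    obtain ⟨ρ, hρ⟩ := Ideal.mem_span_singleton'.1 this
    exact ⟨ρ, hρ.symm⟩
  obtain ⟨ρ, hρ⟩ := h2
  have hf : f = (α - γ1 * X e - γ2 * X d) * X c + (β + γ1 * X c + γ2 * X b) * X e - X b * ρ := by
    apply mul_left_cancel₀ (X_ne_zero (R := K) a)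
    linear_combination H - X b * hρ
  obtain ⟨p, q, r, e1, e2, e3⟩ := koszul3' hab (Ne.symm had) (Ne.symm hbd)
    (-ρ) (α - γ1 * X e - γ2 * X d) (β + γ1 * X c + γ2 * X b) (by linear_combination hρ)
  refine mem3.2 ⟨-p, -q, -r, ?_⟩
  rw [hf, e2, e3]
  linear_combination X b * e1

/-- The kernel of a scroll parametrisation is generated by the minors. -/
theorem kerD {E : Type} [CommRing E] [IsDomain E] (π : MvPolynomial σ K →+* E)
    (hdist : [a, b, c, d, e].Nodup)
    (ha : π (X a) ≠ 0) (h1 : π (X a * X c - X b * X b) = 0) (h2 : π (X a * X e - X b * X d) = 0)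
    (hinj : ∀ g : MvPolynomial σ K, π (kill {c, e} g) = 0 → kill {c, e} g = 0)
    (f : MvPolynomial σ K) (hf : π f = 0) :
    f ∈ Ideal.span {(X a * X c - X b * X b : MvPolynomial σ K), X a * X e - X b * X d,
      X b * X e - X c * X d} := by
  have hd' := hdist
  simp only [List.nodup_cons, List.mem_cons, List.not_mem_nil, not_or, or_false] at hdist
  obtain ⟨⟨hab, hac, had, hae⟩, ⟨hbc, hbd, hbe⟩, ⟨hcd, hce⟩, hde, -⟩ := hdist
  have h3 : π (X b * X e - X c * X d) = 0 := by
    have : π (X a) * π (X b * X e - X c * X d) = 0 := by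
      rw [← map_mul]
      have : X a * (X b * X e - X c * X d) = X b * (X a * X e - X b * X d)
        - X d * (X a * X c - X b * X b : MvPolynomial σ K) := by ring
      rw [this, map_sub, map_mul, map_mul, h1, h2]; simp
    exact (mul_eq_zero.1 this).resolve_left ha
  set D := Ideal.span {(X a * X c - X b * X b : MvPolynomial σ K), X a * X e - X b * X d,
      X b * X e - X c * X d} with hD
  have hDle : ∀ x ∈ D, π x = 0 := by
    intro x hx
    obtain ⟨p, q, r, rfl⟩ := mem3.1 hx
    simp only [map_add, map_mul, h1, h2, h3]; simp
  have D1 : X a * X c - X b * X b ∈ D := Ideal.subset_span (by simp)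
  have D2 : X a * X e - X b * X d ∈ D := Ideal.subset_span (by simp)
  have kX : ∀ i, i ≠ c → i ≠ e → kill {c, e} (X i : MvPolynomial σ K) = X i := by
    intro i h h'
    simp [kill, h, h']
  have key : ∀ f : MvPolynomial σ K, ∃ N, ∃ g, X a ^ N * f - kill {c, e} g ∈ D := by
    intro f
    induction f using MvPolynomial.induction_on with
    | C x => exact ⟨0, C x, by simp [kill, algebraMap_eq]⟩
    | add p q hp hq =>
      obtain ⟨N, g, hg⟩ := hp
      obtain ⟨N', g', hg'⟩ := hq
      refine ⟨N + N', X a ^ N' * g + X a ^ N * g', ?_⟩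
      rw [map_add, map_mul, map_mul, map_pow, map_pow, kX a hac hae]
      convert add_mem (Ideal.mul_mem_left _ (X a ^ N') hg) (Ideal.mul_mem_left _ (X a ^ N) hg')
        using 1
      ring
    | mul_X p i hp =>
      obtain ⟨N, g, hg⟩ := hp
      by_cases hic : i = c
      · subst hic
        refine ⟨N + 1, X b * X b * g, ?_⟩
        rw [map_mul, map_mul, kX b hbc hbe]
        convert add_mem (Ideal.mul_mem_left _ (X a * X i) hg)
          (Ideal.mul_mem_left _ (kill {i, e} g) D1) using 1
        ring
      · by_cases hie : i = e
        · subst hie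
          refine ⟨N + 1, X b * X d * g, ?_⟩
          rw [map_mul, map_mul, kX b hbc hbe, kX d (Ne.symm hcd) hde]
          convert add_mem (Ideal.mul_mem_left _ (X a * X i) hg)
            (Ideal.mul_mem_left _ (kill {c, i} g) D2) using 1
          ring
        · refine ⟨N, g * X i, ?_⟩
          rw [map_mul, kX i hic hie]
          convert Ideal.mul_mem_right (X i) _ hg using 1
          ring
  obtain ⟨N, g, hg⟩ := key f
  have := hDle _ hg
  rw [map_sub, map_mul, hf, mul_zero, zero_sub, neg_eq_zero] at this
  rw [hinj g this, sub_zero] at hg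
  clear this
  induction N with
  | zero => simpa using hg
  | succ n ih =>
    apply ih
    apply va_nzd hd'
    rw [← hD]
    convert hg using 1
    ring

theorem resData_vars {E : Type} [CommRing E] [IsDomain E] (π : MvPolynomial σ K →+* E)
    (hdist : [a, b, c, d, e].Nodup)
    (ha : π (X a) ≠ 0) (h1 : π (X a * X c - X b * X b) = 0) (h2 : π (X a * X e - X b * X d) = 0)
    (hinj : ∀ g : MvPolynomial σ K, π (kill {c, e} g) = 0 → kill {c, e} g = 0)
    (u v w : MvPolynomial σ K) (hQ : π (u * X c - X b * w - X a * v) ≠ 0)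
    (hC : u * X e * X e - X d * X e * w - X d * X d * v ∉
      Ideal.span {(X a : MvPolynomial σ K), X b, X c}) :
    ResData (X a) (X b) (X c) (X d) (X e) u v w := by
  have hd' := hdist
  simp only [List.nodup_cons, List.mem_cons, List.not_mem_nil, not_or, or_false] at hdist
  obtain ⟨⟨hab, hac, had, hae⟩, ⟨hbc, hbd, hbe⟩, ⟨hcd, hce⟩, hde, -⟩ := hdist
  have h3 : π (X b * X e - X c * X d) = 0 := by
    have : π (X a) * π (X b * X e - X c * X d) = 0 := by
      rw [← map_mul]
      have : X a * (X b * X e - X c * X d) = X b * (X a * X e - X b * X d)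
        - X d * (X a * X c - X b * X b : MvPolynomial σ K) := by ring
      rw [this, map_sub, map_mul, map_mul, h1, h2]; simp
    exact (mul_eq_zero.1 this).resolve_left ha
  constructor
  · intro x y h; exact mul_eq_zero.1 h
  · exact X_ne_zero _
  · intro h
    classical
    have := congrArg (MvPolynomial.eval (fun i => if i = b then (1 : K) else 0)) h
    simp [hab] at this
  · rintro h; rw [h] at hQ; simp at hQ
  · exact vab hd'
  · exact vD12 hd'
  · intro x hx
    apply kerD π hd' ha h1 h2 hinj
    obtain ⟨p, q, r, h⟩ := mem3.1 hx
    have := congrArg π h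
    rw [map_add, map_add, map_mul, map_mul, map_mul, map_mul, h1, h2, h3] at this
    simp only [mul_zero, add_zero] at this
    exact (mul_eq_zero.1 this).resolve_right hQ
  · intro x hx
    rw [img3] at *
    refine span_X_mul ?_ hC
    rw [← img3]
    obtain ⟨p, q, r, s, h⟩ := mem4.1 hx
    rw [h]
    exact mem3.2 ⟨p * X c + q * X e - s * v, - p * X b - q * X d + r * X e - s * w,
      - r * X d + s * u, by ring⟩
  · exact vkos2 hab
  · exact vkos3 (Ne.symm hac) (Ne.symm hbc)

end vars
end AMDP

open MvPolynomial
set_option linter.unusedSectionVars false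
namespace AMDP

variable {K : Type} [Field K] {σ τ : Type} [Fintype σ] [Fintype τ]

theorem lin_eq_sum {f : MvPolynomial σ K} (hf : f.IsHomogeneous 1) :
    ∃ c : σ → K, f = ∑ i, c i • X i := by
  have : f ∈ homogeneousSubmodule σ K 1 := hf
  rw [homogeneousSubmodule_one_eq_span_X, Submodule.mem_span_range_iff_exists_fun] at this
  obtain ⟨c, hc⟩ := this
  exact ⟨c, hc.symm⟩

theorem homog_sum (c : σ → K) (L : σ → MvPolynomial τ K) (hL : ∀ i, (L i).IsHomogeneous 1) :
    (∑ i, c i • L i).IsHomogeneous 1 := by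
  have : ∑ i, c i • L i ∈ homogeneousSubmodule τ K 1 :=
    Submodule.sum_mem _ fun i _ => Submodule.smul_mem _ _ (hL i)
  exact this

theorem linearIndependent_X' : LinearIndependent K (X : σ → MvPolynomial σ K) := by
  rw [Fintype.linearIndependent_iff]
  intro g hg i
  have := congrArg (coeff (Finsupp.single i 1)) hg
  classical
  simpa [coeff_sum, coeff_X, Finsupp.single_left_inj] using this

theorem finrank_lin : Module.finrank K (homogeneousSubmodule σ K 1) = Fintype.card σ := by
  rw [homogeneousSubmodule_one_eq_span_X]
  exact finrank_span_eq_card linearIndependent_X'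

instance finite_hom (n : ℕ) : Module.Finite K (homogeneousSubmodule σ K n) :=
  Module.Finite.of_fg (homogeneousSubmodule_fg σ K n)

theorem exists_coord (hc : Fintype.card τ = Fintype.card σ) (L : τ → MvPolynomial σ K)
    (hL : ∀ s, (L s).IsHomogeneous 1) (hind : LinearIndependent K L) :
    ∃ Ω : MvPolynomial τ K ≃ₐ[K] MvPolynomial σ K, (∀ s, Ω (X s) = L s) ∧
      ∀ i, (Ω.symm (X i)).IsHomogeneous 1 := by
  have hspan : Submodule.span K (Set.range L) = homogeneousSubmodule σ K 1 := by
    apply Submodule.eq_of_le_of_finrank_eq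
    · rw [Submodule.span_le]; rintro _ ⟨s, rfl⟩; exact hL s
    · rw [finrank_span_eq_card hind, finrank_lin, hc]
  have h1 : ∀ i : σ, ∃ c : τ → K, ∑ s, c s • L s = X i := by
    intro i
    rw [← Submodule.mem_span_range_iff_exists_fun, hspan]
    exact isHomogeneous_X _ _
  choose c hcc using h1
  let Ω : MvPolynomial τ K →ₐ[K] MvPolynomial σ K := aeval L
  let Ψ : MvPolynomial σ K →ₐ[K] MvPolynomial τ K := aeval fun i => ∑ s, c i s • X s
  have hΩΨ : Ω.comp Ψ = AlgHom.id K _ := by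
    ext1 i
    simp [Ω, Ψ, hcc]
  have hΨΩ : Ψ.comp Ω = AlgHom.id K _ := by
    ext1 s
    have : (Ψ (L s)).IsHomogeneous 1 := by
      obtain ⟨b, hb⟩ := lin_eq_sum (hL s)
      rw [hb, map_sum]
      simp only [map_smul]
      apply homog_sum
      intro i
      simp only [Ψ, aeval_X]
      exact homog_sum _ _ fun s => isHomogeneous_X _ _
    obtain ⟨b, hb⟩ := lin_eq_sum this
    have h2 : Ω (Ψ (L s)) = L s := DFunLike.congr_fun hΩΨ (L s)
    rw [hb] at h2
    simp only [map_sum, map_smul, Ω, aeval_X] at h2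
    classical
    have h3 : ∑ t, (b t - if t = s then 1 else 0) • L t = 0 := by
      simp [sub_smul, h2]
    have h4 := Fintype.linearIndependent_iff.1 hind _ h3
    simp only [AlgHom.comp_apply, AlgHom.id_apply, Ω, aeval_X]
    rw [hb]
    have h5 : ∀ t, b t = if t = s then 1 else 0 := fun t => sub_eq_zero.1 (h4 t)
    simp [h5]
  refine ⟨AlgEquiv.ofAlgHom Ω Ψ hΩΨ hΨΩ, ?_, ?_⟩
  · intro s; simp [Ω]
  · intro i
    have : (AlgEquiv.ofAlgHom Ω Ψ hΩΨ hΨΩ).symm (X i) = ∑ s, c i s • X s := by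
      change Ψ (X i) = _
      simp [Ψ]
    rw [this]
    exact homog_sum _ _ fun s => isHomogeneous_X _ _

theorem homog_map (φ : MvPolynomial τ K →ₐ[K] MvPolynomial σ K)
    (h : ∀ s, (φ (X s)).IsHomogeneous 1) {n : ℕ} {f : MvPolynomial τ K} (hf : f.IsHomogeneous n) :
    (φ f).IsHomogeneous n := by
  have : φ = aeval fun s => φ (X s) := by ext1 s; simp
  rw [this]
  simpa using hf.aeval (fun s => φ (X s)) (n := 1) (fun s => h s)

/-- transport of the resolution data along a ring isomorphism -/
theorem ResData.transport {S T : Type} [CommRing S] [CommRing T] (Ω : S ≃+* T)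
    {a b c d e u v w : S} (h : ResData a b c d e u v w) :
    ResData (Ω a) (Ω b) (Ω c) (Ω d) (Ω e) (Ω u) (Ω v) (Ω w) := by
  have m2 : ∀ x p q, x ∈ Ideal.span {Ω p, Ω q} ↔ Ω.symm x ∈ Ideal.span {p, q} := by
    intro x p q
    have := Ideal.comap_symm (I := Ideal.span {p, q}) Ω
    rw [← Ideal.mem_comap, this, Ideal.map_span]
    simp [Set.image_insert_eq]
  have m3 : ∀ x p q r, x ∈ Ideal.span {Ω p, Ω q, Ω r} ↔ Ω.symm x ∈ Ideal.span {p, q, r} := by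
    intro x p q r
    have := Ideal.comap_symm (I := Ideal.span {p, q, r}) Ω
    rw [← Ideal.mem_comap, this, Ideal.map_span]
    simp [Set.image_insert_eq]
  have m4 : ∀ x p q r s, x ∈ Ideal.span {Ω p, Ω q, Ω r, Ω s} ↔
      Ω.symm x ∈ Ideal.span {p, q, r, s} := by
    intro x p q r s
    have := Ideal.comap_symm (I := Ideal.span {p, q, r, s}) Ω
    rw [← Ideal.mem_comap, this, Ideal.map_span]
    simp [Set.image_insert_eq]
  have inj : ∀ x y : T, x = y ↔ Ω.symm x = Ω.symm y := fun x y => by simp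
  constructor
  · intro x y hxy
    have := h.dom (Ω.symm x) (Ω.symm y) (by rw [← map_mul, hxy, map_zero])
    simpa using this
  · simpa using h.cne
  · have := h.D1ne
    rw [Ne, inj]; simpa using this
  · have := h.Qne
    rw [Ne, inj]; simpa using this
  · intro x
    rw [m2, m2]
    intro hx
    exact h.ab _ (by simpa using hx)
  · intro x y hxy
    obtain ⟨z, h1, h2⟩ := h.D12 (Ω.symm x) (Ω.symm y) (by
      rw [inj] at hxy; simpa using hxy)
    refine ⟨Ω z, ?_, ?_⟩
    · rw [inj, h1]; simp
    · rw [inj, h2]; simp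
  · intro x
    simp only [← map_mul, ← map_sub]
    rw [m3, m3]
    intro hx
    exact h.QD _ (by simpa using hx)
  · intro x
    simp only [← map_mul, ← map_sub]
    rw [m4, m3]
    intro hx
    exact h.CQ _ (by simpa using hx)
  · intro x y hxy
    obtain ⟨z, h1, h2⟩ := h.kos2 (Ω.symm x) (Ω.symm y) (by
      rw [inj] at hxy; simpa using hxy)
    refine ⟨Ω z, ?_, ?_⟩
    · rw [inj, h1]; simp
    · rw [inj, h2]; simp
  · intro x y z hxy
    have := h.kos3 (Ω.symm x) (Ω.symm y) (Ω.symm z) (by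
      rw [inj] at hxy; simpa using hxy)
    rwa [m2]

/-- cone criterion -/
theorem cone_of_subspace {r : ℕ} (I : Ideal (PS K r)) (H : Submodule K (PS K r))
    (hH : H < homogeneousSubmodule (Fin (r + 1)) K 1)
    (hI : ∀ f ∈ I, f ∈ Ideal.span ((I : Set (PS K r)) ∩ Algebra.adjoin K (H : Set (PS K r)))) :
    AMD.IsConeIdeal K r I := by
  -- enlarge H to a hyperplane with a basis
  obtain ⟨x, hx1, hx2⟩ := SetLike.exists_of_lt hH
  obtain ⟨H', hH', hHH', hxH', hfr⟩ : ∃ H' : Submodule K (PS K r),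
      H' ≤ homogeneousSubmodule (Fin (r + 1)) K 1 ∧ H ≤ H' ∧ x ∉ H' ∧
      H' ⊔ Submodule.span K {x} = homogeneousSubmodule (Fin (r + 1)) K 1 := by
    obtain ⟨f, hf, hfH⟩ := Submodule.exists_le_ker_of_notMem hx2
    refine ⟨LinearMap.ker f ⊓ homogeneousSubmodule (Fin (r + 1)) K 1, inf_le_right,
      le_inf hfH hH.le, fun h => hf h.1, ?_⟩
    apply le_antisymm
    · refine sup_le inf_le_right ?_
      rw [Submodule.span_le]; simpa using hx1
    · intro y hy
      rw [Submodule.mem_sup]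
      refine ⟨y - (f y / f x) • x, ⟨?_, ?_⟩, (f y / f x) • x,
        Submodule.smul_mem _ _ (Submodule.mem_span_singleton_self x), by simp⟩
      · have : f x ≠ 0 := hf
        simp [this]
      · exact Submodule.sub_mem _ hy (Submodule.smul_mem _ _ hx1)
  have hdisj : Disjoint H' (Submodule.span K {x}) := by
    rw [Submodule.disjoint_span_singleton' (by rintro rfl; exact hxH' (zero_mem _))]
    exact hxH'
  have hx0 : x ≠ 0 := by rintro rfl; exact hxH' (zero_mem _)
  have : Module.Finite K H' := Submodule.finiteDimensional_of_le hH'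
  have hfr' : Module.finrank K H' = r := by
    have := Submodule.finrank_sup_add_finrank_inf_eq H' (Submodule.span K {x})
    rw [hfr, hdisj.eq_bot, finrank_lin, finrank_span_singleton hx0] at this
    simp at this
    omega
  let b := Module.finBasisOfFinrankEq K H' hfr'
  let L : Fin (r + 1) → PS K r := Fin.snoc (fun i => (b i : PS K r)) x
  have hspanb : Submodule.span K (Set.range fun i => (b i : PS K r)) = H' := by
    have := b.span_eq
    have h2 := congrArg (Submodule.map H'.subtype) this
    rw [Submodule.map_span, ← Set.range_comp, Submodule.map_top, Submodule.range_subtype] at h2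
    exact h2
  have hind : LinearIndependent K L := by
    apply LinearIndependent.finSnoc
    · exact b.linearIndependent.map' H'.subtype (Submodule.ker_subtype _)
    · rw [hspanb]; exact hxH'
  have hL : ∀ i, (L i).IsHomogeneous 1 := by
    intro i
    refine Fin.lastCases ?_ (fun j => ?_) i
    · simp only [L, Fin.snoc_last]; exact hx1
    · simp only [L, Fin.snoc_castSucc]; exact hH' (b j).2
  obtain ⟨Ω, hΩ, hΩ'⟩ := exists_coord rfl L hL hind
  refine ⟨Ω.symm, hΩ', Ideal.comap (((Ω : PS K r →ₐ[K] PS K r).comp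
    (rename (Fin.castSucc : Fin r → Fin (r + 1)))) : MvPolynomial (Fin r) K →ₐ[K] PS K r) I, ?_⟩
  have hadj : ∀ g ∈ Algebra.adjoin K (H : Set (PS K r)),
      ∃ g' : MvPolynomial (Fin r) K, Ω (rename Fin.castSucc g') = g := by
    intro g hg
    have : Algebra.adjoin K (H : Set (PS K r)) ≤ ((Ω : PS K r →ₐ[K] PS K r).comp
      (rename (Fin.castSucc : Fin r → Fin (r + 1)))).range := by
      rw [Algebra.adjoin_le_iff]
      have h1 : (H' : Set (PS K r)) ⊆ ((Ω : PS K r →ₐ[K] PS K r).comp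
        (rename (Fin.castSucc : Fin r → Fin (r + 1)))).range := by
        have h2 : Submodule.span K (Set.range fun i => (b i : PS K r)) ≤
          Subalgebra.toSubmodule ((Ω : PS K r →ₐ[K] PS K r).comp
        (rename (Fin.castSucc : Fin r → Fin (r + 1)))).range := by
          rw [Submodule.span_le]
          rintro _ ⟨i, rfl⟩
          refine ⟨X i, ?_⟩
          simp [hΩ, L]
        rw [hspanb] at h2
        exact h2
      exact fun y hy => h1 (hHH' hy)
    obtain ⟨g', h⟩ := this hg
    exact ⟨g', h⟩
  apply le_antisymm
  · rw [Ideal.map_le_iff_le_comap]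
    intro f hf
    have h1 := hI f hf
    have : Ideal.span ((I : Set (PS K r)) ∩ Algebra.adjoin K (H : Set (PS K r))) ≤
      Ideal.comap Ω.symm (Ideal.map (rename (Fin.castSucc : Fin r → Fin (r + 1)))
        (Ideal.comap (((Ω : PS K r →ₐ[K] PS K r).comp
    (rename (Fin.castSucc : Fin r → Fin (r + 1)))) : MvPolynomial (Fin r) K →ₐ[K] PS K r) I)) := by
      rw [Ideal.span_le]
      rintro g ⟨hgI, hg⟩
      obtain ⟨g', rfl⟩ := hadj g hg
      simp only [SetLike.mem_coe, Ideal.mem_comap]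
      rw [AlgEquiv.symm_apply_apply]
      apply Ideal.mem_map_of_mem
      simpa using hgI
    exact this h1
  · rw [Ideal.map_le_iff_le_comap]
    intro g hg
    simp only [Ideal.mem_comap, AlgHom.comp_apply] at hg ⊢
    have := Ideal.mem_map_of_mem Ω.symm hg
    simpa using this
end AMDP

open MvPolynomial
namespace AMDP
open Cardinal

theorem le_trdeg {K A : Type} [Field K] [CommRing A] [IsDomain A] [Algebra K A]
    [Algebra.FiniteType K A] {n : ℕ} (h : ((n : ℕ∞) : WithBot ℕ∞) ≤ ringKrullDim A) :
    (n : Cardinal) ≤ Algebra.trdeg K A := by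
  obtain ⟨s, g, hg, hIntg⟩ := exists_integral_inj_algHom_of_fg K A
  have h1 : ringKrullDim A ≤ ringKrullDim (MvPolynomial (Fin s) K) := by
    algebraize [g.toRingHom]
    have : Algebra.IsIntegral (MvPolynomial (Fin s) K) A := ⟨hIntg⟩
    refine Order.krullDim_le_of_strictMono
      (fun p => ⟨Ideal.comap (algebraMap (MvPolynomial (Fin s) K) A) p.asIdeal, inferInstance⟩) ?_
    intro p q hpq
    exact Ideal.IsIntegral.comap_lt_comap (show p.asIdeal < q.asIdeal from hpq)
  rw [MvPolynomial.ringKrullDim_of_isNoetherianRing, ringKrullDim_eq_zero_of_field] at h1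
  have h2 := h.trans h1
  simp only [Nat.card_eq_fintype_card, Fintype.card_fin, zero_add] at h2
  have h3 : n ≤ s := by exact_mod_cast h2
  have h4 := trdeg_le_of_injective g hg
  rw [MvPolynomial.trdeg_of_isDomain] at h4
  refine le_trans ?_ h4
  simpa using h3

theorem trdeg_drop {K R B : Type} [Field K] [CommRing R] [IsDomain R] [Algebra K R]
    [CommRing B] [IsDomain B] [Algebra K B] (f : R →ₐ[K] B) (hf : Function.Surjective f)
    (g : R) (hg : g ≠ 0) (hfg : f g = 0) (n : ℕ) (hR : Algebra.trdeg K R ≤ n + 1) :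
    Algebra.trdeg K B ≤ n := by
  by_contra hcon
  push Not at hcon
  have h1 : ((n + 1 : ℕ) : Cardinal) ≤ Algebra.trdeg K B := by
    rw [Nat.cast_succ]; exact Cardinal.add_one_le_of_lt hcon
  obtain ⟨s, hs⟩ := exists_isTranscendenceBasis K B
  have h2 := hs.cardinalMk_eq_trdeg
  rw [← h2] at h1
  obtain ⟨t, hts, ht⟩ := Cardinal.le_mk_iff_exists_subset.1 h1
  have hti : AlgebraicIndependent K ((↑) : t → B) := hs.1.mono hts
  choose l hl using hf
  have hli : AlgebraicIndependent K (fun x : t => l (x : B)) := by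
    apply AlgebraicIndependent.of_comp f
    convert hti using 1
    funext x; simp [hl]
  have htb : IsTranscendenceBasis K (fun x : t => l (x : B)) := by
    have : Finite t := by
      rw [← Cardinal.mk_lt_aleph0_iff, ht]; exact Cardinal.natCast_lt_aleph0
    apply hli.isTranscendenceBasis_of_trdeg_le_of_finite
    rw [ht]; simpa using hR
  have halg := htb.isAlgebraic
  obtain ⟨q, hq0, hq⟩ := (halg.isAlgebraic g).exists_nonzero_dvd (mem_nonZeroDivisors_of_ne_zero hg)
  obtain ⟨p, hp⟩ : ∃ p, aeval (fun x : t => l (x : B)) p = (q : R) := by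
    have : (q : R) ∈ (aeval (R := K) (fun x : t => l (x : B))).range :=
      (Algebra.adjoin_range_eq_range_aeval K (fun x : t => l (x : B))).le q.2
    exact this
  have h5 : f q = 0 := by
    obtain ⟨z, hz⟩ := hq
    have : (q : R) = g * z := hz
    rw [this, map_mul, hfg, zero_mul]
  rw [← hp, ← AlgHom.comp_apply, MvPolynomial.comp_aeval] at h5
  simp only [hl] at h5
  have h6 := hti.eq_zero_of_aeval_eq_zero _ h5
  rw [h6, map_zero] at hp
  exact hq0 (Subtype.ext hp.symm)
end AMDP

open MvPolynomial
namespace AMDP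

section wp
variable {K τ : Type} [Field K] (w : τ → ℕ)

/-- weight homomorphism `X i ↦ X i * T ^ (w i)` -/
def wp : MvPolynomial τ K →ₐ[K] Polynomial (MvPolynomial τ K) :=
  aeval fun i => Polynomial.C (X i) * Polynomial.X ^ (w i)

theorem wp_monomial (m : τ →₀ ℕ) (c : K) :
    wp w (monomial m c) = Polynomial.monomial (Finsupp.weight w m) (monomial m c) := by
  rw [wp, aeval_monomial]
  have h1 : (m.prod fun i k => (Polynomial.C (X i) * Polynomial.X ^ (w i) :
      Polynomial (MvPolynomial τ K)) ^ k) =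
      Polynomial.monomial (Finsupp.weight w m) (monomial m 1) := by
    simp only [mul_pow, Finsupp.prod_mul, ← pow_mul, ← Polynomial.C_pow]
    rw [← Polynomial.C_mul_X_pow_eq_monomial]
    congr 1
    · rw [Finsupp.prod, ← map_prod, monomial_eq, C_1, one_mul]; rfl
    · rw [Finsupp.prod, Finset.prod_pow_eq_pow_sum, Finsupp.weight_apply, Finsupp.sum]
      congr 1
      apply Finset.sum_congr rfl; intros; rw [smul_eq_mul, mul_comm]
  rw [h1, Polynomial.algebraMap_apply]
  rw [Polynomial.C_mul_monomial]
  simp [algebraMap_eq, C_mul_monomial]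

theorem coeff_wp (f : MvPolynomial τ K) (n : ℕ) (m : τ →₀ ℕ) :
    coeff m ((wp w f).coeff n) = if Finsupp.weight w m = n then coeff m f else 0 := by
  classical
  induction f using MvPolynomial.induction_on' with
  | monomial u a =>
    rw [wp_monomial, Polynomial.coeff_monomial]
    by_cases h : u = m
    · subst h; split_ifs <;> simp
    · split_ifs <;> simp [coeff_monomial, h]
  | add p q hp hq =>
    rw [map_add, Polynomial.coeff_add, coeff_add, hp, hq]
    split_ifs <;> simp

theorem wp_ne_zero {f : MvPolynomial τ K} (hf : f ≠ 0) : wp w f ≠ 0 := by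
  intro h
  apply hf
  ext m
  have := coeff_wp w f (Finsupp.weight w m) m
  rw [h] at this
  simpa using this.symm

/-- weighted degree -/
def wd (f : MvPolynomial τ K) : ℕ := (wp w f).natDegree

theorem wd_mul {f g : MvPolynomial τ K} (hf : f ≠ 0) (hg : g ≠ 0) :
    wd w (f * g) = wd w f + wd w g := by
  rw [wd, map_mul, Polynomial.natDegree_mul (wp_ne_zero w hf) (wp_ne_zero w hg)]; rfl

theorem wd_le_iff {f : MvPolynomial τ K} {n : ℕ} :
    wd w f ≤ n ↔ ∀ m ∈ f.support, Finsupp.weight w m ≤ n := by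
  rw [wd, Polynomial.natDegree_le_iff_coeff_eq_zero]
  constructor
  · intro h m hm
    by_contra hlt
    push Not at hlt
    have := coeff_wp w f (Finsupp.weight w m) m
    rw [h _ hlt] at this
    simp only [coeff_zero, if_true] at this
    exact (mem_support_iff.1 hm) this.symm
  · intro h N hN
    ext m
    rw [coeff_wp]
    split_ifs with h1
    · by_contra h2
      have := h m (mem_support_iff.2 h2)
      omega
    · simp

/-- weighted homogeneity as a condition on the support -/
def WH (n : ℕ) (f : MvPolynomial τ K) : Prop := ∀ m ∈ f.support, Finsupp.weight w m = n

theorem WH_iff {n : ℕ} {f : MvPolynomial τ K} : WH w n f ↔ wp w f = Polynomial.monomial n f := by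
  classical
  constructor
  · intro h
    ext N m
    rw [coeff_wp, Polynomial.coeff_monomial]
    split_ifs with h1 h2 h2
    · rfl
    · by_contra h3
      exact h2 ((h m (mem_support_iff.2 h3)).symm.trans h1)
    · subst h2
      by_contra h3
      exact h1 (h m (mem_support_iff.2 (Ne.symm h3)))
    · simp
  · intro h m hm
    by_contra h1
    have := coeff_wp w f n m
    rw [h, Polynomial.coeff_monomial, if_pos rfl, if_neg h1] at this
    exact (mem_support_iff.1 hm) this

theorem WH_of_mul {n : ℕ} {f g : MvPolynomial τ K} (hf : f ≠ 0) (hg : g ≠ 0)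
    (h : WH w n (f * g)) : WH w (wd w f) f := by
  have h1 := (WH_iff w).1 h
  have hfw := wp_ne_zero w hf
  have hgw := wp_ne_zero w hg
  have h2 : (wp w (f * g)).natDegree = n := by
    rw [h1, Polynomial.natDegree_monomial_eq _ (mul_ne_zero hf hg)]
  have h3 : (wp w (f * g)).natTrailingDegree = n := by
    rw [h1, Polynomial.natTrailingDegree_monomial (mul_ne_zero hf hg)]
  rw [map_mul, Polynomial.natDegree_mul hfw hgw] at h2
  rw [map_mul, Polynomial.natTrailingDegree_mul hfw hgw] at h3
  have h4 := Polynomial.natTrailingDegree_le_natDegree (wp w f)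
  have h5 := Polynomial.natTrailingDegree_le_natDegree (wp w g)
  have h6 : (wp w f).natTrailingDegree = wd w f := by rw [wd]; omega
  intro m hm
  by_contra hne
  have h7 := coeff_wp w f (Finsupp.weight w m) m
  rw [if_pos rfl] at h7
  rcases lt_or_gt_of_ne hne with h8 | h8
  · rw [Polynomial.coeff_eq_zero_of_lt_natTrailingDegree (by omega)] at h7
    exact (mem_support_iff.1 hm) (by simpa using h7.symm)
  · rw [Polynomial.coeff_eq_zero_of_natDegree_lt (by rw [wd] at h8; omega)] at h7
    exact (mem_support_iff.1 hm) (by simpa using h7.symm)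

theorem WH_mul {n k : ℕ} {f g : MvPolynomial τ K} (hf : WH w n f) (hg : WH w k g) :
    WH w (n + k) (f * g) := by
  rw [WH_iff] at *
  rw [map_mul, hf, hg, Polynomial.monomial_mul_monomial]

theorem WH_unique {n k : ℕ} {f : MvPolynomial τ K} (hf0 : f ≠ 0) (hf : WH w n f) (hg : WH w k f) :
    n = k := by
  obtain ⟨m, hm⟩ := support_nonempty.2 hf0
  exact (hf m hm).symm.trans (hg m hm)

end wp
end AMDP

open MvPolynomial
set_option linter.unusedSectionVars false
namespace AMDP

section scroll
variable {K ι : Type} [Field K] [Fintype ι] [DecidableEq ι] (a : ι → ℕ)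

def td (m : Option ι →₀ ℕ) : ℕ := ∑ i, m (some i)
def ad (m : Option ι →₀ ℕ) : ℕ := ∑ i, a i * m (some i)
def PP (n : ℕ) : Set (Option ι →₀ ℕ) := {m | td m = n ∧ m none ≤ ad a m}

theorem td_add (m m' : Option ι →₀ ℕ) : td (m + m') = td m + td m' := by
  simp [td, Finset.sum_add_distrib]
theorem ad_add (m m' : Option ι →₀ ℕ) : ad a (m + m') = ad a m + ad a m' := by
  simp [ad, mul_add, Finset.sum_add_distrib]

/-- exponent of `λ^e t_i` -/
def ex (i : ι) (e : ℕ) : Option ι →₀ ℕ := Finsupp.single none e + Finsupp.single (some i) 1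

theorem ex_none (i : ι) (e : ℕ) : ex i e none = e := by simp [ex]
theorem ex_some (i j : ι) (e : ℕ) : ex i e (some j) = if i = j then 1 else 0 := by
  simp [ex, Finsupp.single_apply]
theorem td_ex (i : ι) (e : ℕ) : td (ex i e) = 1 := by simp [td, ex_some]
theorem ad_ex (i : ι) (e : ℕ) : ad a (ex i e) = a i := by simp [ad, ex_some]

/-- scroll parametrization -/
def scr : MvPolynomial ((i : ι) × Fin (a i + 1)) K →ₐ[K] MvPolynomial (Option ι) K :=
  aeval fun p => monomial (ex p.1 p.2) 1

theorem scr_X (p : (i : ι) × Fin (a i + 1)) : scr a (X p : MvPolynomial _ K) = monomial (ex p.1 p.2) 1 := by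
  simp [scr]

theorem scr_le (n : ℕ) (f : MvPolynomial ((i : ι) × Fin (a i + 1)) K) (hf : f.IsHomogeneous n) :
    scr a f ∈ restrictSupport K (PP a n) := by
  have hmon : ∀ (n : ℕ) (u : ((i : ι) × Fin (a i + 1)) →₀ ℕ), u.degree = n →
      ∃ m ∈ PP a n, scr a (monomial u (1 : K)) = monomial m 1 := by
    intro n
    induction n with
    | zero =>
      intro u hu
      refine ⟨0, by simp [PP, td], ?_⟩
      have : u = 0 := (Finsupp.degree_eq_zero_iff u).1 hu
      subst this
      change scr a (1 : MvPolynomial _ K) = 1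
      simp
    | succ n ih =>
      intro u hu
      have : u ≠ 0 := by rintro rfl; simp at hu
      obtain ⟨p, hp⟩ := Finsupp.ne_iff.1 this
      have hu' : u = Finsupp.single p 1 + (u - Finsupp.single p 1) := by
        rw [add_tsub_cancel_of_le]
        rw [Finsupp.single_le_iff]
        simp at hp
        omega
      have hd := congrArg Finsupp.degree hu'
      rw [map_add, hu, Finsupp.degree_single] at hd
      obtain ⟨m, hm, hm2⟩ := ih (u - Finsupp.single p 1) (by omega)
      refine ⟨ex p.1 p.2 + m, ?_, ?_⟩
      · refine ⟨by rw [td_add, td_ex, hm.1]; omega, ?_⟩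
        rw [ad_add, ad_ex, Finsupp.add_apply, ex_none]
        have := hm.2
        have := p.2.2
        omega
      · rw [hu']
        have : (monomial (Finsupp.single p 1 + (u - Finsupp.single p 1)) (1 : K)) =
          X p * monomial (u - Finsupp.single p 1) 1 := by
          rw [X, monomial_mul, one_mul]
        rw [this, map_mul, hm2, scr_X, monomial_mul, one_mul]
  rw [f.as_sum, map_sum]
  apply Submodule.sum_mem
  intro u hu
  have hdeg : u.degree = n := by
    have := hf (mem_support_iff.1 hu)
    rwa [Finsupp.degree_eq_weight_one]
  obtain ⟨m, hm, hm2⟩ := hmon n u hdeg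
  have : monomial u (coeff u f) = (coeff u f) • monomial u (1 : K) := by
    rw [smul_monomial]; simp
  rw [this, map_smul, hm2]
  apply Submodule.smul_mem
  rw [monomial_mem_restrictSupport]
  exact Or.inl hm

theorem scr_ge (n : ℕ) (m : Option ι →₀ ℕ) (hm : m ∈ PP a n) :
    ∃ f : MvPolynomial ((i : ι) × Fin (a i + 1)) K, f.IsHomogeneous n ∧ scr a f = monomial m 1 := by
  induction n generalizing m with
  | zero =>
    refine ⟨1, isHomogeneous_one _ _, ?_⟩
    have h1 : ∀ i, m (some i) = 0 := by
      intro i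
      have := hm.1
      rw [td, Finset.sum_eq_zero_iff] at this
      exact this i (Finset.mem_univ _)
    have h2 : m = 0 := by
      ext o
      cases o with
      | none => have := hm.2; simpa [ad, h1] using this
      | some i => simpa using h1 i
    rw [h2]; simp
  | succ n ih =>
    obtain ⟨i, hi⟩ : ∃ i, m (some i) ≠ 0 := by
      by_contra hcon
      push Not at hcon
      have := hm.1
      simp [td, hcon] at this
    set e := min (m none) (a i) with he
    have hle : ex i e ≤ m := by
      intro o
      cases o with
      | none => rw [ex_none]; exact min_le_left _ _
      | some j =>
        rw [ex_some]
        split_ifs with h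
        · subst h; omega
        · omega
    have hm' : m = ex i e + (m - ex i e) := (add_tsub_cancel_of_le hle).symm
    have h1 := hm.1
    have h2 := hm.2
    rw [hm', td_add, td_ex] at h1
    rw [hm', ad_add, ad_ex, Finsupp.add_apply, ex_none] at h2
    have h3 : m none = e + (m - ex i e) none := by
      conv_lhs => rw [hm']
      rw [Finsupp.add_apply, ex_none]
    obtain ⟨f, hf, hf2⟩ := ih (m - ex i e) ⟨by omega, by omega⟩
    refine ⟨X ⟨i, ⟨e, by omega⟩⟩ * f, ?_, ?_⟩
    · have := (isHomogeneous_X K (⟨i, ⟨e, by omega⟩⟩ : (i : ι) × Fin (a i + 1))).mul hf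
      rwa [add_comm 1 n] at this
    · rw [map_mul, hf2, scr_X, monomial_mul, one_mul]
      simp only
      rw [← hm']

theorem scr_map (n : ℕ) : (homogeneousSubmodule ((i : ι) × Fin (a i + 1)) K n).map
    (scr a (K := K)).toLinearMap = restrictSupport K (PP a n) := by
  apply le_antisymm
  · rintro _ ⟨f, hf, rfl⟩
    exact scr_le a n f hf
  · rw [restrictSupport_eq_span, Submodule.span_le]
    rintro _ ⟨m, hm, rfl⟩
    obtain ⟨f, hf, hf2⟩ := scr_ge (K := K) a n m hm
    exact ⟨f, hf, hf2⟩

end scroll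
end AMDP

open MvPolynomial
set_option linter.unusedSectionVars false
namespace AMDP

section count
variable {K ι : Type} [Field K] [Fintype ι] [DecidableEq ι] (a : ι → ℕ)

def mkE (μ : ι → ℕ) (e : ℕ) : Option ι →₀ ℕ := Finsupp.equivFunOnFinite.symm fun o => o.elim e μ

theorem mkE_none (μ : ι → ℕ) (e : ℕ) : mkE μ e none = e := rfl
theorem mkE_some (μ : ι → ℕ) (e : ℕ) (i : ι) : mkE μ e (some i) = μ i := rfl

def PPf (n : ℕ) : Finset (Option ι →₀ ℕ) := by
  classical
  exact ((Finset.piAntidiag (Finset.univ : Finset ι) n).sigma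
    (fun μ => Finset.range (∑ i, a i * μ i + 1))).image (fun p => mkE p.1 p.2)

theorem coe_PPf (n : ℕ) : (PPf a n : Set (Option ι →₀ ℕ)) = PP a n := by
  ext m
  simp only [PPf, Finset.coe_image, Set.mem_image, Finset.mem_coe, Finset.mem_sigma,
    Finset.mem_piAntidiag, Finset.mem_range, PP, Set.mem_ofPred_eq, td, ad]
  constructor
  · rintro ⟨⟨μ, e⟩, ⟨⟨h1, -⟩, h2⟩, rfl⟩
    simp only [mkE_some, mkE_none]
    exact ⟨h1, by simp only at h2; omega⟩
  · rintro ⟨h1, h2⟩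
    refine ⟨⟨fun i => m (some i), m none⟩, ⟨⟨h1, by simp⟩, by simp only; omega⟩, ?_⟩
    ext o
    cases o <;> rfl

theorem card_PPf (n : ℕ) : (PPf a n).card =
    ∑ μ ∈ Finset.piAntidiag (Finset.univ : Finset ι) n, (∑ i, a i * μ i + 1) := by
  rw [PPf, Finset.card_image_of_injOn]
  · rw [Finset.card_sigma]; simp
  · rintro ⟨μ, e⟩ - ⟨μ', e'⟩ - h
    simp only at h
    have h1 : μ = μ' := by
      ext i; have := DFunLike.congr_fun h (some i); simpa [mkE_some] using this
    have h2 : e = e' := by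
      have := DFunLike.congr_fun h none; simpa [mkE_none] using this
    subst h1; subst h2; rfl

theorem sum_symm (n : ℕ) (i j : ι) :
    ∑ μ ∈ Finset.piAntidiag (Finset.univ : Finset ι) n, μ i =
    ∑ μ ∈ Finset.piAntidiag (Finset.univ : Finset ι) n, μ j := by
  refine Finset.sum_nbij' (fun μ => μ ∘ Equiv.swap i j) (fun μ => μ ∘ Equiv.swap i j) ?_ ?_ ?_ ?_ ?_
  · intro μ hμ
    simp only [Finset.mem_piAntidiag, Finset.mem_univ, implies_true, and_true] at hμ ⊢
    rw [← hμ]; exact Equiv.sum_comp (Equiv.swap i j) μ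
  · intro μ hμ
    simp only [Finset.mem_piAntidiag, Finset.mem_univ, implies_true, and_true] at hμ ⊢
    rw [← hμ]; exact Equiv.sum_comp (Equiv.swap i j) μ
  · intro μ _; ext k; simp
  · intro μ _; ext k; simp
  · intro μ _; simp

theorem card_PPf' (n c A : ℕ) (hA : ∑ i, a i = A)
    (hc : Fintype.card ι * c = n * (Finset.piAntidiag (Finset.univ : Finset ι) n).card)
    (hι : 0 < Fintype.card ι) :
    (PPf a n).card = A * c + (Finset.piAntidiag (Finset.univ : Finset ι) n).card := by
  rw [card_PPf, Finset.sum_add_distrib, Finset.sum_comm]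
  congr 1
  · obtain ⟨i0⟩ := Fintype.card_pos_iff.1 hι
    have h1 : ∑ i, ∑ μ ∈ Finset.piAntidiag (Finset.univ : Finset ι) n, μ i =
        n * (Finset.piAntidiag (Finset.univ : Finset ι) n).card := by
      rw [Finset.sum_comm, Finset.sum_congr rfl (g := fun _ => n)]
      · simp [mul_comm]
      · intro μ hμ
        simp only [Finset.mem_piAntidiag] at hμ; exact hμ.1
    have h2 : ∀ i, ∑ μ ∈ Finset.piAntidiag (Finset.univ : Finset ι) n, μ i = c := by
      intro i
      have h3 : ∑ j, ∑ μ ∈ Finset.piAntidiag (Finset.univ : Finset ι) n, μ j =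
        ∑ j : ι, ∑ μ ∈ Finset.piAntidiag (Finset.univ : Finset ι) n, μ i :=
        Finset.sum_congr rfl fun j _ => sum_symm n j i
      rw [h1, ← hc, Finset.sum_const, Finset.card_univ, smul_eq_mul] at h3
      exact (Nat.eq_of_mul_eq_mul_left hι h3).symm
    simp_rw [← Finset.mul_sum, h2, ← Finset.sum_mul, hA]
  · simp

theorem card_anti (n : ℕ) : (Finset.piAntidiag (Finset.univ : Finset ι) n).card =
    (Fintype.card ι).multichoose n := by
  rw [← Finset.map_sym_eq_piAntidiag, Finset.card_map, Finset.sym_univ, Finset.card_univ,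
    Sym.card_sym_eq_multichoose]

theorem multichoose_two' (n : ℕ) : 2 * n.multichoose 2 = n * (n + 1) := by
  rw [Nat.multichoose_eq]
  rcases n with _ | n
  · simp
  · have := Nat.triangle_succ (n + 1)
    rw [show n + 1 + 2 - 1 = n + 1 + 1 by omega, Nat.choose_two_right]
    have := Nat.div_mul_cancel (Nat.even_mul_pred_self (n + 1 + 1)).two_dvd
    simp only [Nat.add_sub_cancel] at this ⊢
    linarith

theorem multichoose_three' (n : ℕ) : 6 * n.multichoose 3 = n * (n + 1) * (n + 2) := by
  induction n with
  | zero => simp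
  | succ n ih =>
    have h2 := multichoose_two' (n + 1)
    rw [show (3 : ℕ) = 2 + 1 from rfl, Nat.multichoose_succ_succ]
    nlinarith

theorem card_PP2 (d : ℕ) (hι : Fintype.card ι = d + 1) (ha : ∑ i, a i = 3) :
    2 * (PPf a 2).card = (d + 1) * (d + 2) + 6 * (d + 2) := by
  have h := multichoose_two' (d + 1)
  have := card_PPf' a 2 (d + 2) 3 ha (by rw [card_anti, hι, h]) (by omega)
  rw [card_anti, hι] at this
  rw [this, mul_add, h]; ring

theorem card_PP3 (d : ℕ) (hι : Fintype.card ι = d + 1) (ha : ∑ i, a i = 3) :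
    6 * (PPf a 3).card = (d + 1) * (d + 2) * (d + 3) + 9 * ((d + 2) * (d + 3)) := by
  have h := multichoose_three' (d + 1)
  have h2 := multichoose_two' (d + 2)
  have := card_PPf' a 3 ((d + 2).multichoose 2) 3 ha (by rw [card_anti, hι]; nlinarith) (by omega)
  rw [card_anti, hι] at this
  nlinarith

theorem card_PP1 (d : ℕ) (hι : Fintype.card ι = d + 1) (ha : ∑ i, a i = 3) :
    (PPf a 1).card = d + 4 := by
  have := card_PPf' a 1 1 3 ha (by rw [card_anti, hι]; simp) (by omega)
  rw [card_anti, hι] at this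
  rw [this]; simp; omega

theorem finrank_PP (n : ℕ) : Module.finrank K (restrictSupport K (PP a n)) = (PPf a n).card := by
  rw [Module.finrank_eq_nat_card_basis (basisRestrictSupport K (PP a n)), ← coe_PPf]
  simp

theorem finrank_hom (n : ℕ) : Module.finrank K (homogeneousSubmodule ι K n) =
    (Fintype.card ι).multichoose n := by
  have : homogeneousSubmodule ι K n = restrictSupport K {m | m.degree = n} :=
    homogeneousSubmodule_eq_finsupp_supported ι K n
  rw [this, Module.finrank_eq_nat_card_basis (basisRestrictSupport K _), ← Finset.card_univ,
    ← Finset.card_finsuppAntidiag_nat_eq_multichoose]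
  have h2 : {m : ι →₀ ℕ | m.degree = n} = ((Finset.univ.finsuppAntidiag n : Finset (ι →₀ ℕ)) : Set (ι →₀ ℕ)) := by
    ext m
    simp [Finsupp.degree_eq_sum]
  rw [h2, Nat.card_coe_set_eq, Set.ncard_coe_finset]
end count
end AMDP

open MvPolynomial
set_option linter.unusedSectionVars false
namespace AMDP

section D2
variable {K ι : Type} [Field K] [Fintype ι] [DecidableEq ι] (a : ι → ℕ)

def wt : Option ι → ℕ := fun o => o.elim 0 fun _ => 1
def wl : Option ι → ℕ := fun o => o.elim 1 fun i => 3 - a i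

theorem weight_wt (m : Option ι →₀ ℕ) : Finsupp.weight wt m = td m := by
  rw [Finsupp.weight_apply, Finsupp.sum_fintype _ _ (by simp), Fintype.sum_option]
  simp [wt, td]

theorem weight_wl (ha : ∀ i, a i ≤ 3) (m : Option ι →₀ ℕ) :
    Finsupp.weight (wl a) m + ad a m = m none + 3 * td m := by
  rw [Finsupp.weight_apply, Finsupp.sum_fintype _ _ (by simp), Fintype.sum_option]
  simp only [wl, Option.elim, smul_eq_mul, mul_one, td, ad, add_assoc, Finset.mul_sum,
    ← Finset.sum_add_distrib]
  congr 1
  apply Finset.sum_congr rfl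
  intro i _
  obtain ⟨k, hk⟩ := Nat.exists_eq_add_of_le (ha i)
  rw [hk, Nat.add_sub_cancel_left]; ring

theorem mem_rs {τ : Type} (s : Set (τ →₀ ℕ)) (f : MvPolynomial τ K) :
    f ∈ restrictSupport K s ↔ ∀ m ∈ f.support, m ∈ s := by
  rw [mem_restrictSupport_iff]; rfl

theorem mem_PP_iff (ha : ∀ i, a i ≤ 3) (n : ℕ) (m : Option ι →₀ ℕ) :
    m ∈ PP a n ↔ Finsupp.weight wt m = n ∧ Finsupp.weight (wl a) m ≤ 3 * n := by
  have := weight_wl a ha m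
  rw [weight_wt]
  constructor
  · rintro ⟨h1, h2⟩
    exact ⟨h1, by rw [h1] at this; omega⟩
  · rintro ⟨h1, h2⟩
    exact ⟨h1, by rw [h1] at this; omega⟩

theorem mem_rsPP (ha : ∀ i, a i ≤ 3) (n : ℕ) (f : MvPolynomial (Option ι) K) :
    f ∈ restrictSupport K (PP a n) ↔ WH wt n f ∧ wd (wl a) f ≤ 3 * n := by
  rw [mem_rs, wd_le_iff, WH]
  constructor
  · intro h
    exact ⟨fun m hm => ((mem_PP_iff a ha n m).1 (h m hm)).1,
      fun m hm => ((mem_PP_iff a ha n m).1 (h m hm)).2⟩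
  · rintro ⟨h1, h2⟩ m hm
    exact (mem_PP_iff a ha n m).2 ⟨h1 m hm, h2 m hm⟩

def QQ (j g n : ℕ) : Set (Option ι →₀ ℕ) := {m | td m + j = n ∧ Finsupp.weight (wl a) m + g ≤ 3 * n}

theorem mul_mem_PP (ha : ∀ i, a i ≤ 3) {G : MvPolynomial (Option ι) K} (hG : G ≠ 0) {j : ℕ}
    (hj : WH wt j G) (n : ℕ) (H : MvPolynomial (Option ι) K) :
    G * H ∈ restrictSupport K (PP a n) ↔ H ∈ restrictSupport K (QQ a j (wd (wl a) G) n) := by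
  by_cases hH : H = 0
  · subst hH; simp
  rw [mem_rsPP a ha, wd_mul _ hG hH, mem_rs]
  constructor
  · rintro ⟨h1, h2⟩ m hm
    have hH' : WH wt (wd wt H) H := WH_of_mul wt hH hG (by rwa [mul_comm])
    have h3 := WH_unique wt (mul_ne_zero hG hH) h1 (WH_mul wt hj hH')
    have h4 := hH' m hm
    rw [weight_wt] at h4
    have h5 := (wd_le_iff (wl a) (f := H)).1 le_rfl m hm
    exact ⟨by omega, by omega⟩
  · intro h
    have h0 : ∃ m, m ∈ H.support := support_nonempty.2 hH
    obtain ⟨m0, hm0⟩ := h0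
    have hm0' := h m0 hm0
    have h1 : WH wt (n - j) H := by
      intro m hm
      rw [weight_wt]
      have := (h m hm).1
      omega
    have h2 := WH_mul wt hj h1
    have h3 := hm0'.1
    have h4 := hm0'.2
    refine ⟨by rwa [show j + (n - j) = n by omega] at h2, ?_⟩
    have : wd (wl a) H ≤ 3 * n - wd (wl a) G := by
      rw [wd_le_iff]
      intro m hm
      have := (h m hm).2
      omega
    omega

theorem finrank_QQ (ha : ∀ i, a i ≤ 3) {G : MvPolynomial (Option ι) K} (hG : G ≠ 0) {j : ℕ}
    (hj : WH wt j G) (n : ℕ) :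
    Module.finrank K ↥(((Ideal.span {G}).restrictScalars K) ⊓ restrictSupport K (PP a n)) =
      (QQ a j (wd (wl a) G) n).ncard := by
  have : ((Ideal.span {G}).restrictScalars K) ⊓ restrictSupport K (PP a n) =
    (restrictSupport K (QQ a j (wd (wl a) G) n)).map (LinearMap.mulLeft K G) := by
    ext f
    simp only [Submodule.mem_inf, Submodule.restrictScalars_mem, Ideal.mem_span_singleton',
      Submodule.mem_map, LinearMap.mulLeft_apply]
    constructor
    · rintro ⟨⟨H, rfl⟩, h⟩
      rw [mul_comm] at h
      exact ⟨H, (mul_mem_PP a ha hG hj n H).1 h, mul_comm _ _⟩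
    · rintro ⟨H, hH, rfl⟩
      exact ⟨⟨H, mul_comm _ _⟩, (mul_mem_PP a ha hG hj n H).2 hH⟩
  have hinj : Function.Injective (LinearMap.mulLeft K G) := fun x y h => mul_left_cancel₀ hG h
  rw [this, ← (Submodule.equivMapOfInjective _ hinj _).finrank_eq,
    Module.finrank_eq_nat_card_basis (basisRestrictSupport K _)]
  rfl

theorem ker_span {d : ℕ} (hι : Fintype.card ι = d + 1) {F : Type} [Field F] [Algebra K F]
    (Θ : MvPolynomial (Option ι) K →ₐ[K] F) (htr : ((d + 1 : ℕ) : Cardinal) ≤ Algebra.trdeg K Θ.range)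
    (n : ℕ) (q : MvPolynomial (Option ι) K) (hq : q ≠ 0) (hq2 : WH wt n q) (hqΘ : Θ q = 0) :
    ∃ (G : MvPolynomial (Option ι) K) (j : ℕ), G ≠ 0 ∧ WH wt j G ∧
      RingHom.ker Θ = Ideal.span {G} := by
  have hprime : (RingHom.ker Θ).IsPrime := RingHom.ker_isPrime _
  obtain ⟨G, hGp, hGk, hGq⟩ : ∃ G, Prime G ∧ G ∈ RingHom.ker Θ ∧ G ∣ q := by
    obtain ⟨s, hs, hs2⟩ := UniqueFactorizationMonoid.exists_prime_factors q hq
    have h1 : s.prod ∈ RingHom.ker Θ := by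
      rw [RingHom.mem_ker]
      have := (hs2.map Θ)
      rw [hqΘ] at this
      exact (associated_zero_iff_eq_zero _).1 this
    obtain ⟨G, hGs, hG⟩ := (hprime.multiset_prod_mem_iff_exists_mem s).1 h1
    exact ⟨G, hs G hGs, hG, (Multiset.dvd_prod hGs).trans hs2.dvd⟩
  obtain ⟨H, rfl⟩ := hGq
  refine ⟨G, _, hGp.ne_zero, WH_of_mul wt hGp.ne_zero (right_ne_zero_of_mul hq) hq2, ?_⟩
  have hle : Ideal.span {G} ≤ RingHom.ker Θ := by
    rw [Ideal.span_le, Set.singleton_subset_iff]; exact hGk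
  by_contra hne
  obtain ⟨f, hf, hf2⟩ := SetLike.exists_of_lt (lt_of_le_of_ne hle (Ne.symm hne))
  have hp : (Ideal.span {G}).IsPrime := (Ideal.span_singleton_prime hGp.ne_zero).2 hGp
  have hG0 := hGp.ne_zero
  have h1 : Algebra.trdeg K (MvPolynomial (Option ι) K ⧸ Ideal.span {G}) ≤ ((d + 1 : ℕ) : Cardinal) := by
    refine trdeg_drop (Ideal.Quotient.mkₐ K _) (Ideal.Quotient.mkₐ_surjective _ _) G hG0 ?_ (d + 1) ?_
    · rw [Ideal.Quotient.mkₐ_eq_mk, Ideal.Quotient.eq_zero_iff_mem]; exact Ideal.mem_span_singleton_self _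
    · rw [MvPolynomial.trdeg_of_isDomain]
      simp [hι]
  let φ : (MvPolynomial (Option ι) K ⧸ Ideal.span {G}) →ₐ[K] Θ.range :=
    Ideal.Quotient.liftₐ _ Θ.rangeRestrict (by
      intro x hx
      have := hle hx
      rw [RingHom.mem_ker] at this
      exact Subtype.ext this)
  have h2 : Algebra.trdeg K Θ.range ≤ (d : Cardinal) := by
    refine trdeg_drop φ ?_ (Ideal.Quotient.mk _ f) ?_ ?_ d (by exact_mod_cast h1)
    · rintro ⟨y, x, rfl⟩
      exact ⟨Ideal.Quotient.mk _ x, rfl⟩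
    · rwa [Ne, Ideal.Quotient.eq_zero_iff_mem]
    · exact Subtype.ext hf
  have h3 := htr.trans h2
  have : d + 1 ≤ d := by exact_mod_cast h3
  omega
end D2
end AMDP

open MvPolynomial
set_option linter.unusedSectionVars false
namespace AMDP

section D3
variable {K ι : Type} [Field K] [Fintype ι] [DecidableEq ι] (a : ι → ℕ)

theorem td_eq_one {m : Option ι →₀ ℕ} (h : td m = 1) : ∃ i, m = ex i (m none) := by
  obtain ⟨i, hi⟩ : ∃ i, m (some i) ≠ 0 := by
    by_contra hcon
    push Not at hcon
    simp [td, hcon] at h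
  refine ⟨i, ?_⟩
  rw [td, ← Finset.add_sum_erase _ _ (Finset.mem_univ i)] at h
  have h0 : ∑ j ∈ Finset.univ.erase i, m (some j) = 0 := by omega
  rw [Finset.sum_eq_zero_iff] at h0
  ext o
  cases o with
  | none => rw [ex_none]
  | some j =>
    rw [ex_some]
    split_ifs with hij
    · subst hij; omega
    · exact h0 j (by simp [Ne.symm hij])

theorem td_eq_zero {m : Option ι →₀ ℕ} (h : td m = 0) : m = Finsupp.single none (m none) := by
  rw [td, Finset.sum_eq_zero_iff] at h
  ext o
  cases o with
  | none => simp
  | some j => simpa using h j (Finset.mem_univ _)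

theorem numeric {d : ℕ} (hι : Fintype.card ι = d + 1) (hs : ∑ i, a i = 3) (j g : ℕ)
    (hj : j ≠ 0) (hjg : j = 1 → 4 ≤ g) (h2 : (QQ a j g 2).ncard = 1)
    (h3 : (QQ a j g 3).ncard = d + 5) :
    j = 1 ∧ g = 5 ∧ ∃ i1 i2, i1 ≠ i2 ∧ a i1 = 2 ∧ a i2 = 1 ∧ ∀ i, i ≠ i1 → i ≠ i2 → a i = 0 := by
  have ha : ∀ i, a i ≤ 3 := by
    intro i; rw [← hs]; exact Finset.single_le_sum (fun _ _ => Nat.zero_le _) (Finset.mem_univ i)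
  have hfin : (PP a 1).Finite := by rw [← coe_PPf]; exact Finset.finite_toSet _
  have hPP1 : (PP a 1).ncard = d + 4 := by
    rw [← coe_PPf, Set.ncard_coe_finset, card_PP1 a d hι hs]
  obtain ⟨m0, hm0⟩ := Set.ncard_eq_one.1 h2
  have hm : m0 ∈ QQ a j g 2 := by rw [hm0]; rfl
  have huniq : ∀ m, td m + j = 2 → m none + 3 * td m + g ≤ 6 + ad a m → m = m0 := by
    intro m h1 h2
    have : m ∈ QQ a j g 2 := ⟨h1, by have := weight_wl a ha m; omega⟩
    rw [hm0] at this; exact this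
  obtain ⟨hm1, hm2⟩ := hm
  have hw := weight_wl a ha m0
  have hj12 : j = 1 ∨ j = 2 := by omega
  rcases hj12 with rfl | rfl
  · -- j = 1
    have htd : td m0 = 1 := by omega
    obtain ⟨i, hi⟩ := td_eq_one htd
    have had : ad a m0 = a i := by rw [hi, ad_ex]
    have hc : ∀ i' e, e + g ≤ 3 + a i' → ex i' e = m0 := by
      intro i' e he
      apply huniq
      · rw [td_ex]
      · rw [td_ex, ad_ex, ex_none]; omega
    have h00 := hc i 0 (by omega)
    have hm0n : m0 none = 0 := by rw [← h00, ex_none]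
    have hg1 : g = 3 + a i := by
      by_contra hcon
      have := hc i 1 (by omega)
      have := DFunLike.congr_fun this none
      rw [ex_none, hm0n] at this
      omega
    have hoth : ∀ i', i' ≠ i → a i' < a i := by
      intro i' hi'
      by_contra hcon
      have := hc i' 0 (by omega)
      rw [← h00] at this
      have := DFunLike.congr_fun this (some i')
      rw [ex_some, ex_some, if_pos rfl, if_neg (Ne.symm hi')] at this
      omega
    have hsum := hs
    rw [← Finset.add_sum_erase _ _ (Finset.mem_univ i)] at hsum
    have hge := hjg rfl
    have hai := ha i
    have hcase : a i = 1 ∨ a i = 2 ∨ a i = 3 := by omega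
    rcases hcase with h | h | h
    · exfalso
      have : ∑ x ∈ Finset.univ.erase i, a x = 0 := by
        apply Finset.sum_eq_zero
        intro x hx
        have := hoth x (Finset.ne_of_mem_erase hx); omega
      omega
    · refine ⟨rfl, by omega, i, ?_⟩
      obtain ⟨i2, hi2, hi2'⟩ : ∃ i2 ∈ Finset.univ.erase i, a i2 ≠ 0 := by
        by_contra hcon
        push Not at hcon
        rw [Finset.sum_eq_zero hcon] at hsum
        omega
      have hne := Finset.ne_of_mem_erase hi2
      have h21 : a i2 = 1 := by have := hoth i2 hne; omega
      refine ⟨i2, hne.symm, h, h21, ?_⟩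
      rw [← Finset.add_sum_erase _ _ hi2] at hsum
      have h0 : ∑ x ∈ (Finset.univ.erase i).erase i2, a x = 0 := by omega
      rw [Finset.sum_eq_zero_iff] at h0
      intro x hx1 hx2
      exact h0 x (by simp [hx1, hx2])
    · exfalso
      have h0 : ∀ x, x ≠ i → a x = 0 := by
        have h0 : ∑ x ∈ Finset.univ.erase i, a x = 0 := by omega
        rw [Finset.sum_eq_zero_iff] at h0
        intro x hx
        exact h0 x (by simp [hx])
      have had : ∀ m, ad a m = 3 * m (some i) := by
        intro m
        rw [ad, Finset.sum_eq_single i]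
        · rw [h]
        · intro b _ hb; rw [h0 b hb, zero_mul]
        · simp
      have key : ∀ m ∈ QQ a 1 g 3, Finsupp.single (some i) 1 ≤ m ∧
          m - Finsupp.single (some i) 1 ∈ PP a 1 := by
        rintro m ⟨hm1, hm2⟩
        have hw := weight_wl a ha m
        rw [had] at hw
        have hle : Finsupp.single (some i) 1 ≤ m := by
          rw [Finsupp.single_le_iff]; omega
        refine ⟨hle, ?_⟩
        have hmm : m = ex i 0 + (m - Finsupp.single (some i) 1) := by
          have : ex i 0 = Finsupp.single (some i) 1 := by simp [ex]
          rw [this, add_tsub_cancel_of_le hle]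
        have h1 := td_add (ex i 0) (m - Finsupp.single (some i) 1)
        rw [← hmm, td_ex] at h1
        refine ⟨by omega, ?_⟩
        rw [had]
        simp
        omega
      have : (QQ a 1 g 3).ncard ≤ (PP a 1).ncard := by
        refine Set.ncard_le_ncard_of_injOn (fun m => m - Finsupp.single (some i) 1)
          (fun m hm => (key m hm).2) ?_ hfin
        intro m hm m' hm' heq
        simp only at heq
        rw [← add_tsub_cancel_of_le (key m hm).1, heq, add_tsub_cancel_of_le (key m' hm').1]
      omega
  · -- j = 2
    exfalso
    have htd : td m0 = 0 := by omega
    have hmz := td_eq_zero htd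
    have had0 : ∀ e, ad a (Finsupp.single none e) = 0 := by intro e; simp [ad]
    have htd0 : ∀ e, td (Finsupp.single (none : Option ι) e) = 0 := by intro e; simp [td]
    have had : ad a m0 = 0 := by rw [hmz, had0]
    have hc : ∀ e, e + g ≤ 6 → Finsupp.single none e = m0 := by
      intro e he
      apply huniq
      · rw [htd0]
      · rw [htd0, had0]; simp; omega
    have h00 := hc 0 (by omega)
    have hm0n : m0 none = 0 := by rw [← h00]; simp
    have hg1 : g = 6 := by
      by_contra hcon
      have := DFunLike.congr_fun (hc 1 (by omega)) none
      rw [hm0n] at this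
      simp at this
    have : QQ a 2 g 3 = PP a 1 := by
      ext m
      have hw := weight_wl a ha m
      constructor
      · rintro ⟨h1, h2⟩
        exact ⟨by omega, by omega⟩
      · rintro ⟨h1, h2⟩
        exact ⟨by omega, by omega⟩
    rw [this] at h3
    omega
end D3
end AMDP

open MvPolynomial
set_option linter.unusedSectionVars false
namespace AMDP

theorem finrank_map_add {K V W : Type} [Field K] [AddCommGroup V] [Module K V] [AddCommGroup W]
    [Module K W] (f : V →ₗ[K] W) (p : Submodule K V) [Module.Finite K p] :
    Module.finrank K (p.map f) + Module.finrank K ↥(p ⊓ LinearMap.ker f) = Module.finrank K p := by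
  have := LinearMap.finrank_range_add_finrank_ker (f.domRestrict p)
  rw [← this, LinearMap.range_domRestrict, LinearMap.ker_domRestrict]
  congr 1
  rw [← Submodule.finrank_map_subtype_eq, Submodule.map_comap_subtype]

section D4
variable {K ι : Type} [Field K] [Fintype ι] [DecidableEq ι] (a : ι → ℕ)

theorem mono_ex (i : ι) (e : ℕ) : (monomial (ex i e) (1 : K)) = X none ^ e * X (some i) := by
  rw [ex, X_pow_eq_monomial, X, monomial_mul, one_mul]

theorem scr_X' (p : (i : ι) × Fin (a i + 1)) :
    scr a (X p : MvPolynomial _ K) = X none ^ (p.2 : ℕ) * X (some p.1) := by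
  rw [scr_X, mono_ex]

theorem scr_inj (p0 p1 p2 q1 : (i : ι) × Fin (a i + 1)) 
    (hp0 : (p0.2 : ℕ) = 0) (hp1 : (p1.2 : ℕ) = 1) (h10 : p1.1 = p0.1)
    (hall : ∀ p : (i : ι) × Fin (a i + 1), p = p1 ∨ p = p2 ∨ p = q1 ∨ (p.2 : ℕ) = 0)
    (g : MvPolynomial ((i : ι) × Fin (a i + 1)) K)
    (hg : scr a (kill {p2, q1} g) = 0) : kill {p2, q1} g = 0 := by
  let F := FractionRing (MvPolynomial ((i : ι) × Fin (a i + 1)) K)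
  let β : MvPolynomial ((i : ι) × Fin (a i + 1)) K →ₐ[K] F := Algebra.algHom K _ _
  have hβ : Function.Injective β := IsFractionRing.injective (MvPolynomial ((i : ι) × Fin (a i + 1)) K) F
  have hb0 : β (X p0) ≠ 0 := by
    rw [Ne, map_eq_zero_iff β hβ]; exact X_ne_zero _
  let ρ : MvPolynomial (Option ι) K →ₐ[K] F :=
    aeval fun o => o.elim (β (X p1) / β (X p0)) fun i => β (X ⟨i, 0⟩)
  have key : ∀ f, ρ (scr a (kill {p2, q1} f)) = β (kill {p2, q1} f) := by
    have : (ρ.comp (scr a)).comp (kill {p2, q1}) = β.comp (kill {p2, q1}) := by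
      apply MvPolynomial.algHom_ext
      intro p
      simp only [AlgHom.comp_apply]
      by_cases hp : p ∈ ({p2, q1} : Set _)
      · have : kill {p2, q1} (X p : MvPolynomial _ K) = 0 := by rw [kill, aeval_X, if_pos hp]
        rw [this]; simp
      · have : kill {p2, q1} (X p : MvPolynomial _ K) = X p := by rw [kill, aeval_X, if_neg hp]
        rw [this, scr_X', map_mul, map_pow]
        simp only [ρ, aeval_X, Option.elim]
        simp only [Set.mem_insert_iff, Set.mem_singleton_iff, not_or] at hp
        rcases hall p with h | h | h | h
        · subst h
          rw [hp1, pow_one, h10]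
          have : (⟨p0.1, 0⟩ : (i : ι) × Fin (a i + 1)) = p0 := by
            obtain ⟨i, e⟩ := p0
            simp only at hp0 ⊢
            congr 1
            exact Fin.ext hp0.symm
          rw [this, div_mul_cancel₀ _ hb0]
        · exact absurd h hp.1
        · exact absurd h hp.2
        · rw [h, pow_zero, one_mul]
          obtain ⟨i, e⟩ := p
          have : e = 0 := Fin.ext h
          rw [this]
    intro f
    exact DFunLike.congr_fun this f
  apply hβ
  rw [← key, hg]; simp

theorem dims {r : ℕ} (I : Ideal (PS K r)) (Ω : MvPolynomial ((i : ι) × Fin (a i + 1)) K ≃ₐ[K] PS K r)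
    (hΩ : ∀ s, (Ω (X s)).IsHomogeneous 1) (hΩ' : ∀ i, (Ω.symm (X i)).IsHomogeneous 1)
    {F : Type} [Field F] [Algebra K F] (Θ : MvPolynomial (Option ι) K →ₐ[K] F)
    (hΘ : ∀ f, Θ (scr a f) = 0 ↔ Ω f ∈ I) (n : ℕ) :
    Module.finrank K ↥(((RingHom.ker Θ).restrictScalars K) ⊓ restrictSupport K (PP a n)) +
      (r + 1).multichoose n = (PPf a n).card +
      Module.finrank K ↥((I.restrictScalars K) ⊓ homogeneousSubmodule (Fin (r + 1)) K n) := by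
  let Ψ : PS K r →ₗ[K] MvPolynomial (Option ι) K := ((scr a).comp Ω.symm.toAlgHom).toLinearMap
  have hΨ : ∀ f, Ψ f = scr a (Ω.symm f) := fun f => rfl
  have hΘ2 : ∀ f, Θ (Ψ f) = 0 ↔ f ∈ I := by intro f; rw [hΨ, hΘ]; simp
  have m1 : (homogeneousSubmodule (Fin (r + 1)) K n).map Ψ = restrictSupport K (PP a n) := by
    rw [← scr_map]
    ext g
    simp only [Submodule.mem_map]
    constructor
    · rintro ⟨f, hf, rfl⟩
      exact ⟨Ω.symm f, homog_map Ω.symm.toAlgHom hΩ' hf, rfl⟩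
    · rintro ⟨f, hf, rfl⟩
      refine ⟨Ω f, homog_map Ω.toAlgHom hΩ hf, ?_⟩
      rw [hΨ]; simp
  have m2 : ((I.restrictScalars K) ⊓ homogeneousSubmodule (Fin (r + 1)) K n).map Ψ =
      ((RingHom.ker Θ).restrictScalars K) ⊓ restrictSupport K (PP a n) := by
    rw [← m1]
    ext g
    simp only [Submodule.mem_map, Submodule.mem_inf, Submodule.restrictScalars_mem, RingHom.mem_ker]
    constructor
    · rintro ⟨f, ⟨hf, hf2⟩, rfl⟩
      exact ⟨(hΘ2 f).2 hf, f, hf2, rfl⟩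
    · rintro ⟨hg, f, hf2, rfl⟩
      exact ⟨f, ⟨(hΘ2 f).1 hg, hf2⟩, rfl⟩
  have m3 : ((I.restrictScalars K) ⊓ homogeneousSubmodule (Fin (r + 1)) K n) ⊓ LinearMap.ker Ψ =
      homogeneousSubmodule (Fin (r + 1)) K n ⊓ LinearMap.ker Ψ := by
    ext f
    simp only [Submodule.mem_inf, Submodule.restrictScalars_mem, LinearMap.mem_ker]
    constructor
    · rintro ⟨⟨h1, h2⟩, h3⟩; exact ⟨h2, h3⟩
    · rintro ⟨h2, h3⟩; exact ⟨⟨(hΘ2 f).1 (by rw [h3, map_zero]), h2⟩, h3⟩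
  have : Module.Finite K ↥((I.restrictScalars K) ⊓ homogeneousSubmodule (Fin (r + 1)) K n) :=
    Submodule.finiteDimensional_of_le inf_le_right
  have e1 := finrank_map_add Ψ (homogeneousSubmodule (Fin (r + 1)) K n)
  have e2 := finrank_map_add Ψ ((I.restrictScalars K) ⊓ homogeneousSubmodule (Fin (r + 1)) K n)
  rw [m3, m2] at e2
  rw [m1, finrank_PP, finrank_hom, Fintype.card_fin] at e1
  omega
end D4
end AMDP

open MvPolynomial
set_option linter.unusedSectionVars false
namespace AMDP

section D5
variable {K ι : Type} [Field K] [Fintype ι] [DecidableEq ι] (a : ι → ℕ)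

theorem decompG (f : MvPolynomial (Option ι) K)
    (hf : f ∈ restrictSupport K {m : Option ι →₀ ℕ | td m = 1 ∧ m none ≤ ad a m + 2}) :
    ∃ u v w : MvPolynomial ((i : ι) × Fin (a i + 1)) K, u.IsHomogeneous 1 ∧ v.IsHomogeneous 1 ∧
      w.IsHomogeneous 1 ∧ f = scr a u * X none ^ 2 - X none * scr a w - scr a v := by
  rw [restrictSupport_eq_span] at hf
  induction hf using Submodule.span_induction with
  | mem x hx =>
    obtain ⟨m, ⟨h1, h2⟩, rfl⟩ := hx
    obtain ⟨i, hi⟩ := td_eq_one h1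
    have had : ad a m = a i := by rw [hi, ad_ex]
    set e := m none with he
    simp only
    rw [hi, mono_ex]
    have hz : ∀ n, (0 : MvPolynomial ((i : ι) × Fin (a i + 1)) K).IsHomogeneous n := fun n =>
      isHomogeneous_zero _ _ _
    rcases Nat.lt_or_ge e 2 with he2 | he2
    · rcases Nat.lt_or_ge e 1 with he1 | he1
      · refine ⟨0, -X ⟨i, 0⟩, 0, hz _, (isHomogeneous_X _ _).neg, hz _, ?_⟩
        have : e = 0 := by omega
        rw [map_neg, scr_X', this]; simp
      · refine ⟨0, 0, -X ⟨i, 0⟩, hz _, hz _, (isHomogeneous_X _ _).neg, ?_⟩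
        have : e = 1 := by omega
        rw [map_neg, scr_X', this]; simp
    · refine ⟨X ⟨i, ⟨e - 2, by omega⟩⟩, 0, 0, isHomogeneous_X _ _, hz _, hz _, ?_⟩
      rw [scr_X']
      simp only [map_zero, mul_zero, sub_zero]
      obtain ⟨k, hk⟩ := Nat.exists_eq_add_of_le he2
      rw [hk, Nat.add_sub_cancel_left]; ring
  | zero => exact ⟨0, 0, 0, isHomogeneous_zero _ _ _, isHomogeneous_zero _ _ _, isHomogeneous_zero _ _ _, by simp⟩
  | add x y _ _ hx hy =>
    obtain ⟨u, v, w, hu, hv, hw, rfl⟩ := hx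
    obtain ⟨u', v', w', hu', hv', hw', rfl⟩ := hy
    exact ⟨u + u', v + v', w + w', hu.add hu', hv.add hv', hw.add hw', by simp only [map_add]; ring⟩
  | smul c x _ hx =>
    obtain ⟨u, v, w, hu, hv, hw, rfl⟩ := hx
    refine ⟨c • u, c • v, c • w, Submodule.smul_mem (homogeneousSubmodule _ K 1) c hu,
      Submodule.smul_mem (homogeneousSubmodule _ K 1) c hv,
      Submodule.smul_mem (homogeneousSubmodule _ K 1) c hw, ?_⟩
    simp only [map_smul, smul_sub, smul_mul_assoc, mul_smul_comm]

theorem liftGH (ha3 : ∀ i, a i ≤ 3) {i1 i2 : ι} (h12 : i1 ≠ i2) (h1 : a i1 = 2) (h2 : a i2 = 1)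
    (h0 : ∀ i, i ≠ i1 → i ≠ i2 → a i = 0) (G : MvPolynomial (Option ι) K)
    (Q C : MvPolynomial ((i : ι) × Fin (a i + 1)) K) (hQ : scr a Q = X (some i1) * G)
    (hC : scr a C = X (some i2) * X (some i2) * G) (n : ℕ) (H : MvPolynomial (Option ι) K)
    (hH : H ∈ restrictSupport K (QQ a 1 5 n)) :
    ∃ g ∈ Ideal.span {Q, C}, scr a g = G * H := by
  rw [restrictSupport_eq_span] at hH
  induction hH using Submodule.span_induction with
  | mem x hx =>
    obtain ⟨m, ⟨hm1, hm2⟩, rfl⟩ := hx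
    have hw := weight_wl a ha3 m
    have had : ∀ m : Option ι →₀ ℕ, ad a m = 2 * m (some i1) + m (some i2) := by
      intro m
      rw [ad, ← Finset.add_sum_erase _ _ (Finset.mem_univ i1),
        ← Finset.add_sum_erase _ _ (show i2 ∈ Finset.univ.erase i1 by simp [h12.symm]),
        Finset.sum_eq_zero, h1, h2]
      · ring
      · intro x hx
        simp only [Finset.mem_erase] at hx
        rw [h0 x hx.2.1 hx.1, zero_mul]
    have hadm := had m
    rcases Nat.eq_zero_or_pos (m (some i1)) with hz | hp
    · have hle : Finsupp.single (some i2) 2 ≤ m := by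
        rw [Finsupp.single_le_iff]; omega
      set m' := m - Finsupp.single (some i2) 2 with hm'
      have hmm : m = Finsupp.single (some i2) 2 + m' := (add_tsub_cancel_of_le hle).symm
      have hn : m' none = m none := by simp [hm']
      have ha1 : m' (some i1) = m (some i1) := by simp [hm', h12.symm]
      have ha2 : m' (some i2) = m (some i2) - 2 := by simp [hm']
      obtain ⟨f, hf, hf2⟩ := scr_ge (K := K) a (td m') m' ⟨rfl, by rw [had, hn, ha1, ha2]; omega⟩
      refine ⟨f * C, Ideal.mul_mem_left _ _ (Ideal.subset_span (by simp)), ?_⟩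
      rw [map_mul, hf2, hC]
      simp only
      have : monomial m (1 : K) = X (some i2) * X (some i2) * monomial m' 1 := by
        rw [hmm, ← pow_two, X_pow_eq_monomial, monomial_mul, one_mul]
      rw [this]; ring
    · have hle : Finsupp.single (some i1) 1 ≤ m := by
        rw [Finsupp.single_le_iff]; omega
      set m' := m - Finsupp.single (some i1) 1 with hm'
      have hmm : m = Finsupp.single (some i1) 1 + m' := (add_tsub_cancel_of_le hle).symm
      have hn : m' none = m none := by simp [hm']
      have ha1 : m' (some i1) = m (some i1) - 1 := by simp [hm']
      have ha2 : m' (some i2) = m (some i2) := by simp [hm', h12]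
      obtain ⟨f, hf, hf2⟩ := scr_ge (K := K) a (td m') m' ⟨rfl, by rw [had, hn, ha1, ha2]; omega⟩
      refine ⟨f * Q, Ideal.mul_mem_left _ _ (Ideal.subset_span (by simp)), ?_⟩
      rw [map_mul, hf2, hQ]
      simp only
      have : monomial m (1 : K) = X (some i1) * monomial m' 1 := by
        rw [hmm, X, monomial_mul, one_mul]
      rw [this]; ring
  | zero => exact ⟨0, zero_mem _, by simp⟩
  | add x y _ _ hx hy =>
    obtain ⟨g, hg, hg2⟩ := hx
    obtain ⟨g', hg', hg2'⟩ := hy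
    exact ⟨g + g', add_mem hg hg', by rw [map_add, hg2, hg2', mul_add]⟩
  | smul c x _ hx =>
    obtain ⟨g, hg, hg2⟩ := hx
    exact ⟨c • g, Submodule.smul_of_tower_mem _ c hg, by rw [map_smul, hg2, mul_smul_comm]⟩
end D5
end AMDP

open MvPolynomial
set_option linter.unusedSectionVars false
namespace AMDP

section D6
variable {K ι : Type} [Field K] [Fintype ι] [DecidableEq ι] (a : ι → ℕ)

theorem cone_of_gens {r d : ℕ} (hr : d + 3 = r) (I : Ideal (PS K r)) (hcone : ¬ AMD.IsConeIdeal K r I)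
    {a b c d' e u v w : PS K r} (ha : a.IsHomogeneous 1) (hb : b.IsHomogeneous 1)
    (hc : c.IsHomogeneous 1) (hd : d'.IsHomogeneous 1) (he : e.IsHomogeneous 1)
    (hu : u.IsHomogeneous 1) (hv : v.IsHomogeneous 1) (hw : w.IsHomogeneous 1)
    (hI : I = Ideal.span {a*c-b*b, a*e-b*d', b*e-c*d', u*c-b*w-a*v, u*e*e-d'*e*w-d'*d'*v}) :
    d ≤ 4 := by
  classical
  by_contra hcon
  apply hcone
  let s : Finset (PS K r) := {a, b, c, d', e, u, v, w}
  have hs : s.card ≤ 8 := by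
    refine (Finset.card_insert_le _ _).trans (Nat.succ_le_succ ?_)
    refine (Finset.card_insert_le _ _).trans (Nat.succ_le_succ ?_)
    exact Finset.card_le_six
  let H : Submodule K (PS K r) := Submodule.span K (s : Set (PS K r))
  have hle : H ≤ homogeneousSubmodule (Fin (r + 1)) K 1 := by
    rw [Submodule.span_le]
    intro x hx
    simp only [s, Finset.coe_insert, Finset.coe_singleton, Set.mem_insert_iff,
      Set.mem_singleton_iff] at hx
    rcases hx with rfl | rfl | rfl | rfl | rfl | rfl | rfl | rfl <;> assumption
  refine cone_of_subspace I H (lt_of_le_of_ne hle ?_) ?_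
  · intro heq
    have h1 : Module.finrank K H ≤ s.card := finrank_span_finset_le_card s
    rw [heq, finrank_lin, Fintype.card_fin] at h1
    omega
  · have hmem : ∀ x ∈ s, x ∈ Algebra.adjoin K (H : Set (PS K r)) := fun x hx =>
      Algebra.subset_adjoin (Submodule.subset_span hx)
    have ma := hmem a (by simp [s])
    have mb := hmem b (by simp [s])
    have mc := hmem c (by simp [s])
    have md := hmem d' (by simp [s])
    have me := hmem e (by simp [s])
    have mu := hmem u (by simp [s])
    have mv := hmem v (by simp [s])
    have mw := hmem w (by simp [s])
    intro f hf
    have hf' := hf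
    rw [hI] at hf'
    refine Ideal.span_mono ?_ hf'
    intro x hx
    refine ⟨by rw [hI]; exact Ideal.subset_span hx, ?_⟩
    simp only [Set.mem_insert_iff, Set.mem_singleton_iff] at hx
    change x ∈ Algebra.adjoin K (H : Set (PS K r))
    rcases hx with rfl | rfl | rfl | rfl | rfl
    · exact sub_mem (mul_mem ma mc) (mul_mem mb mb)
    · exact sub_mem (mul_mem ma me) (mul_mem mb md)
    · exact sub_mem (mul_mem mb me) (mul_mem mc md)
    · exact sub_mem (sub_mem (mul_mem mu mc) (mul_mem mb mw)) (mul_mem ma mv)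
    · exact sub_mem (sub_mem (mul_mem (mul_mem mu me) me) (mul_mem (mul_mem md me) mw))
        (mul_mem (mul_mem md md) mv)

set_option maxHeartbeats 1600000 in
theorem coreD {r d : ℕ} (hr : d + 3 = r) (I : Ideal (PS K r))
    (hhom : AMD.IsHomIdeal K r I) (hnd : AMD.Nondeg K r I) (hcone : ¬ AMD.IsConeIdeal K r I)
    (hι : Fintype.card ι = d + 1) (hs : ∑ i, a i = 3)
    (Ω : MvPolynomial ((i : ι) × Fin (a i + 1)) K ≃ₐ[K] PS K r)
    (hΩ : ∀ s, (Ω (X s)).IsHomogeneous 1) (hΩ' : ∀ i, (Ω.symm (X i)).IsHomogeneous 1)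
    {F : Type} [Field F] [Algebra K F] (Θ : MvPolynomial (Option ι) K →ₐ[K] F)
    (hΘ : ∀ f, Θ (scr a f) = 0 ↔ Ω f ∈ I)
    (hlam : ∀ p : MvPolynomial (Option ι) K, WH wt 0 p → Θ p = 0 → p = 0)
    (htr : ((d + 1 : ℕ) : Cardinal) ≤ Algebra.trdeg K Θ.range)
    (hd2 : Module.finrank K ↥((I.restrictScalars K) ⊓ homogeneousSubmodule (Fin (r + 1)) K 2) = 4)
    (hd3 : Module.finrank K ↥((I.restrictScalars K) ⊓ homogeneousSubmodule (Fin (r + 1)) K 3) + 1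
      = 4 * (d + 4)) :
    d ≤ 4 ∧ AMD.HasBettiDiagram K r I bt := by
  have ha3 : ∀ i, a i ≤ 3 := by
    intro i; rw [← hs]; exact Finset.single_le_sum (fun _ _ => Nat.zero_le _) (Finset.mem_univ i)
  -- dimension counts
  have e2 : Module.finrank K ↥(((RingHom.ker Θ).restrictScalars K) ⊓ restrictSupport K (PP a 2)) = 1 := by
    have h1 := dims a I Ω hΩ hΩ' Θ hΘ 2
    have h2 := card_PP2 a d hι hs
    have h3 := multichoose_two' (r + 1)
    rw [hd2] at h1
    subst hr
    nlinarith
  have e3 : Module.finrank K ↥(((RingHom.ker Θ).restrictScalars K) ⊓ restrictSupport K (PP a 3)) = d + 5 := by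
    have h1 := dims a I Ω hΩ hΩ' Θ hΘ 3
    have h2 := card_PP3 a d hι hs
    have h3 := multichoose_three' (r + 1)
    subst hr
    nlinarith
  -- the quadric
  obtain ⟨q, hq, hq0⟩ : ∃ q ∈ (((RingHom.ker Θ).restrictScalars K) ⊓ restrictSupport K (PP a 2)), q ≠ 0 := by
    apply Submodule.exists_mem_ne_zero_of_ne_bot
    intro hbot
    rw [hbot] at e2
    simp at e2
  obtain ⟨hqΘ, hqP⟩ := hq
  have hqP' := (mem_rsPP a ha3 2 q).1 hqP
  obtain ⟨G, j, hG0, hGj, hker⟩ := ker_span hι Θ htr 2 q hq0 hqP'.1 hqΘ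
  have hΘG : Θ G = 0 := by
    have : G ∈ RingHom.ker Θ := by rw [hker]; exact Ideal.mem_span_singleton_self _
    exact this
  rw [hker, finrank_QQ a ha3 hG0 hGj] at e2 e3
  have hPP1 : ∀ p ∈ restrictSupport K (PP a 1), Θ p = 0 → p = 0 := by
    intro p hp hp0
    rw [← scr_map] at hp
    obtain ⟨f, hf, rfl⟩ := hp
    have h1 : Ω f ∈ I := (hΘ f).1 hp0
    have h2 := hnd _ h1 (homog_map Ω.toAlgHom hΩ hf)
    have h3 : f = 0 := by simpa using h2
    rw [h3]; simp
  have hj0 : j ≠ 0 := by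
    rintro rfl
    exact hG0 (hlam G hGj hΘG)
  have hjg : j = 1 → 4 ≤ wd (wl a) G := by
    rintro rfl
    by_contra hcon
    exact hG0 (hPP1 G ((mem_rsPP a ha3 1 G).2 ⟨hGj, by omega⟩) hΘG)
  obtain ⟨rfl, hg5, i1, i2, h12, h1, h2, h0⟩ := numeric a hι hs j _ hj0 hjg e2 e3
  -- coordinates
  let p0 : (i : ι) × Fin (a i + 1) := ⟨i1, 0⟩
  let p1 : (i : ι) × Fin (a i + 1) := ⟨i1, ⟨1, by omega⟩⟩
  let p2 : (i : ι) × Fin (a i + 1) := ⟨i1, ⟨2, by omega⟩⟩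
  let q0 : (i : ι) × Fin (a i + 1) := ⟨i2, 0⟩
  let q1 : (i : ι) × Fin (a i + 1) := ⟨i2, ⟨1, by omega⟩⟩
  have hp0 : scr a (X p0 : MvPolynomial _ K) = X (some i1) := by rw [scr_X']; simp [p0]
  have hp1 : scr a (X p1 : MvPolynomial _ K) = X none * X (some i1) := by rw [scr_X']; simp [p1]
  have hp2 : scr a (X p2 : MvPolynomial _ K) = X none ^ 2 * X (some i1) := by rw [scr_X']
  have hq0' : scr a (X q0 : MvPolynomial _ K) = X (some i2) := by rw [scr_X']; simp [q0]
  have hq1 : scr a (X q1 : MvPolynomial _ K) = X none * X (some i2) := by rw [scr_X']; simp [q1]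
  have hdist : [p0, p1, p2, q0, q1].Nodup := by
    have e01 : p0 ≠ p1 := by
      intro h; have := congrArg (fun p => ((p : (i : ι) × Fin (a i + 1)).2 : ℕ)) h; simp [p0, p1] at this
    have e02 : p0 ≠ p2 := by
      intro h; have := congrArg (fun p => ((p : (i : ι) × Fin (a i + 1)).2 : ℕ)) h; simp [p0, p2] at this
    have e12 : p1 ≠ p2 := by
      intro h; have := congrArg (fun p => ((p : (i : ι) × Fin (a i + 1)).2 : ℕ)) h; simp [p1, p2] at this
    have f01 : q0 ≠ q1 := by
      intro h; have := congrArg (fun p => ((p : (i : ι) × Fin (a i + 1)).2 : ℕ)) h; simp [q0, q1] at this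
    have hd : ∀ p q : (i : ι) × Fin (a i + 1), p.1 = i1 → q.1 = i2 → p ≠ q := by
      rintro p q hp hq rfl; exact h12 (hp.symm.trans hq)
    simp only [List.nodup_cons, List.mem_cons, List.not_mem_nil, not_or, or_false, not_false_iff,
      List.nodup_nil, and_true]
    exact ⟨⟨e01, e02, hd _ _ rfl rfl, hd _ _ rfl rfl⟩, ⟨e12, hd _ _ rfl rfl, hd _ _ rfl rfl⟩,
      ⟨hd _ _ rfl rfl, hd _ _ rfl rfl⟩, f01⟩
  have hall : ∀ p : (i : ι) × Fin (a i + 1), p = p1 ∨ p = p2 ∨ p = q1 ∨ (p.2 : ℕ) = 0 := by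
    rintro ⟨i, e⟩
    by_cases hi1 : i = i1
    · subst hi1
      have := e.2
      have hc : (e : ℕ) = 0 ∨ (e : ℕ) = 1 ∨ (e : ℕ) = 2 := by omega
      rcases hc with h | h | h
      · exact Or.inr (Or.inr (Or.inr h))
      · exact Or.inl (by simp only [p1]; congr 1; exact Fin.ext h)
      · exact Or.inr (Or.inl (by simp only [p2]; congr 1; exact Fin.ext h))
    · by_cases hi2 : i = i2
      · subst hi2
        have := e.2
        have hc : (e : ℕ) = 0 ∨ (e : ℕ) = 1 := by omega
        rcases hc with h | h
        · exact Or.inr (Or.inr (Or.inr h))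
        · exact Or.inr (Or.inr (Or.inl (by simp only [q1]; congr 1; exact Fin.ext h)))
      · have := h0 i hi1 hi2
        have := e.2
        exact Or.inr (Or.inr (Or.inr (by simp only; omega)))
  have hinj := scr_inj (K := K) a p0 p1 p2 q1 rfl rfl rfl hall
  -- G
  have hGs : G ∈ restrictSupport K {m : Option ι →₀ ℕ | td m = 1 ∧ m none ≤ ad a m + 2} := by
    rw [mem_rs]
    intro m hm
    have h3 := hGj m hm
    have h4 := (wd_le_iff (wl a) (f := G)).1 le_rfl m hm
    have h5 := weight_wl a ha3 m
    rw [weight_wt] at h3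
    exact ⟨h3, by omega⟩
  obtain ⟨u, v, w, hu, hv, hw, hGe⟩ := decompG a G hGs
  obtain ⟨Q, hQdef⟩ : ∃ Q, Q = u * X p2 - X p1 * w - X p0 * v := ⟨_, rfl⟩
  obtain ⟨C, hCdef⟩ : ∃ C, C = u * X q1 * X q1 - X q0 * X q1 * w - X q0 * X q0 * v := ⟨_, rfl⟩
  have hQ : scr a Q = X (some i1) * G := by
    rw [hQdef, hGe]; simp only [map_sub, map_mul, hp0, hp1, hp2]; ring
  have hC : scr a C = X (some i2) * X (some i2) * G := by
    rw [hCdef, hGe]; simp only [map_sub, map_mul, hq0', hq1]; ring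
  have hD1 : scr a (X p0 * X p2 - X p1 * X p1 : MvPolynomial _ K) = 0 := by
    simp only [map_sub, map_mul, hp0, hp1, hp2]; ring
  have hD2 : scr a (X p0 * X q1 - X p1 * X q0 : MvPolynomial _ K) = 0 := by
    simp only [map_sub, map_mul, hp0, hp1, hq0', hq1]; ring
  have hD3 : scr a (X p1 * X q1 - X p2 * X q0 : MvPolynomial _ K) = 0 := by
    simp only [map_sub, map_mul, hp1, hp2, hq0', hq1]; ring
  have hX0 : scr a (X p0 : MvPolynomial _ K) ≠ 0 := by rw [hp0]; exact X_ne_zero _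
  have hCn : C ∉ Ideal.span {(X p0 : MvPolynomial ((i : ι) × Fin (a i + 1)) K), X p1, X p2} := by
    intro hmem
    have h3 : scr a C ∈ Ideal.span {(X (some i1) : MvPolynomial (Option ι) K)} := by
      have : Ideal.span {(X p0 : MvPolynomial ((i : ι) × Fin (a i + 1)) K), X p1, X p2} ≤
          (Ideal.span {(X (some i1) : MvPolynomial (Option ι) K)}).comap (scr a) := by
        rw [Ideal.span_le]
        intro x hx
        simp only [Set.mem_insert_iff, Set.mem_singleton_iff] at hx
        simp only [SetLike.mem_coe, Ideal.mem_comap, Ideal.mem_span_singleton']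
        rcases hx with rfl | rfl | rfl
        · exact ⟨1, by rw [hp0, one_mul]⟩
        · exact ⟨_, hp1.symm⟩
        · exact ⟨_, hp2.symm⟩
      exact this hmem
    rw [hC, Ideal.mem_span_singleton] at h3
    have hpr : Prime (X (some i1) : MvPolynomial (Option ι) K) := X_prime
    have hnd2 : ¬ (X (some i1) : MvPolynomial (Option ι) K) ∣ X (some i2) := by
      rw [X_dvd_X]
      simp [h12]
    have h4 : (X (some i1) : MvPolynomial (Option ι) K) ∣ G := by
      rcases hpr.dvd_or_dvd h3 with h | h
      · rcases hpr.dvd_or_dvd h with h | h <;> exact absurd h hnd2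
      · exact h
    obtain ⟨H, hH⟩ := h4
    have hH0 : H ≠ 0 := by rintro rfl; apply hG0; rw [hH, mul_zero]
    have hX1 : (X (some i1) : MvPolynomial (Option ι) K) ≠ 0 := X_ne_zero _
    have hw1 : WH wt 1 (X (some i1) : MvPolynomial (Option ι) K) := by
      intro m hm
      rw [support_X, Finset.mem_singleton] at hm
      subst hm
      rw [weight_wt]
      simpa [ex] using td_ex i1 0
    have hwH : WH wt (wd wt H) H := by
      refine WH_of_mul wt hH0 hX1 (n := 1) ?_
      rw [mul_comm, ← hH]; exact hGj
    have h5 := WH_unique wt hG0 hGj (by rw [hH]; exact WH_mul wt hw1 hwH)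
    have h6 : wd wt H = 0 := by omega
    rw [h6] at hwH
    have h7 : Θ (X (some i1)) ≠ 0 := by
      intro h
      refine hX1 (hPP1 _ ?_ h)
      rw [← hp0]
      exact scr_le a 1 _ (isHomogeneous_X _ _)
    rw [hH, map_mul] at hΘG
    exact hH0 (hlam H hwH ((mul_eq_zero.1 hΘG).resolve_left h7))
  have hres := resData_vars (scr a (K := K)).toRingHom hdist hX0 hD1 hD2 hinj u v w
    (by rw [← hQdef]; change scr a Q ≠ 0; rw [hQ]; exact mul_ne_zero (X_ne_zero _) hG0)
    (by rw [← hCdef]; exact hCn)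
  have hres' := hres.transport Ω.toRingEquiv
  -- the ideal
  have hJ : ∀ (n : ℕ) (f : MvPolynomial ((i : ι) × Fin (a i + 1)) K), f.IsHomogeneous n → Ω f ∈ I →
      f ∈ Ideal.span {X p0 * X p2 - X p1 * X p1, X p0 * X q1 - X p1 * X q0,
        X p1 * X q1 - X p2 * X q0, Q, C} := by
    intro n f hf hfI
    have h3 := scr_le a n f hf
    have h4 : scr a f ∈ Ideal.span {G} := by rw [← hker]; exact (hΘ f).2 hfI
    obtain ⟨H, hH⟩ := Ideal.mem_span_singleton'.1 h4
    rw [← hH, mul_comm, mul_mem_PP a ha3 hG0 hGj, hg5] at h3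
    obtain ⟨g, hg, hg2⟩ := liftGH a ha3 h12 h1 h2 h0 G Q C hQ hC n H h3
    have h5 := kerD (scr a (K := K)).toRingHom hdist hX0 hD1 hD2 hinj (f - g) (by
      change scr a (f - g) = 0
      rw [map_sub, hg2, ← hH]; ring)
    have h6 : f = (f - g) + g := by ring
    rw [h6]
    refine add_mem (Ideal.span_mono ?_ h5) (Ideal.span_mono ?_ hg)
    · rintro x (hx | hx | hx)
      · exact Or.inl hx
      · exact Or.inr (Or.inl hx)
      · exact Or.inr (Or.inr (Or.inl hx))
    · intro x hx
      exact Or.inr (Or.inr (Or.inr hx))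
  have hI : I = Ideal.span {Ω (X p0)*Ω (X p2)-Ω (X p1)*Ω (X p1), Ω (X p0)*Ω (X q1)-Ω (X p1)*Ω (X q0),
      Ω (X p1)*Ω (X q1)-Ω (X p2)*Ω (X q0), Ω u*Ω (X p2)-Ω (X p1)*Ω w-Ω (X p0)*Ω v,
      Ω u*Ω (X q1)*Ω (X q1)-Ω (X q0)*Ω (X q1)*Ω w-Ω (X q0)*Ω (X q0)*Ω v} := by
    apply le_antisymm
    · intro f hf
      rw [← sum_homogeneousComponent f]
      refine Ideal.sum_mem _ fun n _ => ?_
      have h3 := hJ n (Ω.symm (homogeneousComponent n f))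
        (homog_map Ω.symm.toAlgHom hΩ' (homogeneousComponent_isHomogeneous n f))
        (by simpa using hhom f hf n)
      have h4 := Ideal.mem_map_of_mem Ω h3
      rw [Ideal.map_span, AlgEquiv.apply_symm_apply] at h4
      simpa only [Set.image_insert_eq, Set.image_singleton, map_sub, map_mul, hQdef, hCdef] using h4
    · rw [Ideal.span_le]
      have hsc : ∀ g : MvPolynomial ((i : ι) × Fin (a i + 1)) K, scr a g = 0 → Ω g ∈ I := by
        intro g hg; rw [← hΘ, hg, map_zero]
      intro x hx
      change x ∈ I
      rcases hx with rfl | rfl | rfl | rfl | rfl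
      · simpa only [map_sub, map_mul] using hsc _ hD1
      · simpa only [map_sub, map_mul] using hsc _ hD2
      · simpa only [map_sub, map_mul] using hsc _ hD3
      · have : Ω Q ∈ I := by rw [← hΘ, hQ, map_mul, hΘG, mul_zero]
        simpa only [hQdef, map_sub, map_mul] using this
      · have : Ω C ∈ I := by rw [← hΘ, hC, map_mul, hΘG, mul_zero]
        simpa only [hCdef, map_sub, map_mul] using this
  have Hu := homog_map Ω.toAlgHom hΩ hu
  have Hv := homog_map Ω.toAlgHom hΩ hv
  have Hw := homog_map Ω.toAlgHom hΩ hw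
  exact ⟨cone_of_gens hr I hcone (hΩ p0) (hΩ p1) (hΩ p2) (hΩ q0) (hΩ q1) Hu Hv Hw hI,
    betti_of_resData (hΩ p0) (hΩ p1) (hΩ p2) (hΩ q0) (hΩ q1) Hu Hv Hw hres' I hI⟩
end D6
end AMDP

open MvPolynomial
set_option linter.unusedSectionVars false
namespace AMDP

section D7
variable {K F : Type} [Field K] [Field F] [Algebra K F]

theorem extend_chain (lam : F) (V : Submodule K F) [Module.Finite K V] {ι0 : Type} [Fintype ι0]
    [DecidableEq ι0] (a0 : ι0 → ℕ) (t0 : ι0 → F) (hV : ∀ i e, e ≤ a0 i → lam ^ e * t0 i ∈ V)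
    {σ : Type} [Fintype σ] (L : σ → F) (hL : LinearIndependent K L)
    (hcard : Fintype.card σ = ∑ i, a0 i + Fintype.card ι0)
    (hLt : ∀ s, ∃ i e, e ≤ a0 i ∧ L s = lam ^ e * t0 i) :
    ∃ (ι : Type) (_ : Fintype ι) (_ : DecidableEq ι) (a : ι → ℕ) (t : ι → F),
      ∑ i, a i = ∑ i, a0 i ∧ Fintype.card ι + ∑ i, a0 i = Module.finrank K V ∧
      (∀ p : (i : ι) × Fin (a i + 1), lam ^ (p.2 : ℕ) * t p.1 ∈ V) ∧
      LinearIndependent K (fun p : (i : ι) × Fin (a i + 1) => lam ^ (p.2 : ℕ) * t p.1) := by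
  let U := Submodule.span K (Set.range L)
  have hUV : U ≤ V := by
    rw [Submodule.span_le]
    rintro _ ⟨s, rfl⟩
    obtain ⟨i, e, he, h⟩ := hLt s
    rw [h]; exact hV i e he
  obtain ⟨W', hW'⟩ := Submodule.exists_isCompl U
  have hsup : U ⊔ (W' ⊓ V) = V := by
    rw [← sup_inf_assoc_of_le _ hUV, hW'.sup_eq_top, top_inf_eq]
  have hinf : U ⊓ (W' ⊓ V) = ⊥ := by
    rw [← inf_assoc, hW'.inf_eq_bot, bot_inf_eq]
  have : Module.Finite K U := Submodule.finiteDimensional_of_le hUV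
  have : Module.Finite K ↥(W' ⊓ V) := Submodule.finiteDimensional_of_le inf_le_right
  have hdim := Submodule.finrank_sup_add_finrank_inf_eq U (W' ⊓ V)
  rw [hsup, hinf, finrank_bot, finrank_span_eq_card hL, hcard] at hdim
  let b := Module.finBasis K ↥(W' ⊓ V)
  let ι := ι0 ⊕ Fin (Module.finrank K ↥(W' ⊓ V))
  let a : ι → ℕ := Sum.elim a0 fun _ => 0
  let t : ι → F := Sum.elim t0 fun j => (b j : F)
  have hmem : ∀ p : (i : ι) × Fin (a i + 1), lam ^ (p.2 : ℕ) * t p.1 ∈ V := by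
    rintro ⟨i | j, e⟩
    · exact hV i e (Nat.lt_succ_iff.1 e.2)
    · have : (e : ℕ) = 0 := by
        have h : (e : ℕ) < 0 + 1 := e.2
        omega
      simp only [this, pow_zero, one_mul]
      exact (b j).2.2
  have hsum : ∑ i, a i = ∑ i, a0 i := by simp [a, ι]
  have hcι : Fintype.card ι + ∑ i, a0 i = Module.finrank K V := by
    simp [ι]; omega
  refine ⟨ι, inferInstance, inferInstance, a, t, hsum, hcι, hmem, ?_⟩
  rw [linearIndependent_iff_card_eq_finrank_span, Set.finrank]
  have hspan : Submodule.span K (Set.range (fun p : (i : ι) × Fin (a i + 1) => lam ^ (p.2 : ℕ) * t p.1)) = V := by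
    apply le_antisymm
    · rw [Submodule.span_le]
      rintro _ ⟨p, rfl⟩
      exact hmem p
    · rw [← hsup]
      apply sup_le
      · rw [Submodule.span_le]
        rintro _ ⟨s, rfl⟩
        obtain ⟨i, e, he, h⟩ := hLt s
        exact Submodule.subset_span ⟨⟨Sum.inl i, ⟨e, Nat.lt_succ_of_le he⟩⟩, h.symm⟩
      · intro x hx
        have h1 := b.mem_span ⟨x, hx⟩
        have h2 := Submodule.mem_map_of_mem (f := (W' ⊓ V).subtype) h1
        rw [Submodule.map_span] at h2
        refine Submodule.span_mono ?_ h2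
        rintro _ ⟨_, ⟨j, rfl⟩, rfl⟩
        exact ⟨⟨Sum.inr j, ⟨0, Nat.succ_pos _⟩⟩, by simp [t]⟩
  rw [hspan, Fintype.card_sigma, ← hcι, ← hsum]
  simp [Finset.sum_add_distrib]
  omega

theorem chains (lam : F) (hlam : Transcendental K lam) (V : Submodule K F) [Module.Finite K V]
    (M : Submodule K F) (hMV : M ≤ V) (hM3 : Module.finrank K M = 3) (hMl : ∀ x ∈ M, lam * x ∈ V) :
    ∃ (ι : Type) (_ : Fintype ι) (_ : DecidableEq ι) (a : ι → ℕ) (t : ι → F),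
      ∑ i, a i = 3 ∧ Fintype.card ι + 3 = Module.finrank K V ∧
      (∀ p : (i : ι) × Fin (a i + 1), lam ^ (p.2 : ℕ) * t p.1 ∈ V) ∧
      LinearIndependent K (fun p : (i : ι) × Fin (a i + 1) => lam ^ (p.2 : ℕ) * t p.1) := by
  have hMf : Module.Finite K M := Submodule.finiteDimensional_of_le hMV
  have hpow : ∀ (n : ℕ) (x : F), x ≠ 0 → LinearIndependent K (fun e : Fin n => lam ^ (e : ℕ) * x) := by
    intro n x hx
    have h1 : LinearIndependent K (fun e : ℕ => lam ^ e) := by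
      have hb := (Polynomial.basisMonomials K).linearIndependent
      have := hb.map' (Polynomial.aeval lam).toLinearMap (by
        rw [LinearMap.ker_eq_bot]; exact transcendental_iff_injective.1 hlam)
      have he : (fun e : ℕ => lam ^ e) = (Polynomial.aeval lam).toLinearMap ∘ (Polynomial.basisMonomials K) := by
        funext e
        simp
      rw [he]
      exact this
    have h2 : LinearIndependent K (fun e : Fin n => lam ^ (e : ℕ)) := h1.comp _ Fin.val_injective
    have h3 := h2.map' (LinearMap.mulRight K x) (by
      rw [LinearMap.ker_eq_bot]; exact mul_left_injective₀ hx)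
    exact h3
  by_cases hi : ∃ x ∈ M, x ≠ 0 ∧ lam * x ∈ M ∧ lam * (lam * x) ∈ M
  · obtain ⟨x, hx, hx0, hx1, hx2⟩ := hi
    obtain ⟨ι, h1, h2, a, t, h3, h4, h5, h6⟩ := extend_chain lam V (fun _ : Unit => 3) (fun _ => x) (by
      intro _ e he
      have : e = 0 ∨ e = 1 ∨ e = 2 ∨ e = 3 := by omega
      rcases this with rfl | rfl | rfl | rfl
      · simpa using hMV hx
      · simpa using hMV hx1
      · convert hMV hx2 using 1; ring
      · convert hMl _ hx2 using 1; ring) _ (hpow 4 x hx0) (by simp) (by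
        intro s
        exact ⟨(), s, by have := s.2; omega, rfl⟩)
    exact ⟨ι, h1, h2, a, t, by simpa using h3, by simpa using h4, h5, h6⟩
  by_cases hii : ∃ x ∈ M, x ≠ 0 ∧ lam * x ∈ M
  · obtain ⟨x, hx, hx0, hx1⟩ := hii
    have hxx := hpow 2 x hx0
    have hcard4 : ∀ f : Fin 4 → F, (∀ i, f i ∈ M) → ¬ LinearIndependent K f := by
      intro f hf hli
      have h1 : Submodule.span K (Set.range f) ≤ M := by
        rw [Submodule.span_le]; rintro _ ⟨i, rfl⟩; exact hf i
      have h2 := Submodule.finrank_mono h1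
      rw [finrank_span_eq_card hli, hM3, Fintype.card_fin] at h2
      omega
    have hN' : ∀ w ∈ M, lam * w ∈ M → ∃ c : K, w = c • x := by
      intro w hw hw1
      by_contra hcon
      push Not at hcon
      have hxw : ∀ α β : K, α • x + β • w = 0 → α = 0 ∧ β = 0 := by
        intro α β h
        have hβ : β = 0 := by
          by_contra hβ
          apply hcon (-(β⁻¹ * α))
          have h2 : β • w = -(α • x) := by rw [eq_neg_iff_add_eq_zero, add_comm]; exact h
          rw [← inv_smul_smul₀ hβ w, h2, smul_neg, smul_smul, neg_smul]
        rw [hβ, zero_smul, add_zero] at h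
        exact ⟨(smul_eq_zero.1 h).resolve_right hx0, hβ⟩
      have h4 := hcard4 ![x, w, lam * x, lam * w] (by
        intro i; fin_cases i
        · exact hx
        · exact hw
        · exact hx1
        · exact hw1)
      apply h4
      rw [Fintype.linearIndependent_iff]
      intro g hg
      simp only [Fin.sum_univ_four, Matrix.cons_val] at hg
      have hz : lam * (g 2 • x + g 3 • w) = -(g 0 • x + g 1 • w) := by
        rw [eq_neg_iff_add_eq_zero, ← hg, mul_add, mul_smul_comm, mul_smul_comm]; ring
      have hz0 : g 2 • x + g 3 • w = 0 := by
        by_contra hne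
        apply hi
        refine ⟨_, M.add_mem (M.smul_mem _ hx) (M.smul_mem _ hw), hne, ?_, ?_⟩
        · rw [hz]; exact M.neg_mem (M.add_mem (M.smul_mem _ hx) (M.smul_mem _ hw))
        · rw [hz, mul_neg, mul_add, mul_smul_comm, mul_smul_comm]
          exact M.neg_mem (M.add_mem (M.smul_mem _ hx1) (M.smul_mem _ hw1))
      rw [hz0, mul_zero, eq_comm, neg_eq_zero] at hz
      obtain ⟨h0, h1⟩ := hxw _ _ hz
      obtain ⟨h2, h3⟩ := hxw _ _ hz0
      intro i; fin_cases i <;> assumption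
    obtain ⟨y, hy, hyn⟩ : ∃ y ∈ M, y ∉ Submodule.span K (Set.range fun e : Fin 2 => lam ^ (e : ℕ) * x) := by
      by_contra hcon
      push Not at hcon
      have : Module.Finite K (Submodule.span K (Set.range fun e : Fin 2 => lam ^ (e : ℕ) * x)) :=
        FiniteDimensional.span_of_finite K (Set.finite_range _)
      have h2 := Submodule.finrank_mono (show M ≤ _ from hcon)
      rw [finrank_span_eq_card hxx, hM3, Fintype.card_fin] at h2
      omega
    have hind3 : ∀ α β δ : K, α • x + β • (lam * x) + δ • y = 0 → α = 0 ∧ β = 0 ∧ δ = 0 := by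
      intro α β δ h
      have hδ : δ = 0 := by
        by_contra hδ
        apply hyn
        have h2 : δ • y = -(α • x + β • (lam * x)) := by
          rw [eq_neg_iff_add_eq_zero, add_comm]; exact h
        rw [← inv_smul_smul₀ hδ y, h2]
        refine Submodule.smul_mem _ _ (Submodule.neg_mem _ (Submodule.add_mem _
          (Submodule.smul_mem _ _ (Submodule.subset_span ⟨0, by simp⟩))
          (Submodule.smul_mem _ _ (Submodule.subset_span ⟨1, by simp⟩))))
      rw [hδ, zero_smul, add_zero] at h
      rw [Fintype.linearIndependent_iff] at hxx
      have h3 := hxx ![α, β] (by simpa [Fin.sum_univ_two] using h)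
      exact ⟨h3 0, h3 1, hδ⟩
    have hind5 : LinearIndependent K ![x, lam * x, lam ^ 2 * x, y, lam * y] := by
      rw [Fintype.linearIndependent_iff]
      intro g hg
      simp only [Fin.sum_univ_five, Matrix.cons_val] at hg
      have hw : lam * (g 2 • (lam * x) + g 4 • y) = -(g 0 • x + g 1 • (lam * x) + g 3 • y) := by
        rw [eq_neg_iff_add_eq_zero, ← hg, mul_add, mul_smul_comm, mul_smul_comm, pow_two, mul_assoc]; ring
      obtain ⟨c, hc⟩ := hN' (g 2 • (lam * x) + g 4 • y)
        (M.add_mem (M.smul_mem _ hx1) (M.smul_mem _ hy)) (by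
          rw [hw]
          exact M.neg_mem (M.add_mem (M.add_mem (M.smul_mem _ hx) (M.smul_mem _ hx1)) (M.smul_mem _ hy)))
      obtain ⟨h1, h2, h3⟩ := hind3 (-c) (g 2) (g 4) (by rw [add_assoc, hc, ← add_smul]; simp)
      have hc0 : c = 0 := by simpa using h1
      rw [hc, hc0, zero_smul, mul_zero, eq_comm, neg_eq_zero] at hw
      obtain ⟨h4, h5, h6⟩ := hind3 _ _ _ hw
      intro i; fin_cases i <;> assumption
    obtain ⟨ι, h1, h2, a, t, h3, h4, h5, h6⟩ := extend_chain lam V ![2, 1] ![x, y] (by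
      intro i e he
      fin_cases i
      · have he' : e ≤ 2 := he
        have : e = 0 ∨ e = 1 ∨ e = 2 := by omega
        rcases this with rfl | rfl | rfl
        · simpa using hMV hx
        · simpa using hMV hx1
        · convert hMl _ hx1 using 1; simp; ring
      · have he' : e ≤ 1 := he
        have : e = 0 ∨ e = 1 := by omega
        rcases this with rfl | rfl
        · simpa using hMV hy
        · simpa using hMl _ hy) _ hind5 (by simp) (by
        intro s
        fin_cases s
        · exact ⟨0, 0, by simp, by simp⟩
        · exact ⟨0, 1, by simp, by simp⟩
        · exact ⟨0, 2, by simp, by simp⟩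
        · exact ⟨1, 0, by simp, by simp⟩
        · exact ⟨1, 1, by simp, by simp⟩)
    exact ⟨ι, h1, h2, a, t, by simpa using h3, by simpa using h4, h5, h6⟩
  · push Not at hii
    let b := Module.finBasisOfFinrankEq K M hM3
    let m : Fin 3 → F := fun i => (b i : F)
    have hm : LinearIndependent K m := b.linearIndependent.map' M.subtype (Submodule.ker_subtype M)
    have hmM : ∀ i, m i ∈ M := fun i => (b i).2
    have hind : LinearIndependent K (Sum.elim m fun i => lam * m i) := by
      rw [Fintype.linearIndependent_iff]
      intro g hg
      simp only [Fintype.sum_sum_type, Sum.elim_inl, Sum.elim_inr] at hg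
      have hz : lam * (∑ i, g (Sum.inr i) • m i) = -∑ i, g (Sum.inl i) • m i := by
        rw [eq_neg_iff_add_eq_zero, ← hg, Finset.mul_sum, add_comm]
        simp_rw [mul_smul_comm]
      have h0 : ∑ i, g (Sum.inr i) • m i = 0 := by
        by_contra hne
        refine hii _ (M.sum_mem fun i _ => M.smul_mem _ (hmM i)) hne ?_
        rw [hz]
        exact M.neg_mem (M.sum_mem fun i _ => M.smul_mem _ (hmM i))
      rw [h0, mul_zero, eq_comm, neg_eq_zero] at hz
      rw [Fintype.linearIndependent_iff] at hm
      rintro (i | i)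
      · exact hm _ hz i
      · exact hm _ h0 i
    obtain ⟨ι, h1, h2, a, t, h3, h4, h5, h6⟩ := extend_chain lam V (fun _ : Fin 3 => 1) m (by
      intro i e he
      have : e = 0 ∨ e = 1 := by omega
      rcases this with rfl | rfl
      · simpa using hMV (hmM i)
      · simpa using hMl _ (hmM i)) _ hind (by simp) (by
        rintro (i | i)
        · exact ⟨i, 0, by simp, by simp⟩
        · exact ⟨i, 1, by simp, by simp⟩)
    exact ⟨ι, h1, h2, a, t, by simpa using h3, by simpa using h4, h5, h6⟩
end D7
end AMDP

open MvPolynomial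
set_option linter.unusedSectionVars false
namespace AMDP

section D8
variable {K F : Type} [Field K] [Field F] [Algebra K F]

theorem stepD [IsAlgClosed K] {r d : ℕ} (hr : d + 3 = r) (I : Ideal (PS K r)) (hprime : I.IsPrime)
    (hhom : AMD.IsHomIdeal K r I) (hnd : AMD.Nondeg K r I) (hdim : AMD.DimEq K r I d)
    (hcone : ¬ AMD.IsConeIdeal K r I)
    (ev : PS K r →ₐ[K] F) (hev : ∀ f, ev f = 0 ↔ f ∈ I)
    (hd2 : Module.finrank K ↥((I.restrictScalars K) ⊓ homogeneousSubmodule (Fin (r + 1)) K 2) = 4)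
    (hd3 : Module.finrank K ↥((I.restrictScalars K) ⊓ homogeneousSubmodule (Fin (r + 1)) K 3) + 1
      = 4 * (d + 4))
    (m n : Fin 3 → PS K r) (hm : ∀ i, (m i).IsHomogeneous 1) (hn : ∀ i, (n i).IsHomogeneous 1)
    (hmi : LinearIndependent K m) (lam : F) (hlam : ∀ i, ev (n i) = lam * ev (m i))
    (hlamK : lam ∉ Set.range (algebraMap K F)) :
    d ≤ 4 ∧ AMD.HasBettiDiagram K r I bt := by
  have hker : ∀ x ∈ homogeneousSubmodule (Fin (r + 1)) K 1, ev.toLinearMap x = 0 → x = 0 := by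
    intro x hx h0
    exact hnd x ((hev x).1 h0) hx
  have htl : Transcendental K lam := by
    intro halg
    apply hlamK
    have hIntg : IsIntegral K lam := halg.isIntegral
    have h1 := IsAlgClosed.degree_eq_one_of_irreducible K (minpoly.irreducible hIntg)
    exact minpoly.mem_range_of_degree_eq_one K lam h1
  let V : Submodule K F := (homogeneousSubmodule (Fin (r + 1)) K 1).map ev.toLinearMap
  have hVf : Module.Finite K V := by
    have := finite_hom (K := K) (σ := Fin (r + 1)) 1
    infer_instance
  have hVd : Module.finrank K V = d + 4 := by
    have h := finrank_map_add ev.toLinearMap (homogeneousSubmodule (Fin (r + 1)) K 1)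
    have h0 : (homogeneousSubmodule (Fin (r + 1)) K 1) ⊓ LinearMap.ker ev.toLinearMap = ⊥ := by
      rw [eq_bot_iff]
      intro x hx
      exact hker x hx.1 hx.2
    rw [h0, finrank_bot, add_zero, finrank_hom] at h
    rw [h]
    simp
    omega
  have hmi' : LinearIndependent K (fun i => ev (m i)) := by
    rw [Fintype.linearIndependent_iff] at hmi ⊢
    intro g hg
    apply hmi g
    apply hker
    · exact Submodule.sum_mem _ fun i _ => Submodule.smul_mem _ _ (hm i)
    · simpa using hg
  let M : Submodule K F := Submodule.span K (Set.range fun i => ev (m i))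
  have hMV : M ≤ V := by
    rw [Submodule.span_le]
    rintro _ ⟨i, rfl⟩
    exact ⟨m i, hm i, rfl⟩
  have hM3 : Module.finrank K M = 3 := by
    rw [finrank_span_eq_card hmi']; simp
  have hMl : ∀ x ∈ M, lam * x ∈ V := by
    intro x hx
    have : M ≤ V.comap (LinearMap.mulLeft K lam) := by
      rw [Submodule.span_le]
      rintro _ ⟨i, rfl⟩
      exact ⟨n i, hn i, hlam i⟩
    exact this hx
  obtain ⟨ι, _, _, a, t, hs, hc, htV, hti⟩ := chains lam htl V M hMV hM3 hMl
  choose L hL1 hL2 using htV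
  have hLi : LinearIndependent K L := by
    apply LinearIndependent.of_comp ev.toLinearMap
    have he : (ev.toLinearMap ∘ L) = fun p => lam ^ (p.2 : ℕ) * t p.1 := funext hL2
    rw [he]
    exact hti
  have hι : Fintype.card ι = d + 1 := by omega
  have hcard : Fintype.card ((i : ι) × Fin (a i + 1)) = Fintype.card (Fin (r + 1)) := by
    rw [Fintype.card_sigma]
    simp [Finset.sum_add_distrib, hs, hι]
    omega
  obtain ⟨Ω, hΩ, hΩ'⟩ := exists_coord hcard L hL1 hLi
  let Θ : MvPolynomial (Option ι) K →ₐ[K] F := aeval fun o => o.elim lam t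
  have hΘΩ : ∀ f, Θ (scr a f) = ev (Ω f) := by
    intro f
    have : Θ.comp (scr a) = ev.comp (Ω : _ →ₐ[K] _) := by
      apply MvPolynomial.algHom_ext
      intro p
      have := hL2 p
      simp only [AlgHom.comp_apply, scr_X']
      change _ = ev (Ω (X p))
      rw [hΩ, show ev (L p) = lam ^ (p.2 : ℕ) * t p.1 from this]
      simp [Θ]
    exact DFunLike.congr_fun this f
  refine coreD a hr I hhom hnd hcone hι hs Ω (fun s => by rw [hΩ]; exact hL1 s) hΩ' Θ
    (fun f => by rw [hΘΩ, hev]) ?_ ?_ hd2 hd3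
  · intro p hp hp0
    let q : Polynomial K := ∑ m ∈ p.support, Polynomial.monomial (m none) (coeff m p)
    have hq : Polynomial.aeval (X none : MvPolynomial (Option ι) K) q = p := by
      conv_rhs => rw [p.as_sum]
      rw [map_sum]
      refine Finset.sum_congr rfl fun m hm => ?_
      have h1 := hp m hm
      rw [weight_wt] at h1
      have h2 : m = Finsupp.single none (m none) := by
        ext o
        cases o with
        | none => simp
        | some i =>
          have := Finset.sum_eq_zero_iff.1 h1 i (Finset.mem_univ _)
          simp [this]
      rw [Polynomial.aeval_monomial, X_pow_eq_monomial, algebraMap_eq, C_mul_monomial, mul_one, ← h2]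
    have hq0 : Polynomial.aeval lam q = 0 := by
      rw [← hp0, ← hq, ← Polynomial.aeval_algHom_apply]
      simp [Θ]
    rw [transcendental_iff] at htl
    rw [← hq, htl q hq0, map_zero]
  · let g : (PS K r ⧸ I) →ₐ[K] F := Ideal.Quotient.liftₐ I ev fun f hf => (hev f).2 hf
    have hg : Function.Injective g := by
      rw [injective_iff_map_eq_zero]
      intro x
      obtain ⟨f, rfl⟩ := Ideal.Quotient.mk_surjective x
      intro h
      exact Ideal.Quotient.eq_zero_iff_mem.2 ((hev f).1 h)
    have hgr : ∀ x, g x ∈ Θ.range := by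
      intro x
      obtain ⟨f, rfl⟩ := Ideal.Quotient.mk_surjective x
      refine ⟨scr a (Ω.symm f), ?_⟩
      show Θ (scr a (Ω.symm f)) = ev f
      rw [hΘΩ, AlgEquiv.apply_symm_apply]
    have h1 : ((d + 1 : ℕ) : Cardinal) ≤ Algebra.trdeg K (PS K r ⧸ I) := by
      apply le_trdeg
      rw [show ringKrullDim (PS K r ⧸ I) = _ from hdim]
      simp
    refine h1.trans (trdeg_le_of_injective (g.codRestrict Θ.range hgr) ?_)
    intro x y hxy
    exact hg (congrArg Subtype.val hxy)
end D8
end AMDP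

open MvPolynomial
set_option linter.unusedSectionVars false
set_option linter.unusedSimpArgs false
namespace AMDP

section C1
variable {K : Type} [Field K] {σ : Type} [Fintype σ] [DecidableEq σ]

theorem coord_extend {n : ℕ} (l : Fin n → MvPolynomial σ K) (hl : ∀ i, (l i).IsHomogeneous 1)
    (hli : LinearIndependent K l) :
    ∃ (τ : Type) (j : Fin n → τ) (Ω : MvPolynomial τ K ≃ₐ[K] MvPolynomial σ K),
      Function.Injective j ∧ ∀ i, Ω (X (j i)) = l i := by
  classical
  let l' : Fin n → homogeneousSubmodule σ K 1 := fun i => ⟨l i, hl i⟩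
  have hl' : LinearIndependent K l' := LinearIndependent.of_comp (Submodule.subtype _) hli
  let b := Module.Basis.sumExtend hl'
  let _ : Fintype (Fin n ⊕ Module.Basis.sumExtendIndex hl') := FiniteDimensional.fintypeBasisIndex b
  have hc : Fintype.card (Fin n ⊕ Module.Basis.sumExtendIndex hl') = Fintype.card σ := by
    rw [← Module.finrank_eq_card_basis b, finrank_lin]
  obtain ⟨Ω, hΩ, -⟩ := exists_coord hc (fun s => (b s : MvPolynomial σ K)) (fun s => (b s).2)
    (b.linearIndependent.map' (Submodule.subtype _) (Submodule.ker_subtype _))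
  refine ⟨_, Sum.inl, Ω, Sum.inl_injective, fun i => ?_⟩
  rw [hΩ]
  have : b (Sum.inl i) = l' i := by
    simp [b, Module.Basis.sumExtend]
    rfl
  rw [this]

theorem hc_mul {l p : MvPolynomial σ K} (hl : l.IsHomogeneous 1) (n : ℕ) :
    homogeneousComponent (n + 1) (p * l) = homogeneousComponent n p * l := by
  induction p using MvPolynomial.induction_on' with
  | monomial m c =>
    have h1 : (monomial m c).IsHomogeneous m.degree := isHomogeneous_monomial c rfl
    rw [homogeneousComponent_of_mem h1, homogeneousComponent_of_mem (h1.mul hl)]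
    by_cases h : n = m.degree
    · simp [h]
    · simp [h]
  | add p q hp hq => rw [add_mul, map_add, hp, hq, map_add, add_mul]

theorem koszul4' {τ : Type} {i j k m : τ} (hij : i ≠ j) (hik : k ≠ i) (hjk : k ≠ j)
    (hmi : m ≠ i) (hmj : m ≠ j) (hmk : m ≠ k) (x y z w : MvPolynomial τ K)
    (H : x * X i + y * X j + z * X k + w * X m = 0) :
    ∃ A B C D E G, x = A * X j + B * X k + C * X m ∧ y = - A * X i + D * X k + E * X m ∧
      z = - B * X i - D * X j + G * X m ∧ w = - C * X i - E * X j - G * X k := by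
  have hw : w ∈ Ideal.span {(X i : MvPolynomial τ K), X j, X k} := by
    rw [img3]
    refine span_X_mul (g := X m) ?_ (X_not_mem (by simp [hmi, hmj, hmk]))
    rw [← img3]
    have : w * X m = -x * X i + (-y * X j + (-z) * X k) := by linear_combination H
    rw [this]
    refine add_mem (Ideal.mul_mem_left _ _ (Ideal.subset_span (by simp)))
      (add_mem (Ideal.mul_mem_left _ _ (Ideal.subset_span (by simp)))
        (Ideal.mul_mem_left _ _ (Ideal.subset_span (by simp))))
  obtain ⟨p, q, s, rfl⟩ := mem3.1 hw
  obtain ⟨a, b, c, h1, h2, h3⟩ := koszul3' hij hik hjk (x + p * X m) (y + q * X m) (z + s * X m)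
    (by linear_combination H)
  exact ⟨a, b, -p, c, -q, -s, by linear_combination h1, by linear_combination h2,
    by linear_combination h3, by ring⟩

theorem kosL2 (l Q : Fin 2 → MvPolynomial σ K) (hl : ∀ i, (l i).IsHomogeneous 1)
    (hli : LinearIndependent K l) (hQ : ∀ i, (Q i).IsHomogeneous 2) (h : ∑ i, Q i * l i = 0) :
    ∃ z : MvPolynomial σ K, z.IsHomogeneous 1 ∧ Q 0 = z * l 1 ∧ Q 1 = - z * l 0 := by
  obtain ⟨τ, j, Ω, hj, hΩ⟩ := coord_extend l hl hli
  have h' : Ω.symm (Q 0) * X (j 0) + Ω.symm (Q 1) * X (j 1) = 0 := by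
    apply Ω.injective
    simpa [hΩ, Fin.sum_univ_two] using h
  obtain ⟨z, h1, h2⟩ := vkos2 (hj.ne (by decide)) _ _ h'
  have h1' := congrArg Ω h1
  have h2' := congrArg Ω h2
  simp only [AlgEquiv.apply_symm_apply, map_mul, map_neg, hΩ] at h1' h2'
  refine ⟨homogeneousComponent 1 (Ω z), homogeneousComponent_isHomogeneous _ _, ?_, ?_⟩
  · rw [← hc_mul (hl 1), ← h1', homogeneousComponent_of_mem (hQ 0)]; simp
  · rw [neg_mul, ← hc_mul (hl 0), ← map_neg, ← neg_mul, ← h2', homogeneousComponent_of_mem (hQ 1)]; simp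

theorem kosL3 (l Q : Fin 3 → MvPolynomial σ K) (hl : ∀ i, (l i).IsHomogeneous 1)
    (hli : LinearIndependent K l) (hQ : ∀ i, (Q i).IsHomogeneous 2) (h : ∑ i, Q i * l i = 0) :
    ∃ p q s : MvPolynomial σ K, p.IsHomogeneous 1 ∧ q.IsHomogeneous 1 ∧ s.IsHomogeneous 1 ∧
      Q 0 = p * l 1 + q * l 2 ∧ Q 1 = - p * l 0 + s * l 2 ∧ Q 2 = - q * l 0 - s * l 1 := by
  obtain ⟨τ, j, Ω, hj, hΩ⟩ := coord_extend l hl hli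
  have h' : Ω.symm (Q 0) * X (j 0) + Ω.symm (Q 1) * X (j 1) + Ω.symm (Q 2) * X (j 2) = 0 := by
    apply Ω.injective
    simpa [hΩ, Fin.sum_univ_three] using h
  obtain ⟨p, q, s, h1, h2, h3⟩ := koszul3' (hj.ne (by decide)) (hj.ne (by decide)) (hj.ne (by decide)) _ _ _ h'
  have h1' := congrArg Ω h1
  have h2' := congrArg Ω h2
  have h3' := congrArg Ω h3
  simp only [AlgEquiv.apply_symm_apply, map_mul, map_neg, map_add, map_sub, hΩ] at h1' h2' h3'
  have e : ∀ i, Q i = homogeneousComponent 2 (Q i) := fun i => by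
    rw [homogeneousComponent_of_mem (hQ i)]; simp
  refine ⟨homogeneousComponent 1 (Ω p), homogeneousComponent 1 (Ω q), homogeneousComponent 1 (Ω s),
    homogeneousComponent_isHomogeneous _ _, homogeneousComponent_isHomogeneous _ _,
    homogeneousComponent_isHomogeneous _ _, ?_, ?_, ?_⟩
  · rw [e, h1']; simp only [neg_mul, map_add, map_sub, map_neg, hc_mul (hl _)]
  · rw [e, h2']; simp only [neg_mul, map_add, map_sub, map_neg, hc_mul (hl _)]
  · rw [e, h3']; simp only [neg_mul, map_add, map_sub, map_neg, hc_mul (hl _)]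

theorem kosL4 (l Q : Fin 4 → MvPolynomial σ K) (hl : ∀ i, (l i).IsHomogeneous 1)
    (hli : LinearIndependent K l) (hQ : ∀ i, (Q i).IsHomogeneous 2) (h : ∑ i, Q i * l i = 0) :
    ∃ A B C D E G : MvPolynomial σ K, (A.IsHomogeneous 1 ∧ B.IsHomogeneous 1 ∧ C.IsHomogeneous 1 ∧
      D.IsHomogeneous 1 ∧ E.IsHomogeneous 1 ∧ G.IsHomogeneous 1) ∧
      Q 0 = A * l 1 + B * l 2 + C * l 3 ∧ Q 1 = - A * l 0 + D * l 2 + E * l 3 ∧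
      Q 2 = - B * l 0 - D * l 1 + G * l 3 ∧ Q 3 = - C * l 0 - E * l 1 - G * l 2 := by
  obtain ⟨τ, j, Ω, hj, hΩ⟩ := coord_extend l hl hli
  have h' : Ω.symm (Q 0) * X (j 0) + Ω.symm (Q 1) * X (j 1) + Ω.symm (Q 2) * X (j 2)
      + Ω.symm (Q 3) * X (j 3) = 0 := by
    apply Ω.injective
    simpa [hΩ, Fin.sum_univ_four] using h
  obtain ⟨A, B, C, D, E, G, h0, h1, h2, h3⟩ := koszul4' (hj.ne (by decide)) (hj.ne (by decide)) (hj.ne (by decide))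
    (hj.ne (by decide)) (hj.ne (by decide)) (hj.ne (by decide)) _ _ _ _ h'
  have h0' := congrArg Ω h0
  have h1' := congrArg Ω h1
  have h2' := congrArg Ω h2
  have h3' := congrArg Ω h3
  simp only [AlgEquiv.apply_symm_apply, map_mul, map_neg, map_add, map_sub, hΩ] at h0' h1' h2' h3'
  have hH := fun p : MvPolynomial σ K => homogeneousComponent_isHomogeneous 1 p
  have e : ∀ i, Q i = homogeneousComponent 2 (Q i) := fun i => by
    rw [homogeneousComponent_of_mem (hQ i)]; simp
  refine ⟨homogeneousComponent 1 (Ω A), homogeneousComponent 1 (Ω B), homogeneousComponent 1 (Ω C),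
    homogeneousComponent 1 (Ω D), homogeneousComponent 1 (Ω E), homogeneousComponent 1 (Ω G),
    ⟨hH _, hH _, hH _, hH _, hH _, hH _⟩, ?_, ?_, ?_, ?_⟩
  · rw [e, h0']; simp only [neg_mul, map_add, map_sub, map_neg, hc_mul (hl _)]
  · rw [e, h1']; simp only [neg_mul, map_add, map_sub, map_neg, hc_mul (hl _)]
  · rw [e, h2']; simp only [neg_mul, map_add, map_sub, map_neg, hc_mul (hl _)]
  · rw [e, h3']; simp only [neg_mul, map_add, map_sub, map_neg, hc_mul (hl _)]

theorem reduce_syz (n : ℕ) : ∀ (l Q : Fin n → MvPolynomial σ K), (∀ i, (l i).IsHomogeneous 1) →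
    (∃ i, l i ≠ 0) → LinearIndependent K Q → ∑ i, Q i * l i = 0 →
    ∃ (k : ℕ) (l' Q' : Fin k → MvPolynomial σ K), k ≤ n ∧ (¬ LinearIndependent K l → k < n) ∧
      (∀ i, (l' i).IsHomogeneous 1) ∧ LinearIndependent K l' ∧ (∃ i, l' i ≠ 0) ∧
      LinearIndependent K Q' ∧ (∀ i, Q' i ∈ Submodule.span K (Set.range Q)) ∧ ∑ i, Q' i * l' i = 0 := by
  induction n with
  | zero => intro l Q _ h; exact h.elim fun i => i.elim0
  | succ n ih =>
    intro l Q hl h0 hQ hs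
    by_cases hli : LinearIndependent K l
    · exact ⟨n + 1, l, Q, le_rfl, fun h => absurd hli h, hl, hli, h0, hQ,
        fun i => Submodule.subset_span ⟨i, rfl⟩, hs⟩
    have hli' := hli
    rw [Fintype.linearIndependent_iff] at hli'
    push Not at hli'
    obtain ⟨g, hg, k, hk⟩ := hli'
    rw [Fin.sum_univ_succAbove _ k] at hg hs
    let l1 : Fin n → MvPolynomial σ K := fun i => l (k.succAbove i)
    let Q1 : Fin n → MvPolynomial σ K := fun i => Q (k.succAbove i) - ((g k)⁻¹ * g (k.succAbove i)) • Q k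
    have hlk : l k = - ∑ i, ((g k)⁻¹ * g (k.succAbove i)) • l (k.succAbove i) := by
      have := eq_neg_of_add_eq_zero_left hg
      rw [← inv_smul_smul₀ hk (l k), this, smul_neg, Finset.smul_sum]
      simp only [smul_smul]
    have hQ1 : LinearIndependent K Q1 := by
      rw [Fintype.linearIndependent_iff] at hQ ⊢
      intro b hb i
      have h := hQ (k.insertNth (- ∑ i, b i * ((g k)⁻¹ * g (k.succAbove i))) b) (by
        rw [Fin.sum_univ_succAbove _ k]
        simp only [Fin.insertNth_apply_same, Fin.insertNth_apply_succAbove]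
        rw [← hb]
        simp only [Q1, smul_sub, Finset.sum_sub_distrib, neg_smul, Finset.sum_smul, smul_smul]
        ring) (k.succAbove i)
      simpa using h
    have hs1 : ∑ i, Q1 i * l1 i = 0 := by
      rw [← hs, hlk]
      simp only [Q1, l1, sub_mul, Finset.sum_sub_distrib, mul_neg, Finset.mul_sum, mul_smul_comm, smul_mul_assoc]
      ring
    have hne : ∃ i, l1 i ≠ 0 := by
      by_contra hcon
      push Not at hcon
      obtain ⟨i, hi⟩ := h0
      apply hi
      rcases Fin.eq_self_or_eq_succAbove k i with rfl | ⟨i', rfl⟩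
      · rw [hlk]
        simp only [neg_eq_zero]
        exact Finset.sum_eq_zero fun i' _ => by rw [show l _ = 0 from hcon i', smul_zero]
      · exact hcon i'
    obtain ⟨k', l', Q', h1, h2, h3, h4, h5, h6, h7, h8⟩ := ih l1 Q1 (fun i => hl _) hne hQ1 hs1
    refine ⟨k', l', Q', by omega, fun _ => by omega, h3, h4, h5, h6, fun i => ?_, h8⟩
    refine Submodule.span_le.2 ?_ (h7 i)
    rintro _ ⟨i, rfl⟩
    exact Submodule.sub_mem _ (Submodule.subset_span ⟨_, rfl⟩)
      (Submodule.smul_mem _ _ (Submodule.subset_span ⟨_, rfl⟩))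

end C1
end AMDP

open MvPolynomial
set_option linter.unusedSectionVars false
set_option linter.unusedSimpArgs false
namespace AMDP

section C2
variable {K F : Type} [Field K] [Field F] [Algebra K F]

def Pencil {r : ℕ} (ev : PS K r →ₐ[K] F) : Prop :=
  ∃ (m n : Fin 3 → PS K r) (lam : F), (∀ i, (m i).IsHomogeneous 1) ∧ (∀ i, (n i).IsHomogeneous 1) ∧
    LinearIndependent K m ∧ (∀ i, ev (n i) = lam * ev (m i)) ∧ lam ∉ Set.range (algebraMap K F)

theorem pencil_of_lt4 {r : ℕ} (I : Ideal (PS K r)) (hprime : I.IsPrime)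
    (hnd : AMD.Nondeg K r I) (ev : PS K r →ₐ[K] F) (hev : ∀ f, ev f = 0 ↔ f ∈ I)
    (k : ℕ) (hk : k < 4) (l Q : Fin k → PS K r) (hl : ∀ i, (l i).IsHomogeneous 1)
    (hli : LinearIndependent K l) (h0 : ∃ i, l i ≠ 0) (hQi : LinearIndependent K Q)
    (hQ : ∀ i, (Q i).IsHomogeneous 2) (hQI : ∀ i, Q i ∈ I) (h : ∑ i, Q i * l i = 0) :
    Pencil ev := by
  have hlI : ∀ i, l i ∉ I := fun i hi => hli.ne_zero i (hnd _ hi (hl i))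
  interval_cases k
  · exact h0.elim fun i => i.elim0
  · simp only [Finset.univ_unique, Finset.sum_singleton] at h
    rcases mul_eq_zero.1 h with h | h
    · exact absurd h (hQi.ne_zero _)
    · exact absurd h (hli.ne_zero _)
  · obtain ⟨z, hz, h1, h2⟩ := kosL2 l Q hl hli hQ h
    have h3 := hQI 0
    rw [h1] at h3
    have h4 := hnd _ ((hprime.mem_or_mem h3).resolve_right (hlI 1)) hz
    rw [h4, zero_mul] at h1
    exact absurd h1 (hQi.ne_zero _)
  · obtain ⟨p, q, s, hp, hq, hs, h1, h2, h3⟩ := kosL3 l Q hl hli hQ h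
    let n : Fin 3 → PS K r := ![s, -q, p]
    have hn : ∀ i, (n i).IsHomogeneous 1 := by
      intro i; fin_cases i
      · exact hs
      · exact hq.neg
      · exact hp
    have e0 : ∀ i, ev (l i) ≠ 0 := fun i hi => hlI i ((hev _).1 hi)
    have hlam : ∀ i, ev (n i) = ev s / ev (l 0) * ev (l i) := by
      have H0 := (hev _).2 (hQI 1)
      have H1 := (hev _).2 (hQI 2)
      rw [h2] at H0
      rw [h3] at H1
      simp only [map_add, map_sub, map_mul, map_neg] at H0 H1
      have := e0 0
      intro i; fin_cases i
      · simp [n, this]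
      · simp [n]; field_simp; linear_combination H1
      · simp [n]; field_simp; linear_combination -H0
    refine ⟨l, n, ev s / ev (l 0), hl, hn, hli, hlam, ?_⟩
    rintro ⟨c, hc⟩
    have hz : ∀ i, n i = c • l i := by
      intro i
      rw [← sub_eq_zero]
      refine hnd _ ((hev _).1 ?_) ?_
      · rw [map_sub, map_smul, hlam, ← hc, Algebra.smul_def, sub_self]
      · exact Submodule.sub_mem _ (hn i) (Submodule.smul_mem (homogeneousSubmodule _ K 1) _ (hl i))
    apply hQi.ne_zero 0
    have e1 : -q = c • l 1 := hz 1
    have e2 : p = c • l 2 := hz 2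
    rw [h1, e2, ← neg_neg q, e1]
    simp only [smul_eq_C_mul]
    ring

theorem pencil_exists {r d : ℕ} (hr : d + 3 = r) (I : Ideal (PS K r)) (hprime : I.IsPrime)
    (hnd : AMD.Nondeg K r I) (ev : PS K r →ₐ[K] F) (hev : ∀ f, ev f = 0 ↔ f ∈ I)
    (hd2 : Module.finrank K ↥((I.restrictScalars K) ⊓ homogeneousSubmodule (Fin (r + 1)) K 2) = 4)
    (hd3 : Module.finrank K ↥((I.restrictScalars K) ⊓ homogeneousSubmodule (Fin (r + 1)) K 3) + 1
      = 4 * (d + 4)) : Pencil ev := by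
  set I2 := (I.restrictScalars K) ⊓ homogeneousSubmodule (Fin (r + 1)) K 2 with hI2
  set I3 := (I.restrictScalars K) ⊓ homogeneousSubmodule (Fin (r + 1)) K 3 with hI3
  have hf2 : Module.Finite K I2 := Submodule.finiteDimensional_of_le inf_le_right
  have hf3 : Module.Finite K I3 := Submodule.finiteDimensional_of_le inf_le_right
  let b := Module.finBasisOfFinrankEq K I2 hd2
  let Q0 : Fin 4 → PS K r := fun i => b i
  have hQ0 : LinearIndependent K Q0 := b.linearIndependent.map' (Submodule.subtype _) (Submodule.ker_subtype _)
  obtain ⟨l0, hl0, hl0n, hs0⟩ : ∃ l : Fin 4 → PS K r, (∀ i, (l i).IsHomogeneous 1) ∧ (∃ i, l i ≠ 0) ∧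
      ∑ i, Q0 i * l i = 0 := by
    by_contra hcon
    push Not at hcon
    let φ : (Fin 4 → homogeneousSubmodule (Fin (r + 1)) K 1) →ₗ[K] PS K r :=
      ∑ i, (LinearMap.mulLeft K (Q0 i)) ∘ₗ (Submodule.subtype _) ∘ₗ (LinearMap.proj i)
    have hφ : ∀ l, φ l = ∑ i, Q0 i * (l i : PS K r) := fun l => by simp [φ]
    let ψ : (Fin 4 → homogeneousSubmodule (Fin (r + 1)) K 1) →ₗ[K] I3 := φ.codRestrict I3 (by
      intro l
      rw [hφ]
      refine Submodule.sum_mem _ fun i _ => ⟨?_, ?_⟩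
      · exact I.mul_mem_right _ (b i).2.1
      · exact (show (Q0 i).IsHomogeneous 2 from (b i).2.2).mul (l i).2)
    have hinj : Function.Injective ψ := by
      rw [← LinearMap.ker_eq_bot, LinearMap.ker_eq_bot']
      intro l hl
      by_contra hne
      have h1 : ∃ i, (l i : PS K r) ≠ 0 := by
        by_contra hall
        push Not at hall
        exact hne (funext fun i => Subtype.ext (hall i))
      refine hcon (fun i => l i) (fun i => (l i).2) h1 ?_
      rw [← hφ]
      exact congrArg Subtype.val hl
    have h1 := LinearMap.finrank_le_finrank_of_injective hinj
    rw [Module.finrank_pi_fintype] at h1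
    simp only [finrank_lin, Fintype.card_fin, Finset.sum_const, Finset.card_univ, smul_eq_mul] at h1
    omega
  have hspan : Submodule.span K (Set.range Q0) ≤ I2 := by
    rw [Submodule.span_le]; rintro _ ⟨i, rfl⟩; exact (b i).2
  obtain ⟨k, l, Q, hk4, -, hl, hli, hne, hQi, hQs, hs⟩ := reduce_syz 4 l0 Q0 hl0 hl0n hQ0 hs0
  have hQ : ∀ i, (Q i).IsHomogeneous 2 := fun i => (hspan (hQs i)).2
  have hQI : ∀ i, Q i ∈ I := fun i => (hspan (hQs i)).1
  by_cases hk : k < 4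
  · exact pencil_of_lt4 I hprime hnd ev hev k hk l Q hl hli hne hQi hQ hQI hs
  obtain rfl : k = 4 := by omega
  have hspanQ : Submodule.span K (Set.range Q) = I2 := by
    apply Submodule.eq_of_le_of_finrank_eq
    · rw [Submodule.span_le]; rintro _ ⟨i, rfl⟩; exact hspan (hQs i)
    · rw [finrank_span_eq_card hQi, hd2]; simp
  -- any nonzero dependent syzygy finishes
  have key : ∀ l' : Fin 4 → PS K r, (∀ i, (l' i).IsHomogeneous 1) → ∑ i, Q i * l' i = 0 →
      ¬ LinearIndependent K l' → (∃ i, l' i ≠ 0) → Pencil ev := by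
    intro l' hl' hs' hdep hne'
    obtain ⟨k, l1, Q1, -, hk4, hl1, hli1, hne1, hQi1, hQs1, hs1⟩ := reduce_syz 4 l' Q hl' hne' hQi hs'
    rw [hspanQ] at hQs1
    exact pencil_of_lt4 I hprime hnd ev hev k (hk4 hdep) l1 Q1 hl1 hli1 hne1 hQi1
      (fun i => (hQs1 i).2) (fun i => (hQs1 i).1) hs1
  obtain ⟨A, B, C', D, E, G, ⟨hA, hB, hC, hD, hE, hG⟩, q0, q1, q2, q3⟩ := kosL4 l Q hl hli hQ hs
  let Pf : PS K r := A * G - B * E + C' * D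
  have hPfI : Pf ∈ I := by
    have h1 : Pf * l 0 ∈ I := by
      have : Pf * l 0 = -(G * Q 1 - E * Q 2 + D * Q 3) := by
        rw [q1, q2, q3]; simp only [Pf]; ring
      rw [this]
      exact I.neg_mem (I.add_mem (I.sub_mem (I.mul_mem_left _ (hQI _)) (I.mul_mem_left _ (hQI _)))
        (I.mul_mem_left _ (hQI _)))
    exact (hprime.mem_or_mem h1).resolve_right fun hi => hli.ne_zero 0 (hnd _ hi (hl 0))
  have hPf2 : Pf.IsHomogeneous 2 := ((hA.mul hG).sub (hB.mul hE)).add (hC.mul hD)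
  have hPfs : Pf ∈ Submodule.span K (Set.range Q) := by rw [hspanQ]; exact ⟨hPfI, hPf2⟩
  obtain ⟨c, hc⟩ := (Submodule.mem_span_range_iff_exists_fun K).1 hPfs
  let T : Fin 4 → Fin 4 → PS K r := ![![0, G, -E, D], ![-G, 0, C', -B], ![E, -C', 0, A], ![-D, B, -A, 0]]
  have hT1 : ∀ i j, (T i j).IsHomogeneous 1 := by
    intro i j
    fin_cases i <;> fin_cases j <;>
      first
      | exact isHomogeneous_zero _ _ _
      | exact hA | exact hB | exact hC | exact hD | exact hE | exact hG
      | exact hA.neg | exact hB.neg | exact hC.neg | exact hD.neg | exact hE.neg | exact hG.neg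
  have hTs : ∀ i j, T i j = - T j i := by
    intro i j
    fin_cases i <;> fin_cases j <;> simp [T]
  have hTd : ∀ i, T i i = 0 := by intro i; fin_cases i <;> rfl
  have hTQ : ∀ i, ∑ k, Q k * T i k = - (Pf * l i) := by
    intro i
    rw [Fin.sum_univ_four, q0, q1, q2, q3]
    fin_cases i <;> simp [T, Pf] <;> ring
  have hR : ∀ i, ∑ k, Q k * (T i k + c k • l i) = 0 := by
    intro i
    simp only [mul_add, Finset.sum_add_distrib, hTQ]
    rw [← hc, Finset.sum_mul, neg_add_eq_zero]
    refine Finset.sum_congr rfl fun k _ => ?_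
    simp [mul_smul_comm, smul_mul_assoc]
  by_cases hc0 : ∀ k, c k = 0
  · have : ∃ i k, T i k ≠ 0 := by
      by_contra hcon
      push Not at hcon
      have hG0 : G = 0 := hcon 0 1
      have hE0 : E = 0 := neg_eq_zero.1 (hcon 0 2)
      have hC0 : C' = 0 := hcon 1 2
      apply hQi.ne_zero 3
      rw [q3, hG0, hE0, hC0]; simp
    obtain ⟨i, k, hik⟩ := this
    refine key (T i) (hT1 i) ?_ ?_ ⟨k, hik⟩
    · have := hR i
      simpa [hc0] using this
    · intro h
      exact h.ne_zero i (hTd i)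
  push Not at hc0
  obtain ⟨j, hj⟩ := hc0
  by_cases hall : ∃ i k, c j • (T i k + c k • l i) - c i • (T j k + c k • l j) ≠ 0
  · obtain ⟨i, k, hik⟩ := hall
    refine key (fun k => c j • (T i k + c k • l i) - c i • (T j k + c k • l j)) ?_ ?_ ?_ ⟨k, hik⟩
    · intro k
      have hh : ∀ i, T i k + c k • l i ∈ homogeneousSubmodule (Fin (r + 1)) K 1 := fun i =>
        Submodule.add_mem _ (hT1 i k) (Submodule.smul_mem _ _ (hl i))
      exact Submodule.sub_mem _ (Submodule.smul_mem _ _ (hh i)) (Submodule.smul_mem _ _ (hh j))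
    · simp only [mul_sub, mul_smul_comm, Finset.sum_sub_distrib, ← Finset.smul_sum, hR, smul_zero, sub_zero]
    · intro hind
      have hij : i ≠ j := by
        rintro rfl
        exact hik (sub_self _)
      rw [Fintype.linearIndependent_iff] at hind
      have h := hind (Pi.single i (c j) - Pi.single j (c i)) (by
        simp only [Pi.sub_apply, sub_smul, Finset.sum_sub_distrib, Pi.single_apply, ite_smul, zero_smul,
          Finset.sum_ite_eq', Finset.mem_univ, if_true, hTd, hTs j i]
        simp only [smul_eq_C_mul]
        ring) i
      simp [hij, hj] at h
  · exfalso
    push Not at hall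
    have hTj : ∀ i, T i j = c i • l j - c j • l i := by
      intro i
      have h := hall i j
      rw [hTd] at h
      have h2 : c j • (T i j - (c i • l j - c j • l i)) = 0 := by
        rw [← h]; simp only [smul_eq_C_mul]; ring
      exact sub_eq_zero.1 ((smul_eq_zero.1 h2).resolve_left hj)
    have hTT : ∀ i k, T i k = c i • l k - c k • l i := by
      intro i k
      have h := hall i k
      rw [hTs j k, hTj k] at h
      have h2 : c j • (T i k - (c i • l k - c k • l i)) = 0 := by
        rw [← h]; simp only [smul_eq_C_mul]; ring
      exact sub_eq_zero.1 ((smul_eq_zero.1 h2).resolve_left hj)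
    have hP0 : Pf = 0 := by
      have e1 : G = _ := hTT 0 1
      have e2 : -E = _ := hTT 0 2
      have e3 : D = _ := hTT 0 3
      have e4 : C' = _ := hTT 1 2
      have e5 : -B = _ := hTT 1 3
      have e6 : A = _ := hTT 2 3
      have : Pf = A * G - (-B) * (-E) + C' * D := by simp only [Pf]; ring
      rw [this, e1, e2, e3, e4, e5, e6]
      simp only [smul_eq_C_mul]
      ring
    rw [hP0] at hc
    rw [Fintype.linearIndependent_iff] at hQi
    exact hj (hQi c hc j)

end C2
end AMDP

open MvPolynomial
set_option linter.unusedSectionVars false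
set_option linter.unusedSimpArgs false
namespace AMDP

structure Fil (L F : Type) [Field L] [Field F] [Algebra L F] where
  M : ℕ → Submodule L F
  fin : ∀ n, Module.Finite L (M n)
  mono : Monotone M
  one : (1 : F) ∈ M 0
  mul : ∀ {i j x y}, x ∈ M i → y ∈ M j → x * y ∈ M (i + j)
  s : F
  hs : s ∈ M 1
  n1 : ℕ
  surj : ∀ n, n1 ≤ n → ∀ x ∈ M (n + 1), ∃ a ∈ M n, ∃ b ∈ M n, x = a + s * b
  dim5 : ∀ n, n1 ≤ n → Module.finrank L (M (n + 1)) = Module.finrank L (M n) + 5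

section A1
variable {L F : Type} [Field L] [Field F] [Algebra L F]

def sm (s : F) (U : Submodule L F) : Submodule L F := U.map (LinearMap.mulLeft L s)

theorem mem_sm {s : F} {U : Submodule L F} {x : F} : x ∈ sm s U ↔ ∃ u ∈ U, s * u = x := Iff.rfl

theorem finrank_sm {s : F} (hs : s ≠ 0) (U : Submodule L F) :
    Module.finrank L (sm s U) = Module.finrank L U :=
  LinearEquiv.finrank_eq (Submodule.equivMapOfInjective (LinearMap.mulLeft L s) (mul_right_injective₀ hs) U).symm

instance (s : F) (U : Submodule L F) [Module.Finite L U] : Module.Finite L (sm s U) := by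
  unfold sm; infer_instance

/-- dimension count for `U + sU`. -/
theorem finrank_add_sm {s : F} (hs : s ≠ 0) (U U' : Submodule L F) [Module.Finite L U]
    (h1 : sm s U' ≤ U) (h2 : U' ≤ U) (h3 : ∀ g ∈ U, s * g ∈ U → g ∈ U') :
    Module.finrank L ↥(U ⊔ sm s U) + Module.finrank L U' = 2 * Module.finrank L U := by
  have h := Submodule.finrank_sup_add_finrank_inf_eq U (sm s U)
  have h4 : U ⊓ sm s U = sm s U' := by
    apply le_antisymm
    · rintro x ⟨hx, g, hg, rfl⟩
      exact ⟨g, h3 g hg hx, rfl⟩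
    · refine le_inf h1 (Submodule.map_mono h2)
  rw [h4, finrank_sm hs, finrank_sm hs] at h
  omega

namespace Fil
variable (Φ : Fil L F)

instance (n : ℕ) : Module.Finite L (Φ.M n) := Φ.fin n

theorem s_ne : Φ.s ≠ 0 := by
  intro h
  have h1 : Φ.M (Φ.n1 + 1) ≤ Φ.M Φ.n1 := by
    intro x hx
    obtain ⟨a, ha, b, hb, rfl⟩ := Φ.surj _ le_rfl x hx
    simpa [h] using ha
  have h2 := Submodule.finrank_mono h1
  have h3 := Φ.dim5 Φ.n1 le_rfl
  omega

theorem smul_mem {n : ℕ} {x : F} (hx : x ∈ Φ.M n) : Φ.s * x ∈ Φ.M (n + 1) := by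
  rw [add_comm]; exact Φ.mul Φ.hs hx

theorem spow_mem (k : ℕ) {n : ℕ} {x : F} (hx : x ∈ Φ.M n) : Φ.s ^ k * x ∈ Φ.M (n + k) := by
  induction k with
  | zero => simpa using hx
  | succ k ih => rw [pow_succ', mul_assoc]; exact Φ.smul_mem ih

theorem spow_mem1 (k : ℕ) : Φ.s ^ k ∈ Φ.M k := by
  have := Φ.spow_mem k Φ.one
  simpa using this

theorem cancel (m : ℕ) (hm : Φ.n1 ≤ m) (g : F) (hg : g ∈ Φ.M (m + 1)) (hsg : Φ.s * g ∈ Φ.M (m + 1)) :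
    g ∈ Φ.M m := by
  have hle : sm Φ.s (Φ.M m) ≤ Φ.M (m + 1) := by
    rintro _ ⟨x, hx, rfl⟩; exact Φ.smul_mem hx
  have h0 : Φ.M (m + 1 + 1) = Φ.M (m + 1) ⊔ sm Φ.s (Φ.M (m + 1)) := by
    apply le_antisymm
    · intro x hx
      obtain ⟨a, ha, b, hb, rfl⟩ := Φ.surj _ (by omega) x hx
      exact Submodule.add_mem_sup ha ⟨b, hb, rfl⟩
    · refine sup_le (Φ.mono (by omega)) ?_
      rintro _ ⟨x, hx, rfl⟩; exact Φ.smul_mem hx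
  have h := Submodule.finrank_sup_add_finrank_inf_eq (Φ.M (m + 1)) (sm Φ.s (Φ.M (m + 1)))
  rw [← h0, finrank_sm Φ.s_ne, Φ.dim5 _ (by omega : Φ.n1 ≤ m + 1)] at h
  have h5 := Φ.dim5 m hm
  have h6 : sm Φ.s (Φ.M m) = Φ.M (m + 1) ⊓ sm Φ.s (Φ.M (m + 1)) := by
    apply Submodule.eq_of_le_of_finrank_eq
    · exact le_inf hle (Submodule.map_mono (Φ.mono (by omega)))
    · rw [finrank_sm Φ.s_ne]; omega
  have h7 : Φ.s * g ∈ sm Φ.s (Φ.M m) := by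
    rw [h6]; exact ⟨hsg, ⟨g, hg, rfl⟩⟩
  obtain ⟨g', hg', he⟩ := h7
  have : g' = g := mul_left_cancel₀ Φ.s_ne he
  rwa [← this]

theorem up {g : F} {j n n' : ℕ} (h : n ≤ n') (hg : Φ.s ^ n * g ∈ Φ.M (n + j)) :
    Φ.s ^ n' * g ∈ Φ.M (n' + j) := by
  obtain ⟨k, rfl⟩ := Nat.exists_eq_add_of_le h
  have := Φ.spow_mem k hg
  rw [← mul_assoc, ← pow_add, add_comm k n] at this
  convert this using 2
  omega

def W (j : ℕ) : Submodule L F where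
  carrier := {g | (∃ k, g ∈ Φ.M k) ∧ ∃ n, Φ.s ^ n * g ∈ Φ.M (n + j)}
  zero_mem' := ⟨⟨0, Submodule.zero_mem _⟩, 0, by simp⟩
  add_mem' := by
    rintro x y ⟨⟨k, hk⟩, n, hn⟩ ⟨⟨k', hk'⟩, n', hn'⟩
    refine ⟨⟨max k k', Submodule.add_mem _ (Φ.mono (le_max_left _ _) hk) (Φ.mono (le_max_right _ _) hk')⟩,
      max n n', ?_⟩
    rw [mul_add]
    exact Submodule.add_mem _ (Φ.up (le_max_left _ _) hn) (Φ.up (le_max_right _ _) hn')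
  smul_mem' := by
    rintro c x ⟨⟨k, hk⟩, n, hn⟩
    refine ⟨⟨k, Submodule.smul_mem _ _ hk⟩, n, ?_⟩
    rw [mul_smul_comm]
    exact Submodule.smul_mem _ _ hn

theorem mem_W {j : ℕ} {g : F} : g ∈ Φ.W j ↔ (∃ k, g ∈ Φ.M k) ∧ ∃ n, Φ.s ^ n * g ∈ Φ.M (n + j) := Iff.rfl

theorem M_le_W (j : ℕ) : Φ.M j ≤ Φ.W j := fun g hg => ⟨⟨j, hg⟩, 0, by simpa using hg⟩

theorem W_mono {i j : ℕ} (h : i ≤ j) : Φ.W i ≤ Φ.W j := by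
  rintro g ⟨hk, n, hn⟩
  exact ⟨hk, n, Φ.mono (by omega) hn⟩

theorem W_mul {i j : ℕ} {x y : F} (hx : x ∈ Φ.W i) (hy : y ∈ Φ.W j) : x * y ∈ Φ.W (i + j) := by
  obtain ⟨⟨k, hk⟩, n, hn⟩ := hx
  obtain ⟨⟨k', hk'⟩, n', hn'⟩ := hy
  refine ⟨⟨k + k', Φ.mul hk hk'⟩, n + n', ?_⟩
  have := Φ.mul hn hn'
  have e1 : Φ.s ^ n * x * (Φ.s ^ n' * y) = Φ.s ^ (n + n') * (x * y) := by rw [pow_add]; ring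
  have e2 : n + i + (n' + j) = n + n' + (i + j) := by omega
  rwa [e1, e2] at this

theorem W_s {j : ℕ} {x : F} (hx : x ∈ Φ.W j) : Φ.s * x ∈ Φ.W (j + 1) := by
  rw [add_comm]; exact Φ.W_mul (Φ.M_le_W 1 Φ.hs) hx

theorem W_cancel {j k : ℕ} {g : F} (hg : g ∈ Φ.W k) (h : Φ.s * g ∈ Φ.W (j + 1)) : g ∈ Φ.W j := by
  obtain ⟨-, n, hn⟩ := h
  refine ⟨hg.1, n + 1, ?_⟩
  rw [pow_succ, mul_assoc]
  convert hn using 2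
  omega

theorem W_le {j N : ℕ} (h1 : j ≤ N) (h2 : Φ.n1 ≤ N) : Φ.W j ≤ Φ.M N := by
  rintro g ⟨⟨k, hk⟩, n, hn⟩
  have key : ∀ m, g ∈ Φ.M (N + m) → g ∈ Φ.M N := by
    intro m
    induction m with
    | zero => exact id
    | succ m ih =>
      intro hg
      apply ih
      have : ∀ i, i ≤ n → Φ.s ^ (n - i) * g ∈ Φ.M (n - i + (N + m)) := by
        intro i
        induction i with
        | zero => intro _; exact Φ.mono (by simp; omega) hn
        | succ i ihi =>
          intro hi
          have h3 := ihi (by omega)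
          have h4 : n - i = n - (i + 1) + 1 := by omega
          rw [h4, pow_succ', mul_assoc] at h3
          apply Φ.cancel _ (by omega)
          · have := Φ.spow_mem (n - (i + 1)) hg
            exact Φ.mono (by omega) this
          · convert h3 using 2; omega
      have := this n le_rfl
      simpa using this
  exact key k (Φ.mono (by omega) hk)

theorem W_eq {j : ℕ} (h : Φ.n1 ≤ j) : Φ.W j = Φ.M j := le_antisymm (Φ.W_le le_rfl h) (Φ.M_le_W j)

instance (j : ℕ) : Module.Finite L (Φ.W j) :=
  Submodule.finiteDimensional_of_le (Φ.W_le (N := max j Φ.n1) (le_max_left _ _) (le_max_right _ _))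

theorem s_notMem : Φ.s ∉ Φ.W 0 := by
  intro h
  have h1 : Φ.M (Φ.n1 + 1) ≤ Φ.M Φ.n1 := by
    intro x hx
    obtain ⟨a, ha, b, hb, rfl⟩ := Φ.surj _ le_rfl x hx
    refine Submodule.add_mem _ ha ?_
    rw [← Φ.W_eq le_rfl] at hb ⊢
    have := Φ.W_mul h hb
    simpa using this
  have h2 := Submodule.finrank_mono h1
  have h3 := Φ.dim5 Φ.n1 le_rfl
  omega

/-- `W 0` as a field. -/
def E : IntermediateField L F :=
  let A : Subalgebra L F :=
    { carrier := Φ.W 0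
      mul_mem' := fun {x y} hx hy => by simpa using Φ.W_mul hx hy
      add_mem' := fun {x y} hx hy => Submodule.add_mem _ hx hy
      algebraMap_mem' := fun c => by
        rw [Algebra.algebraMap_eq_smul_one]
        exact Submodule.smul_mem _ _ (Φ.M_le_W 0 Φ.one) }
  have : Module.Finite L A := inferInstanceAs (Module.Finite L (Φ.W 0))
  A.toIntermediateField' (isField_of_isIntegral_of_isField' (R := L) (Field.toIsField L))

theorem mem_E {x : F} : x ∈ Φ.E ↔ x ∈ Φ.W 0 := Iff.rfl

theorem finrank_E : Module.finrank L Φ.E = Module.finrank L (Φ.W 0) := rfl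

theorem W_cancel0 {g : F} (hg : g ∈ Φ.W 0) (h : Φ.s * g ∈ Φ.W 0) : g = 0 := by
  by_contra hne
  apply Φ.s_notMem
  rw [← mem_E] at *
  have := Φ.E.mul_mem h (Φ.E.inv_mem hg)
  rwa [mul_assoc, mul_inv_cancel₀ hne, mul_one] at this

theorem conv0 : 2 * Module.finrank L (Φ.W 0) = Module.finrank L ↥(Φ.W 0 ⊔ sm Φ.s (Φ.W 0)) := by
  have h := finrank_add_sm Φ.s_ne (Φ.W 0) ⊥ (by rintro _ ⟨x, hx, rfl⟩; rw [(Submodule.mem_bot L).1 hx]; simp) bot_le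
    (fun g hg h => (Submodule.mem_bot L).2 (Φ.W_cancel0 hg h))
  rw [finrank_bot] at h
  omega

theorem conv (j : ℕ) : Module.finrank L ↥(Φ.W (j + 1) ⊔ sm Φ.s (Φ.W (j + 1))) + Module.finrank L (Φ.W j) =
    2 * Module.finrank L (Φ.W (j + 1)) := by
  refine finrank_add_sm Φ.s_ne _ _ ?_ (Φ.W_mono (by omega)) (fun g hg h => Φ.W_cancel hg h)
  rintro _ ⟨x, hx, rfl⟩; exact Φ.W_s hx

theorem sup_le (j : ℕ) : Φ.W j ⊔ sm Φ.s (Φ.W j) ≤ Φ.W (j + 1) := by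
  refine _root_.sup_le (Φ.W_mono (by omega)) ?_
  rintro _ ⟨x, hx, rfl⟩; exact Φ.W_s hx

theorem incr (j : ℕ) : 2 * Module.finrank L (Φ.W (j + 1)) ≤ Module.finrank L (Φ.W (j + 2)) + Module.finrank L (Φ.W j) := by
  have h1 := Φ.conv j
  have h2 := Submodule.finrank_mono (Φ.sup_le (j + 1))
  rw [show j + 1 + 1 = j + 2 from rfl] at h2
  omega

theorem dimW5 {j : ℕ} (h : Φ.n1 ≤ j) : Module.finrank L (Φ.W (j + 1)) = Module.finrank L (Φ.W j) + 5 := by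
  rw [Φ.W_eq h, Φ.W_eq (by omega : Φ.n1 ≤ j + 1)]
  exact Φ.dim5 j h

theorem incr_le (j : ℕ) : Module.finrank L (Φ.W (j + 1)) ≤ Module.finrank L (Φ.W j) + 5 := by
  have h : ∀ k, Module.finrank L (Φ.W (j + 1)) + Module.finrank L (Φ.W (j + k)) ≤
      Module.finrank L (Φ.W j) + Module.finrank L (Φ.W (j + k + 1)) := by
    intro k
    induction k with
    | zero => rw [add_zero]; omega
    | succ k ih =>
      have := Φ.incr (j + k)
      rw [show j + (k + 1) = j + k + 1 from rfl, show j + k + 1 + 1 = j + k + 2 from rfl]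
      omega
  have h1 := h Φ.n1
  have h2 := Φ.dimW5 (j := j + Φ.n1) (by omega)
  omega

theorem dvd_W (j : ℕ) : Module.finrank L Φ.E ∣ Module.finrank L (Φ.W j) := by
  let W' : Submodule Φ.E F :=
    { carrier := Φ.W j
      zero_mem' := Submodule.zero_mem _
      add_mem' := fun {x y} hx hy => Submodule.add_mem _ hx hy
      smul_mem' := fun c x hx => by
        have := Φ.W_mul (Φ.mem_E.1 c.2) hx
        rw [zero_add] at this
        exact this }
  have h := Module.finrank_mul_finrank L Φ.E W'
  refine ⟨Module.finrank Φ.E W', ?_⟩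
  rw [h]
  rfl

theorem E_cases : Module.finrank L Φ.E = 1 ∨ Module.finrank L Φ.E = 5 := by
  have h1 := Φ.dvd_W Φ.n1
  have h2 := Φ.dvd_W (Φ.n1 + 1)
  rw [Φ.dimW5 le_rfl] at h2
  have h3 := (Nat.dvd_add_right h1).1 h2
  exact (Nat.dvd_prime (by norm_num)).1 h3

theorem transc : Transcendental Φ.E Φ.s := by
  intro h
  have hIntg : IsIntegral Φ.E Φ.s := h.isIntegral
  obtain ⟨p, hp, hp0⟩ := hIntg
  have hn : p.natDegree ≠ 0 := by
    intro h0
    rw [hp.natDegree_eq_zero.1 h0] at hp0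
    simp at hp0
  obtain ⟨n, hn⟩ := Nat.exists_eq_succ_of_ne_zero hn
  rw [Polynomial.eval₂_eq_sum_range, hn, Finset.sum_range_succ, ← Nat.succ_eq_add_one, ← hn, hp.coeff_natDegree, map_one, one_mul] at hp0
  have h1 : Φ.s ^ p.natDegree ∈ Φ.W n := by
    rw [eq_neg_of_add_eq_zero_right hp0]
    refine Submodule.neg_mem _ (Submodule.sum_mem _ fun i hi => ?_)
    have h2 : Φ.s ^ i ∈ Φ.W i := Φ.M_le_W _ (Φ.spow_mem1 i)
    have h3 := Φ.W_mul (Φ.mem_E.1 (p.coeff i).2) h2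
    refine Φ.W_mono ?_ h3
    have := Finset.mem_range.1 hi
    omega
  obtain ⟨-, k, hk⟩ := h1
  apply Φ.s_notMem
  refine ⟨⟨1, Φ.hs⟩, k + n, ?_⟩
  rw [← pow_add, hn] at hk
  rw [← pow_succ]
  exact hk

theorem case5 (h : Module.finrank L Φ.E = 5) : ∀ x ∈ Φ.M 1, ∃ α ∈ Φ.E, ∃ β ∈ Φ.E, x = α * Φ.s + β := by
  have h0 := Φ.conv0
  have h1 := Φ.incr_le 0
  rw [finrank_E] at h
  have h2 := Submodule.finrank_mono (Φ.sup_le 0)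
  have h3 : Φ.W 0 ⊔ sm Φ.s (Φ.W 0) = Φ.W (0 + 1) := Submodule.eq_of_le_of_finrank_eq (Φ.sup_le 0) (by omega)
  intro x hx
  have hx' : x ∈ Φ.W (0 + 1) := Φ.M_le_W _ hx
  rw [← h3] at hx'
  obtain ⟨β, hβ, _, ⟨α, hα, rfl⟩, rfl⟩ := Submodule.mem_sup.1 hx'
  exact ⟨α, hα, β, hβ, by simp [LinearMap.mulLeft_apply]; ring⟩

end Fil
end A1
end AMDP

open MvPolynomial
set_option linter.unusedSectionVars false
set_option linter.unusedSimpArgs false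
namespace AMDP

section B1
variable {L F : Type} [Field L] [Field F] [Algebra L F]
namespace Fil
variable (Φ : Fil L F)

theorem supM_le (j : ℕ) : Φ.M j ⊔ sm Φ.s (Φ.M j) ≤ Φ.M (j + 1) := by
  refine _root_.sup_le (Φ.mono (by omega)) ?_
  rintro _ ⟨x, hx, rfl⟩; exact Φ.smul_mem hx

theorem prop (hM : ∀ n, Φ.M (n + 1) = Φ.M 1 * Φ.M n) (n0 : ℕ)
    (h : Φ.M (n0 + 1) ≤ Φ.M n0 ⊔ sm Φ.s (Φ.M n0)) :
    ∀ k, Φ.M (n0 + k + 1) ≤ Φ.M (n0 + k) ⊔ sm Φ.s (Φ.M (n0 + k)) := by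
  intro k
  induction k with
  | zero => exact h
  | succ k ih =>
    rw [hM (n0 + (k + 1)), Submodule.mul_le]
    intro x hx y hy
    obtain ⟨a, ha, _, ⟨b, hb, rfl⟩, rfl⟩ := Submodule.mem_sup.1 (ih hy)
    rw [mul_add]
    have e : n0 + (k + 1) = 1 + (n0 + k) := by omega
    rw [e]
    refine Submodule.add_mem_sup (Φ.mul hx ha) ⟨x * b, Φ.mul hx hb, ?_⟩
    simp only [LinearMap.mulLeft_apply]; ring

theorem concave (n : ℕ) (h : Φ.M (n + 2) ≤ Φ.M (n + 1) ⊔ sm Φ.s (Φ.M (n + 1))) :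
    Module.finrank L (Φ.M (n + 2)) + Module.finrank L (Φ.M n) ≤ 2 * Module.finrank L (Φ.M (n + 1)) := by
  have h1 := Submodule.finrank_sup_add_finrank_inf_eq (Φ.M (n + 1)) (sm Φ.s (Φ.M (n + 1)))
  have h2 := Submodule.finrank_mono h
  have h3 : sm Φ.s (Φ.M n) ≤ Φ.M (n + 1) ⊓ sm Φ.s (Φ.M (n + 1)) := by
    refine le_inf ?_ (Submodule.map_mono (Φ.mono (by omega)))
    rintro _ ⟨x, hx, rfl⟩; exact Φ.smul_mem hx
  have h4 := Submodule.finrank_mono h3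
  rw [finrank_sm Φ.s_ne] at h1 h4
  omega

theorem growth (hM : ∀ n, Φ.M (n + 1) = Φ.M 1 * Φ.M n) (n0 c : ℕ)
    (h : Φ.M (n0 + 1) ≤ Φ.M n0 ⊔ sm Φ.s (Φ.M n0))
    (hc : Module.finrank L (Φ.M (n0 + 1)) ≤ Module.finrank L (Φ.M n0) + c) :
    ∀ k, Module.finrank L (Φ.M (n0 + k + 1)) ≤ Module.finrank L (Φ.M (n0 + k)) + c := by
  intro k
  induction k with
  | zero => exact hc
  | succ k ih =>
    have h1 := Φ.concave (n0 + k) (Φ.prop hM n0 h (k + 1))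
    rw [show n0 + (k + 1) = n0 + k + 1 from rfl, show n0 + k + 1 + 1 = n0 + k + 2 from rfl]
    omega

theorem stepB (hM : ∀ n, Φ.M (n + 1) = Φ.M 1 * Φ.M n) (hE : Module.finrank L Φ.E = 1)
    (h0 : Module.finrank L (Φ.M 0) = 1) (h1 : Module.finrank L (Φ.M 1) = 5)
    (htau : ∃ n g, g ∈ Φ.M (n + 1) ∧ g ∉ Φ.M n ∧ Φ.s * g ∈ Φ.M (n + 1)) :
    Module.finrank L (Φ.M 2) = 11 ∧ Module.finrank L (Φ.M 3) = 16 := by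
  rw [finrank_E] at hE
  have hW0 : Φ.M 0 = Φ.W 0 := Submodule.eq_of_le_of_finrank_eq (Φ.M_le_W 0) (by omega)
  -- dimension of N2
  have hN2 : Module.finrank L ↥(Φ.M 1 ⊔ sm Φ.s (Φ.M 1)) = 9 := by
    have := finrank_add_sm Φ.s_ne (Φ.M 1) (Φ.M 0) (by
      rintro _ ⟨x, hx, rfl⟩; exact Φ.smul_mem hx) (Φ.mono (by omega)) (by
      intro g hg hsg
      rw [hW0]
      exact Φ.W_cancel (Φ.M_le_W _ hg) (Φ.M_le_W _ hsg))
    omega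
  have hM2le : ¬ Φ.M 2 ≤ Φ.M 1 ⊔ sm Φ.s (Φ.M 1) := by
    intro h
    have h2 := Submodule.finrank_mono h
    have h3 := Φ.growth hM 1 4 h (by rw [show 1 + 1 = 2 from rfl]; omega) Φ.n1
    have h4 := Φ.dim5 (1 + Φ.n1) (by omega)
    omega
  have hlt : 9 < Module.finrank L (Φ.M 2) := by
    rw [← hN2]
    exact Submodule.finrank_lt_finrank_of_lt (lt_of_le_of_ne (Φ.supM_le 1) fun he => hM2le he.ge)
  have hw1 := Φ.incr_le 0
  rw [zero_add] at hw1
  have hw1' := Submodule.finrank_mono (Φ.M_le_W 1)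
  have hw2 := Φ.incr_le 1
  rw [show 1 + 1 = 2 from rfl] at hw2
  have hw2' := Submodule.finrank_mono (Φ.M_le_W 2)
  -- once an increment is 5, everything is generated
  have hgen : ∀ j, Module.finrank L (Φ.W (j + 1)) = Module.finrank L (Φ.W j) + 5 →
      ∀ k, Module.finrank L (Φ.W (j + k + 1)) = Module.finrank L (Φ.W (j + k)) + 5 ∧
        Φ.W (j + k + 2) = Φ.W (j + k + 1) ⊔ sm Φ.s (Φ.W (j + k + 1)) := by
    intro j hj
    have hd : ∀ k, Module.finrank L (Φ.W (j + k + 1)) = Module.finrank L (Φ.W (j + k)) + 5 := by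
      intro k
      induction k with
      | zero => exact hj
      | succ k ih =>
        have a1 := Φ.incr (j + k)
        have a2 := Φ.incr_le (j + k + 1)
        rw [show j + (k + 1) = j + k + 1 from rfl]
        rw [show j + k + 2 = j + k + 1 + 1 from rfl] at a1
        omega
    intro k
    refine ⟨hd k, ?_⟩
    symm
    apply Submodule.eq_of_le_of_finrank_eq (Φ.sup_le (j + k + 1))
    have a1 := Φ.conv (j + k)
    have a2 := hd k
    have a3 := hd (k + 1)
    rw [show j + (k + 1) = j + k + 1 from rfl] at a3
    omega
  -- M = W propagates
  have hMW : ∀ j, Module.finrank L (Φ.W (j + 1)) = Module.finrank L (Φ.W j) + 5 → Φ.M (j + 1) = Φ.W (j + 1) →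
      ∀ k, Φ.M (j + k + 1) = Φ.W (j + k + 1) := by
    intro j hj hjM k
    induction k with
    | zero => exact hjM
    | succ k ih =>
      apply le_antisymm (Φ.M_le_W _)
      rw [show j + (k + 1) + 1 = j + k + 2 from rfl, (hgen j hj k).2, ← ih]
      exact Φ.supM_le _
  have hcases : Module.finrank L (Φ.W 1) = 5 ∨ Module.finrank L (Φ.W 1) = 6 := by omega
  rcases hcases with hw | hw
  · exfalso
    have e1 : Φ.M 1 = Φ.W 1 := Submodule.eq_of_le_of_finrank_eq (Φ.M_le_W 1) (by omega)
    have e2 : Φ.M 2 = Φ.W 2 := Submodule.eq_of_le_of_finrank_eq (Φ.M_le_W 2) (by omega)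
    have e3 := hMW 1 (by rw [show 1 + 1 = 2 from rfl]; omega) e2
    have e : ∀ n, Φ.M n = Φ.W n := by
      intro n
      rcases n with _ | _ | n
      · exact hW0
      · exact e1
      · have := e3 n
        rwa [show 1 + n + 1 = n + 1 + 1 by omega] at this
    obtain ⟨n, g, hg, hg', hsg⟩ := htau
    rw [e] at *
    exact hg' (Φ.W_cancel hg hsg)
  have hj0 : Module.finrank L (Φ.W (0 + 1)) = Module.finrank L (Φ.W 0) + 5 := by rw [zero_add]; omega
  have hg0 := hgen 0 hj0
  have hw2e : Module.finrank L (Φ.W 2) = 11 := by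
    have := (hg0 1).1; rw [show 0 + 1 + 1 = 2 from rfl, show 0 + 1 = 1 from rfl] at this; omega
  have hw3e : Module.finrank L (Φ.W 3) = 16 := by
    have := (hg0 2).1; rw [show 0 + 2 + 1 = 3 from rfl, show 0 + 2 = 2 from rfl] at this; omega
  have hc2 : Module.finrank L (Φ.M 2) = 10 ∨ Module.finrank L (Φ.M 2) = 11 := by omega
  rcases hc2 with hm | hm
  · exfalso
    obtain ⟨z, hz, hzM⟩ : ∃ z ∈ Φ.W 1, z ∉ Φ.M 1 := by
      by_contra hcon
      push Not at hcon
      have := Submodule.finrank_mono (show Φ.W 1 ≤ Φ.M 1 from hcon)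
      omega
    have hW1 : Φ.M 1 ⊔ Submodule.span L {z} = Φ.W 1 := by
      apply Submodule.eq_of_le_of_finrank_le
      · exact _root_.sup_le (Φ.M_le_W 1) ((Submodule.span_singleton_le_iff_mem _ _).2 hz)
      · rw [hw]
        have : Φ.M 1 < Φ.M 1 ⊔ Submodule.span L {z} := by
          refine lt_of_le_of_ne le_sup_left fun he => hzM ?_
          rw [he]
          exact Submodule.mem_sup_right (Submodule.mem_span_singleton_self z)
        have hfin : Module.Finite L ↥(Φ.M 1 ⊔ Submodule.span L {z}) := inferInstance
        have := Submodule.finrank_lt_finrank_of_lt this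
        omega
    -- W2 elements
    have hW2 : ∀ x ∈ Φ.W 2, ∃ u ∈ Φ.M 1 ⊔ sm Φ.s (Φ.M 1), ∃ a b : L, x = u + (a • z + b • (Φ.s * z)) := by
      intro x hx
      have e := (hg0 0).2
      rw [show 0 + 0 + 2 = 2 from rfl, show 0 + 0 + 1 = 1 from rfl] at e
      rw [e, ← hW1] at hx
      obtain ⟨p, hp, _, ⟨q, hq, rfl⟩, rfl⟩ := Submodule.mem_sup.1 hx
      obtain ⟨p1, hp1, p2, hp2, rfl⟩ := Submodule.mem_sup.1 hp
      obtain ⟨q1, hq1, q2, hq2, rfl⟩ := Submodule.mem_sup.1 hq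
      obtain ⟨a, rfl⟩ := Submodule.mem_span_singleton.1 hp2
      obtain ⟨b, rfl⟩ := Submodule.mem_span_singleton.1 hq2
      refine ⟨p1 + Φ.s * q1, Submodule.add_mem_sup hp1 ⟨q1, hq1, rfl⟩, a, b, ?_⟩
      simp only [LinearMap.mulLeft_apply, mul_add, mul_smul_comm]
      ring
    set N2 := Φ.M 1 ⊔ sm Φ.s (Φ.M 1) with hN2def
    obtain ⟨v, hv, hvN⟩ : ∃ v ∈ Φ.M 2, v ∉ N2 := by
      by_contra hcon
      push Not at hcon
      exact hM2le hcon
    obtain ⟨u, hu, a, b, hvu⟩ := hW2 v (Φ.M_le_W 2 hv)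
    have hN2M : N2 ≤ Φ.M 2 := Φ.supM_le 1
    let p : F := a • 1 + b • Φ.s
    have hpz : p * z = v - u := by
      rw [hvu]; simp only [p, add_mul, smul_mul_assoc, one_mul]; ring
    have hpzM : p * z ∈ Φ.M 2 := by rw [hpz]; exact Submodule.sub_mem _ hv (hN2M hu)
    have hpM : p ∈ Φ.M 1 := Submodule.add_mem _ (Submodule.smul_mem _ _ (Φ.mono (by omega) Φ.one))
      (Submodule.smul_mem _ _ Φ.hs)
    have hM2e : N2 ⊔ Submodule.span L {p * z} = Φ.M 2 := by
      apply Submodule.eq_of_le_of_finrank_le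
      · exact _root_.sup_le hN2M ((Submodule.span_singleton_le_iff_mem _ _).2 hpzM)
      · have : N2 < N2 ⊔ Submodule.span L {p * z} := by
          refine lt_of_le_of_ne le_sup_left fun he => hvN ?_
          have h5 : p * z ∈ N2 := by
            rw [he]
            exact Submodule.mem_sup_right (Submodule.mem_span_singleton_self _)
          rw [hpz] at h5
          have := Submodule.add_mem _ h5 hu
          rwa [sub_add_cancel] at this
        have := Submodule.finrank_lt_finrank_of_lt this
        omega
    -- M3 inside M2 + s M2
    have hT : ∀ x ∈ Φ.M 1, ∀ w ∈ N2, x * w ∈ Φ.M 2 ⊔ sm Φ.s (Φ.M 2) := by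
      intro x hx w hw'
      obtain ⟨c, hc, _, ⟨e, he, rfl⟩, rfl⟩ := Submodule.mem_sup.1 hw'
      rw [mul_add]
      refine Submodule.add_mem_sup (Φ.mul hx hc) ⟨x * e, Φ.mul hx he, ?_⟩
      simp only [LinearMap.mulLeft_apply]; ring
    have hM3 : Φ.M (2 + 1) ≤ Φ.M 2 ⊔ sm Φ.s (Φ.M 2) := by
      rw [hM 2, Submodule.mul_le]
      intro x hx y hy
      rw [← hM2e] at hy
      obtain ⟨w, hw', y2, hy2, rfl⟩ := Submodule.mem_sup.1 hy
      obtain ⟨c, rfl⟩ := Submodule.mem_span_singleton.1 hy2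
      rw [mul_add]
      refine Submodule.add_mem _ (hT x hx w hw') ?_
      rw [mul_smul_comm]
      refine Submodule.smul_mem _ _ ?_
      have hxz : x * z ∈ Φ.W 2 := Φ.W_mul (Φ.M_le_W 1 hx) hz
      obtain ⟨u', hu', a', b', he⟩ := hW2 _ hxz
      have : x * (p * z) = p * u' + (a' • (p * z) + Φ.s * (b' • (p * z))) := by
        rw [show x * (p * z) = p * (x * z) by ring, he]
        simp only [mul_add, mul_smul_comm]; ring
      rw [this]
      refine Submodule.add_mem _ (hT p hpM u' hu') ?_
      exact Submodule.add_mem_sup (Submodule.smul_mem _ _ hpzM) ⟨_, Submodule.smul_mem _ _ hpzM, rfl⟩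
    have hgr := Φ.growth hM 2 5 hM3 (by
      have h2 := Φ.concave 1 (by exact hM3)
      rw [show 1 + 2 = 2 + 1 from rfl, show 1 + 1 = 2 from rfl] at h2
      omega)
    have hle : ∀ k, Module.finrank L (Φ.M (2 + k)) ≤ 10 + 5 * k := by
      intro k
      induction k with
      | zero => rw [add_zero, hm]
      | succ k ih =>
        have := hgr k
        rw [show 2 + (k + 1) = 2 + k + 1 from rfl]
        omega
    have hwk : ∀ k, Module.finrank L (Φ.W (2 + k)) = 11 + 5 * k := by
      intro k
      induction k with
      | zero => rw [add_zero, hw2e]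
      | succ k ih =>
        have := (hg0 (2 + k)).1
        rw [zero_add] at this
        rw [show 2 + (k + 1) = 2 + k + 1 from rfl]
        omega
    have q1 := hle Φ.n1
    have q2 := hwk Φ.n1
    rw [Φ.W_eq (by omega)] at q2
    omega
  · have e2 : Φ.M 2 = Φ.W 2 := Submodule.eq_of_le_of_finrank_eq (Φ.M_le_W 2) (by omega)
    have e3 := hMW 1 (by rw [show 1 + 1 = 2 from rfl]; omega) e2 1
    rw [show 1 + 1 + 1 = 3 from rfl] at e3
    exact ⟨hm, by rw [e3, hw3e]⟩

end Fil
end B1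
end AMDP

open MvPolynomial
set_option linter.unusedSectionVars false
set_option linter.unusedSimpArgs false
namespace AMDP

section depth
variable {K : Type} [Field K] {r : ℕ}

/-- the irrelevant ideal -/
def irr (K : Type) [Field K] (r : ℕ) : Ideal (PS K r) :=
  Ideal.span (Set.range (X : Fin (r + 1) → PS K r))

def Reg (J : Ideal (PS K r)) (a : PS K r) : Prop := ∀ y, a * y ∈ J → y ∈ J

def RL : Ideal (PS K r) → List (PS K r) → Prop
  | _, [] => True
  | J, a :: rs => Reg J a ∧ RL (J ⊔ Ideal.span {a}) rs

def DG : ℕ → Ideal (PS K r) → Prop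
  | 0, _ => True
  | n + 1, J => ∃ a ∈ irr K r, Reg J a ∧ DG n (J ⊔ Ideal.span {a})

def NS (J : Ideal (PS K r)) : Prop := ∀ x, (∀ i, X i * x ∈ J) → x ∈ J

theorem irr_mul {J : Ideal (PS K r)} {x : PS K r} (h : ∀ i, X i * x ∈ J) {a : PS K r}
    (ha : a ∈ irr K r) : a * x ∈ J := by
  unfold irr at ha
  induction ha using Submodule.span_induction with
  | mem y hy => obtain ⟨i, rfl⟩ := hy; exact h i
  | zero => simp
  | add a b _ _ h1 h2 => rw [add_mul]; exact J.add_mem h1 h2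
  | smul c a _ h1 => rw [smul_eq_mul, mul_assoc]; exact J.mul_mem_left _ h1

theorem lin_irr {a : PS K r} (ha : a.IsHomogeneous 1) : a ∈ irr K r := by
  have : a ∈ Submodule.span K (Set.range (X : Fin (r + 1) → PS K r)) := by
    rw [← homogeneousSubmodule_one_eq_span_X]; exact ha
  exact Submodule.span_le_restrictScalars K (PS K r) _ this

theorem NS_of_reg {J : Ideal (PS K r)} {a : PS K r} (ha : a ∈ irr K r) (h : Reg J a) : NS J :=
  fun x hx => h x (irr_mul hx ha)

theorem exists_reg [Infinite K] (T : Finset (Ideal (PS K r))) (hT : ∀ J ∈ T, NS J) :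
    ∃ b : PS K r, b.IsHomogeneous 1 ∧ ∀ J ∈ T, Reg J b := by
  classical
  let Ps : Set (Ideal (PS K r)) := ⋃ J ∈ T, associatedPrimes (PS K r) (PS K r ⧸ J)
  have hfin : Ps.Finite := T.finite_toSet.biUnion fun J _ => associatedPrimes.finite _ _
  let V := homogeneousSubmodule (Fin (r + 1)) K 1
  let f : Ideal (PS K r) → Subspace K V := fun p => (p.restrictScalars K).comap V.subtype
  let s : Finset (Subspace K V) := hfin.toFinset.image f
  have htop : ⊤ ∉ s := by
    intro h
    simp only [s, Finset.mem_image, Set.Finite.mem_toFinset] at h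
    obtain ⟨p, hp, hpt⟩ := h
    simp only [Ps, Set.mem_iUnion] at hp
    obtain ⟨J, hJ, hp⟩ := hp
    have hX : ∀ i, X i ∈ p := by
      intro i
      have : (⟨X i, isHomogeneous_X K i⟩ : V) ∈ f p := by rw [hpt]; trivial
      exact this
    have hp : IsAssociatedPrime p (PS K r ⧸ J) := hp
    obtain ⟨hpp, x, hx⟩ := isAssociatedPrime_iff.1 hp
    obtain ⟨x, rfl⟩ := Ideal.Quotient.mk_surjective x
    have hxJ : x ∈ J := by
      refine hT J hJ x fun i => ?_
      have := hX i
      rw [hx] at this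
      rw [← Ideal.Quotient.eq_zero_iff_mem]
      rw [Submodule.mem_colon_singleton, Submodule.mem_bot] at this
      exact this
    apply hpp.ne_top
    rw [hx, Ideal.Quotient.eq_zero_iff_mem.2 hxJ]
    ext z; simp
  have := Subspace.biUnion_ne_univ_of_top_notMem htop
  obtain ⟨b, hb⟩ := (Set.ne_univ_iff_exists_notMem _).1 this
  refine ⟨b, b.2, fun J hJ y hy => ?_⟩
  by_contra hyJ
  have h1 : (b : PS K r) ∈ ⋃ p ∈ associatedPrimes (PS K r) (PS K r ⧸ J), (p : Set (PS K r)) := by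
    rw [biUnion_associatedPrimes_eq_zero_divisors]
    refine ⟨Ideal.Quotient.mk J y, ?_, ?_⟩
    · rwa [Ne, Ideal.Quotient.eq_zero_iff_mem]
    · exact (Ideal.Quotient.eq_zero_iff_mem (I := J) (a := (b : PS K r) * y)).2 hy
  simp only [Set.mem_iUnion] at h1
  obtain ⟨p, hp, hbp⟩ := h1
  apply hb
  simp only [Set.mem_iUnion]
  refine ⟨f p, ?_, hbp⟩
  simp only [s, Finset.mem_image, Set.Finite.mem_toFinset, Ps, Set.mem_iUnion]
  exact ⟨p, ⟨J, hJ, hp⟩, rfl⟩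

theorem mem_sup_single {J : Ideal (PS K r)} {a x : PS K r} :
    x ∈ J ⊔ Ideal.span {a} ↔ ∃ c, x - a * c ∈ J := by
  rw [Submodule.mem_sup]
  constructor
  · rintro ⟨j, hj, z, hz, rfl⟩
    obtain ⟨c, rfl⟩ := Ideal.mem_span_singleton'.1 hz
    exact ⟨c, by convert hj using 1; ring⟩
  · rintro ⟨c, hc⟩
    exact ⟨_, hc, a * c, Ideal.mul_mem_right _ _ (Ideal.mem_span_singleton_self a), by ring⟩

theorem Reg_swap {J : Ideal (PS K r)} {a b : PS K r} (ha : Reg J a) (hb : Reg (J ⊔ Ideal.span {a}) b) :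
    Reg (J ⊔ Ideal.span {b}) a := by
  intro z hz
  obtain ⟨w, hw⟩ := mem_sup_single.1 hz
  have h1 : b * w ∈ J ⊔ Ideal.span {a} := mem_sup_single.2 ⟨z, by
    convert J.neg_mem hw using 1; ring⟩
  obtain ⟨w', hw'⟩ := mem_sup_single.1 (hb _ h1)
  refine mem_sup_single.2 ⟨w', ha _ ?_⟩
  convert J.add_mem hw (J.mul_mem_left b hw') using 1; ring

theorem NS_transfer {J : Ideal (PS K r)} {a l : PS K r} (ham : a ∈ irr K r)
    (ha : Reg J a) (hlr : Reg J l)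
    (h : NS (J ⊔ Ideal.span {a})) : NS (J ⊔ Ideal.span {l}) := by
  intro z hz
  obtain ⟨x, hx⟩ := mem_sup_single.1 (irr_mul hz ham)
  -- a z = l x mod J
  have : x ∈ J ⊔ Ideal.span {a} := by
    refine h x fun i => ?_
    obtain ⟨w, hw⟩ := mem_sup_single.1 (hz i)
    refine mem_sup_single.2 ⟨w, hlr _ ?_⟩
    convert J.sub_mem (J.mul_mem_left a hw) (J.mul_mem_left (X i) hx) using 1; ring
  obtain ⟨w, hw⟩ := mem_sup_single.1 this
  refine mem_sup_single.2 ⟨w, ha _ ?_⟩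
  convert J.add_mem hx (J.mul_mem_left l hw) using 1; ring

theorem DG_drop [Infinite K] (n : ℕ) : ∀ (J : Ideal (PS K r)) (a l : PS K r), a ∈ irr K r → l ∈ irr K r →
    Reg J a → Reg J l → DG n (J ⊔ Ideal.span {a}) → DG n (J ⊔ Ideal.span {l}) := by
  classical
  induction n with
  | zero => intros; trivial
  | succ n ih =>
    intro J a l ha hl hra hrl h
    obtain ⟨c, hc, hrc, hD⟩ := h
    have h1 : NS (J ⊔ Ideal.span {a}) := NS_of_reg hc hrc
    have h2 := NS_transfer ha hra hrl h1
    obtain ⟨b, hb, hbr⟩ := exists_reg {J ⊔ Ideal.span {a}, J ⊔ Ideal.span {l}} (by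
      simp [h1, h2])
    have hba := hbr (J ⊔ Ideal.span {a}) (by simp)
    have hbl := hbr (J ⊔ Ideal.span {l}) (by simp)
    have hbm := lin_irr hb
    refine ⟨b, hbm, hbl, ?_⟩
    have e1 := ih _ c b hc hbm hrc hba hD
    rw [sup_right_comm] at e1 ⊢
    exact ih _ a l ha hl (Reg_swap hra hba) (Reg_swap hrl hbl) e1

theorem exists_linRL [Infinite K] (n : ℕ) : ∀ (J : Ideal (PS K r)), DG n J →
    ∃ rs : List (PS K r), rs.length = n ∧ (∀ x ∈ rs, x.IsHomogeneous 1) ∧ RL J rs := by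
  classical
  induction n with
  | zero => intro J _; exact ⟨[], rfl, by simp, trivial⟩
  | succ n ih =>
    rintro J ⟨a, ha, hra, hD⟩
    obtain ⟨b, hb, hbr⟩ := exists_reg {J} (by simpa using NS_of_reg ha hra)
    have hbr := hbr J (by simp)
    obtain ⟨rs, h1, h2, h3⟩ := ih _ (DG_drop n J a b ha (lin_irr hb) hra hbr hD)
    exact ⟨b :: rs, by simp [h1], by simpa [hb] using h2, hbr, h3⟩

theorem RL_iff : ∀ (rs : List (PS K r)) (J : Ideal (PS K r)), RL J rs ↔
    ∀ i (h : i < rs.length), Reg (J ⊔ Ideal.span {x | x ∈ rs.take i}) rs[i]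
  | [], J => by simp [RL]
  | a :: rs, J => by
    have key : ∀ i, J ⊔ Ideal.span {x | x ∈ (a :: rs).take (i + 1)} =
        J ⊔ Ideal.span {a} ⊔ Ideal.span {x | x ∈ rs.take i} := by
      intro i
      rw [sup_assoc, ← Ideal.span_union]
      congr 2
      ext x; simp
    rw [RL, RL_iff rs]
    constructor
    · rintro ⟨h0, h⟩ i hi
      cases i with
      | zero => simpa using h0
      | succ i => rw [key]; exact h i (by simpa using hi)
    · intro h
      refine ⟨by have := h 0 (by simp); rw [List.getElem_cons_zero] at this; simpa using this, fun i hi => ?_⟩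
      have := h (i + 1) (by simpa using hi)
      rw [key] at this; exact this

theorem regSeq_map (I : Ideal (PS K r)) (rs : List (PS K r)) :
    AMD.IsRegSeq (rs.map (Ideal.Quotient.mk I)) ↔ RL I rs := by
  have key : ∀ i, Ideal.span {x | x ∈ (rs.map (Ideal.Quotient.mk I)).take i} =
      (Ideal.span {x | x ∈ rs.take i}).map (Ideal.Quotient.mk I) := by
    intro i
    rw [Ideal.map_span]; congr 1; ext x; simp [← List.map_take]
  rw [RL_iff]
  unfold AMD.IsRegSeq
  constructor
  · intro h i hi y hy
    have := h ⟨i, by simpa using hi⟩ (Ideal.Quotient.mk I y)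
    simp only [key, List.get_eq_getElem, List.getElem_map, ← map_mul, Ideal.mem_quotient_iff_mem_sup] at this
    rw [sup_comm] at hy ⊢
    exact this hy
  · rintro h ⟨i, hi⟩ y
    obtain ⟨y, rfl⟩ := Ideal.Quotient.mk_surjective y
    simp only [key, List.get_eq_getElem, List.getElem_map, ← map_mul, Ideal.mem_quotient_iff_mem_sup]
    have := h i (by simpa using hi) y
    rw [sup_comm] at this
    exact this

theorem DG_of_RL : ∀ (rs : List (PS K r)) (J : Ideal (PS K r)), (∀ x ∈ rs, x ∈ irr K r) → RL J rs →
    DG rs.length J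
  | [], _, _, _ => trivial
  | a :: rs, J, hm, h => ⟨a, hm a (by simp), h.1,
      DG_of_RL rs _ (fun x hx => hm x (by simp [hx])) h.2⟩

theorem depth_lin [Infinite K] (I : Ideal (PS K r)) (hI : I ≤ irr K r) (t : ℕ) (h : AMD.DepthEq K r I t) :
    (∃ rs : List (PS K r), rs.length = t ∧ (∀ x ∈ rs, x.IsHomogeneous 1) ∧ RL I rs) ∧
    ∀ rs : List (PS K r), (∀ x ∈ rs, x ∈ irr K r) → RL I rs → rs.length ≤ t := by
  obtain ⟨⟨rs, h1, h2, h3⟩, h4⟩ := h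
  constructor
  · subst h1
    apply exists_linRL
    obtain ⟨rs, rfl⟩ : ∃ l : List (PS K r), l.map (Ideal.Quotient.mk I) = rs :=
      (List.map_surjective_iff.2 Ideal.Quotient.mk_surjective) rs
    rw [List.length_map]
    refine DG_of_RL _ _ (fun x hx => ?_) ((regSeq_map _ _).1 h3)
    have := h2 _ (List.mem_map_of_mem hx)
    rw [AMD.maxIdl, Ideal.mem_quotient_iff_mem_sup] at this
    have e : irr K r ⊔ I = irr K r := sup_eq_left.2 hI
    unfold irr at e ⊢
    rwa [e] at this
  · intro rs hrs hR
    have := h4 (rs.map (Ideal.Quotient.mk I)) ?_ ((regSeq_map _ _).2 hR)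
    · simpa using this
    · intro x hx
      obtain ⟨y, hy, rfl⟩ := List.mem_map.1 hx
      exact Ideal.mem_map_of_mem _ (hrs y hy)

end depth
end AMDP

open MvPolynomial
set_option linter.unusedSectionVars false
set_option linter.unusedSimpArgs false
set_option linter.unusedVariables false
namespace AMDP

section hilb
variable {K : Type} [Field K] {r : ℕ}

abbrev Sh (K : Type) [Field K] (r n : ℕ) : Submodule K (PS K r) := homogeneousSubmodule (Fin (r+1)) K n

def q (J : Ideal (PS K r)) (n : ℕ) : ℕ := Module.finrank K (AMD.quotComponent K r J n)

theorem q_add (J : Ideal (PS K r)) (n : ℕ) :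
    q J n + Module.finrank K ↥(J.restrictScalars K ⊓ Sh K r n) = Module.finrank K (Sh K r n) := by
  have := finrank_map_add (Ideal.Quotient.mkₐ K J).toLinearMap (Sh K r n)
  have e : J.restrictScalars K = LinearMap.ker (Ideal.Quotient.mkₐ K J).toLinearMap := by
    ext x
    simp only [LinearMap.mem_ker, Submodule.restrictScalars_mem]
    exact Ideal.Quotient.eq_zero_iff_mem.symm
  rw [← this, e, inf_comm]
  rfl

theorem hc_mul_zero {l p : PS K r} (hl : l.IsHomogeneous 1) :
    homogeneousComponent 0 (p * l) = 0 := by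
  have h0 : coeff 0 l = 0 := hl.coeff_eq_zero (by simp)
  rw [← constantCoeff_eq] at h0
  rw [homogeneousComponent_zero, ← constantCoeff_eq, map_mul, h0, mul_zero, map_zero]

theorem lin_mul_mem {l f : PS K r} (hl : l.IsHomogeneous 1) {n : ℕ} (hf : f ∈ Sh K r n) :
    l * f ∈ Sh K r (n+1) := by
  have := hf.mul hl
  rwa [mul_comm] at this

theorem hom_sup {J : Ideal (PS K r)} (hJ : AMD.IsHomIdeal K r J) {l : PS K r} (hl : l.IsHomogeneous 1) :
    AMD.IsHomIdeal K r (J ⊔ Ideal.span {l}) := by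
  intro p hp n
  obtain ⟨c, hc⟩ := mem_sup_single.1 hp
  have h1 := hJ _ hc n
  rw [map_sub, mul_comm] at h1
  cases n with
  | zero => rw [hc_mul_zero hl, sub_zero] at h1; exact Ideal.mem_sup_left h1
  | succ n => rw [hc_mul hl, mul_comm] at h1; exact mem_sup_single.2 ⟨_, h1⟩

theorem sup_deg {J : Ideal (PS K r)} (hJ : AMD.IsHomIdeal K r J) {l : PS K r} (hl : l.IsHomogeneous 1)
    (n : ℕ) : (J ⊔ Ideal.span {l}).restrictScalars K ⊓ Sh K r (n+1) =
      (J.restrictScalars K ⊓ Sh K r (n+1)) ⊔ (Sh K r n).map (LinearMap.mulLeft K l) := by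
  apply le_antisymm
  · rintro p ⟨hp, hp1⟩
    obtain ⟨c, hc⟩ := mem_sup_single.1 hp
    have h1 := hJ _ hc (n+1)
    have hp2 : homogeneousComponent (n+1) p = p := by
      rw [homogeneousComponent_of_mem hp1]; simp
    rw [map_sub, mul_comm, hc_mul hl, hp2, mul_comm] at h1
    have h2 : l * homogeneousComponent n c ∈ Sh K r (n+1) := lin_mul_mem hl (homogeneousComponent_isHomogeneous n c)
    refine Submodule.mem_sup.2 ⟨_, ⟨h1, Submodule.sub_mem _ hp1 h2⟩, l * homogeneousComponent n c,
      ⟨_, homogeneousComponent_isHomogeneous n c, rfl⟩, by ring⟩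
  · apply sup_le
    · exact fun x hx => ⟨Ideal.mem_sup_left hx.1, hx.2⟩
    · rintro _ ⟨c, hc, rfl⟩
      refine ⟨Ideal.mem_sup_right (Ideal.mul_mem_right _ _ (Ideal.mem_span_singleton_self l)), lin_mul_mem hl hc⟩

theorem q_rec {J : Ideal (PS K r)} (hJ : AMD.IsHomIdeal K r J) {l : PS K r} (hl : l.IsHomogeneous 1)
    (hl0 : l ≠ 0) (n : ℕ) (hreg : ∀ f ∈ Sh K r n, l * f ∈ J → f ∈ J) :
    q (J ⊔ Ideal.span {l}) (n+1) + q J n = q J (n+1) := by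
  have h1 := q_add (J ⊔ Ideal.span {l}) (n+1)
  have h2 := q_add J n
  have h3 := q_add J (n+1)
  rw [sup_deg hJ hl] at h1
  have inj : Function.Injective (LinearMap.mulLeft K l) := fun a b h => mul_left_cancel₀ hl0 h
  have hf1 : FiniteDimensional K ↥(J.restrictScalars K ⊓ Sh K r (n+1)) :=
    Submodule.finiteDimensional_inf_right _ _
  have hf2 : FiniteDimensional K ↥((Sh K r n).map (LinearMap.mulLeft K l)) := inferInstance
  have h4 := Submodule.finrank_sup_add_finrank_inf_eq (J.restrictScalars K ⊓ Sh K r (n+1))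
    ((Sh K r n).map (LinearMap.mulLeft K l))
  have h5 : (J.restrictScalars K ⊓ Sh K r (n+1)) ⊓ ((Sh K r n).map (LinearMap.mulLeft K l)) =
      (J.restrictScalars K ⊓ Sh K r n).map (LinearMap.mulLeft K l) := by
    apply le_antisymm
    · rintro _ ⟨⟨hx, _⟩, ⟨f, hf, rfl⟩⟩
      exact ⟨f, ⟨hreg f hf hx, hf⟩, rfl⟩
    · rintro _ ⟨f, ⟨hf, hf2⟩, rfl⟩
      refine ⟨⟨J.mul_mem_left _ hf, lin_mul_mem hl hf2⟩, ⟨f, hf2, rfl⟩⟩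
  have h6 := fun p : Submodule K (PS K r) =>
    (Submodule.equivMapOfInjective (LinearMap.mulLeft K l) inj p).finrank_eq
  rw [h5, ← h6, ← h6] at h4
  omega

theorem q_zero {J : Ideal (PS K r)} (hJ : J ≤ irr K r) : q J 0 = 1 := by
  have h := q_add J 0
  rw [finrank_hom] at h
  have : J.restrictScalars K ⊓ Sh K r 0 = ⊥ := by
    rw [eq_bot_iff]
    rintro x ⟨hx, hx0⟩
    have h1 : x ∈ irr K r := hJ hx
    have hx2 : homogeneousComponent 0 x = x := by
      rw [homogeneousComponent_of_mem hx0]; simp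
    rw [homogeneousComponent_zero] at hx2
    have : coeff 0 x = 0 := by
      unfold irr at h1
      have hle : Ideal.span (Set.range (X : Fin (r+1) → PS K r)) ≤ RingHom.ker (constantCoeff (R := K) (σ := Fin (r+1))) := by
        rw [Ideal.span_le]; rintro _ ⟨i, rfl⟩; simp
      simpa [RingHom.mem_ker, constantCoeff_eq] using hle h1
    rw [this] at hx2
    simpa using hx2.symm
  rw [this] at h
  simpa using h

def En : Ideal (PS K r) → List (PS K r) → Ideal (PS K r)
  | J, [] => J
  | J, a :: rs => En (J ⊔ Ideal.span {a}) rs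

theorem En_hom : ∀ (rs : List (PS K r)) (J : Ideal (PS K r)), AMD.IsHomIdeal K r J →
    (∀ x ∈ rs, x.IsHomogeneous 1) → AMD.IsHomIdeal K r (En J rs)
  | [], _, h, _ => h
  | a :: rs, J, h, h2 => En_hom rs _ (hom_sup h (h2 a (by simp))) (fun x hx => h2 x (by simp [hx]))

theorem sup_irr {J : Ideal (PS K r)} (hJ : J ≤ irr K r) {l : PS K r} (hl : l.IsHomogeneous 1) :
    J ⊔ Ideal.span {l} ≤ irr K r :=
  sup_le hJ ((Ideal.span_singleton_le_iff_mem _).2 (lin_irr hl))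

theorem En_irr : ∀ (rs : List (PS K r)) (J : Ideal (PS K r)), J ≤ irr K r →
    (∀ x ∈ rs, x.IsHomogeneous 1) → En J rs ≤ irr K r
  | [], _, h, _ => h
  | a :: rs, J, h, h2 => En_irr rs _ (sup_irr h (h2 a (by simp))) (fun x hx => h2 x (by simp [hx]))

theorem RL_snoc : ∀ (rs : List (PS K r)) (J : Ideal (PS K r)) (b : PS K r), RL J rs → Reg (En J rs) b →
    RL J (rs ++ [b])
  | [], J, b, _, h => ⟨h, trivial⟩
  | a :: rs, J, b, h, h2 => ⟨h.1, RL_snoc rs _ b h.2 h2⟩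

theorem ne_zero_of_reg {J : Ideal (PS K r)} (hJ : J ≤ irr K r) {l : PS K r} (h : Reg J l) : l ≠ 0 := by
  rintro rfl
  have : (1 : PS K r) ∈ J := h 1 (by simp)
  have h0 := q_zero hJ
  have h1 := q_add J 0
  have : J = ⊤ := (Ideal.eq_top_iff_one J).2 this
  rw [h0, finrank_hom, this] at h1
  have e : (⊤ : Ideal (PS K r)).restrictScalars K ⊓ Sh K r 0 = Sh K r 0 := by
    ext; simp
  rw [e, finrank_hom] at h1
  simp at h1

theorem hilb_En : ∀ (rs : List (PS K r)) (J : Ideal (PS K r)), AMD.IsHomIdeal K r J → J ≤ irr K r →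
    (∀ x ∈ rs, x.IsHomogeneous 1) → RL J rs →
    AMD.hilbSeries K r J * (1 - PowerSeries.X) ^ rs.length = AMD.hilbSeries K r (En J rs)
  | [], _, _, _, _, _ => by simp [En]
  | a :: rs, J, hJ, hJ1, h, hR => by
    have ha : a.IsHomogeneous 1 := h a (by simp)
    have ih := hilb_En rs (J ⊔ Ideal.span {a}) (hom_sup hJ ha) (sup_irr hJ1 ha) (fun x hx => h x (by simp [hx])) hR.2
    rw [En, ← ih, List.length_cons, pow_succ', ← mul_assoc]
    congr 1
    ext n
    cases n with
    | zero =>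
      have h1 := q_zero hJ1
      have h2 := q_zero (sup_irr hJ1 ha)
      unfold q at h1 h2
      simp [AMD.hilbSeries, h1, h2, mul_sub, PowerSeries.coeff_zero_mul_X]
    | succ n =>
      have := q_rec hJ ha (ne_zero_of_reg hJ1 hR.1) n (fun f _ => hR.1 f)
      unfold q at this
      rw [mul_sub, mul_one, map_sub, PowerSeries.coeff_succ_mul_X]
      simp only [AMD.hilbSeries, PowerSeries.coeff_mk]
      rw [← this]; push_cast; ring

theorem q_En : ∀ (rs : List (PS K r)) (J : Ideal (PS K r)), AMD.IsHomIdeal K r J → J ≤ irr K r →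
    (∀ x ∈ rs, x.IsHomogeneous 1) → RL J rs →
    q J 1 = q (En J rs) 1 + rs.length ∧
    q J 2 = q (En J rs) 2 + rs.length * q (En J rs) 1 + rs.length.multichoose 2 ∧
    q J 3 = q (En J rs) 3 + rs.length * q (En J rs) 2 + rs.length.multichoose 2 * q (En J rs) 1
      + rs.length.multichoose 3
  | [], _, _, _, _, _ => by simp [En, Nat.multichoose]
  | a :: rs, J, hJ, hJ1, h, hR => by
    have ha : a.IsHomogeneous 1 := h a (by simp)
    obtain ⟨i1, i2, i3⟩ := q_En rs (J ⊔ Ideal.span {a}) (hom_sup hJ ha) (sup_irr hJ1 ha) (fun x hx => h x (by simp [hx])) hR.2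
    have e := fun n => q_rec hJ ha (ne_zero_of_reg hJ1 hR.1) n (fun f _ => hR.1 f)
    have e0 := e 0
    have e1 := e 1
    have e2 := e 2
    rw [q_zero hJ1] at e0
    norm_num at e0 e1 e2
    have m2 : (rs.length + 1).multichoose 2 = rs.length.multichoose 2 + (rs.length + 1) := by
      rw [Nat.multichoose_succ_succ, Nat.multichoose_one_right]
    have m3 : (rs.length + 1).multichoose 3 = rs.length.multichoose 3 + (rs.length + 1).multichoose 2 := by
      rw [Nat.multichoose_succ_succ]
    rw [List.length_cons, En, m3, m2]
    refine ⟨by lia, ?_, ?_⟩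
    · rw [← e1, ← e0, i1, i2]; ring
    · rw [← e2, ← e1, ← e0, i1, i2, i3]; ring

theorem q_eventually {J : Ideal (PS K r)} {h : Polynomial ℤ} {e : ℕ}
    (hh : AMD.hilbSeries K r J * (1 - PowerSeries.X) = PowerSeries.mk (fun n => h.coeff n))
    (he : h.eval 1 = (e : ℤ)) : ∀ n, h.natDegree ≤ n → q J n = e := by
  have key : ∀ n, (q J n : ℤ) = ∑ i ∈ Finset.range (n+1), h.coeff i := by
    intro n
    induction n with
    | zero =>
      have := congrArg (PowerSeries.coeff 0) hh
      simp [mul_sub, AMD.hilbSeries] at this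
      simpa [q] using this
    | succ n ih =>
      have := congrArg (PowerSeries.coeff (n+1)) hh
      rw [mul_sub, mul_one, map_sub, PowerSeries.coeff_succ_mul_X] at this
      simp only [AMD.hilbSeries, PowerSeries.coeff_mk] at this
      rw [Finset.sum_range_succ, ← ih, ← this, q, q]; ring
  intro n hn
  have := key n
  rw [Polynomial.eval_eq_sum_range' (Nat.lt_succ_of_le hn)] at he
  simp only [one_pow, mul_one] at he
  rw [Nat.succ_eq_add_one, ← this] at he
  exact_mod_cast he

end hilb
end AMDP

open MvPolynomial
set_option linter.unusedSectionVars false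
set_option linter.unusedSimpArgs false
namespace AMDP

section sat
variable {K : Type} [Field K] {r : ℕ}

theorem hc_mul_gen {u : PS K r} {n : ℕ} (hu : u ∈ Sh K r n) (x : PS K r) (j : ℕ) :
    homogeneousComponent (n + j) (u * x) = u * homogeneousComponent j x := by
  classical
  conv_lhs => rw [← sum_homogeneousComponent x, Finset.mul_sum, map_sum]
  have h1 : ∀ i, homogeneousComponent (n + j) (u * homogeneousComponent i x) =
      if i = j then u * homogeneousComponent j x else 0 := by
    intro i
    rw [homogeneousComponent_of_mem ((mem_homogeneousSubmodule _ _).2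
      (IsHomogeneous.mul hu (homogeneousComponent_isHomogeneous i x)))]
    by_cases h : i = j
    · subst h; simp
    · rw [if_neg (by omega), if_neg h]
  simp only [h1, Finset.sum_ite_eq']
  split_ifs with h
  · rfl
  · rw [homogeneousComponent_eq_zero j x (by simpa using h), mul_zero]

def Sat (J : Ideal (PS K r)) : Ideal (PS K r) where
  carrier := {x | ∃ k, ∀ n ≥ k, ∀ u ∈ Sh K r n, u * x ∈ J}
  zero_mem' := ⟨0, by simp⟩
  add_mem' := by
    rintro a b ⟨k, hk⟩ ⟨k', hk'⟩
    refine ⟨max k k', fun n hn u hu => ?_⟩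
    rw [mul_add]
    exact J.add_mem (hk n (le_trans (le_max_left _ _) hn) u hu)
      (hk' n (le_trans (le_max_right _ _) hn) u hu)
  smul_mem' := by
    rintro c x ⟨k, hk⟩
    refine ⟨k, fun n hn u hu => ?_⟩
    rw [smul_eq_mul, mul_left_comm]
    exact J.mul_mem_left _ (hk n hn u hu)

theorem mem_Sat {J : Ideal (PS K r)} {x : PS K r} :
    x ∈ Sat J ↔ ∃ k, ∀ n ≥ k, ∀ u ∈ Sh K r n, u * x ∈ J := Iff.rfl

theorem Sat_NS (J : Ideal (PS K r)) : NS (Sat J) := by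
  intro x hx
  choose k hk using fun i => mem_Sat.1 (hx i)
  refine mem_Sat.2 ⟨Finset.univ.sup k + 1, fun n hn u hu => ?_⟩
  obtain ⟨m, rfl⟩ : ∃ m, n = m + 1 := ⟨n - 1, by omega⟩
  unfold Sh at hu
  rw [← homogeneousSubmodule_one_pow, pow_succ, homogeneousSubmodule_one_pow] at hu
  refine Submodule.mul_induction_on hu (fun a ha l hl => ?_) (fun a b ha hb => ?_)
  · have := irr_mul (J := J) (x := a * x) (fun i => ?_) (lin_irr hl)
    · rwa [← mul_assoc, mul_comm l] at this
    · rw [mul_left_comm]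
      refine hk i m ?_ a ha
      have := Finset.le_sup (f := k) (Finset.mem_univ i)
      omega
  · rw [add_mul]; exact J.add_mem ha hb

theorem Sat_hom {J : Ideal (PS K r)} (hJ : AMD.IsHomIdeal K r J) : AMD.IsHomIdeal K r (Sat J) := by
  rintro x hx j
  obtain ⟨k, hk⟩ := mem_Sat.1 hx
  refine mem_Sat.2 ⟨k, fun n hn u hu => ?_⟩
  rw [← hc_mul_gen hu]
  exact hJ _ (hk n hn u hu) _

theorem Sat_large {J : Ideal (PS K r)} (hJ : AMD.IsHomIdeal K r J) :
    ∃ n1, ∀ n ≥ n1, ∀ f ∈ Sh K r n, f ∈ Sat J → f ∈ J := by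
  classical
  obtain ⟨T, hT⟩ := (isNoetherianRing_iff_ideal_fg _).1 (inferInstance : IsNoetherianRing (PS K r)) (Sat J)
  have hTS : ∀ t ∈ T, t ∈ Sat J := fun t ht => by rw [← hT]; exact Ideal.subset_span ht
  choose! k hk using fun t => fun ht : t ∈ Sat J => mem_Sat.1 ht
  have huni : ∀ x ∈ Sat J, ∀ n ≥ T.sup k, ∀ u ∈ Sh K r n, u * x ∈ J := by
    intro x hx n hn u hu
    rw [← hT] at hx
    induction hx using Submodule.span_induction with
    | mem t ht => exact hk t (hTS t ht) n (le_trans (Finset.le_sup ht) hn) u hu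
    | zero => simp
    | add a b _ _ h1 h2 => rw [mul_add]; exact J.add_mem h1 h2
    | smul c a _ h1 => rw [smul_eq_mul, mul_left_comm]; exact J.mul_mem_left _ h1
  let D := T.sup totalDegree
  refine ⟨T.sup k + D, fun n hn f hf hfS => ?_⟩
  have claim : ∀ g ∈ Sat J, homogeneousComponent n g ∈ J := by
    intro g hg
    rw [← hT] at hg
    obtain ⟨c, rfl⟩ := Submodule.mem_span_finset'.1 hg
    rw [map_sum]
    refine Submodule.sum_mem _ fun t _ => ?_
    have ht := t.2
    rw [smul_eq_mul]
    have e1 : homogeneousComponent n (c t * (t : PS K r)) = ∑ i ∈ Finset.range ((t : PS K r).totalDegree + 1),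
        homogeneousComponent n (c t * homogeneousComponent i (t : PS K r)) := by
      conv_lhs => rw [← sum_homogeneousComponent (t : PS K r), Finset.mul_sum, map_sum]
    rw [e1]
    refine Submodule.sum_mem _ fun i hi => ?_
    have hiD : i ≤ D := by
      have h1 : (t : PS K r).totalDegree ≤ D := Finset.le_sup (f := totalDegree) ht
      have := Finset.mem_range.1 hi
      omega
    obtain ⟨m, rfl⟩ : ∃ m, n = i + m := ⟨n - i, by omega⟩
    rw [mul_comm, hc_mul_gen (homogeneousComponent_isHomogeneous i _), mul_comm]
    exact huni _ (Sat_hom hJ _ (hTS t ht) i) m (by omega) _ (homogeneousComponent_isHomogeneous m _)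
  have := claim f hfS
  rwa [homogeneousComponent_of_mem hf, if_pos rfl] at this

theorem exists_y0 [Infinite K] {J : Ideal (PS K r)} (hJ : AMD.IsHomIdeal K r J) :
    ∃ b : PS K r, b.IsHomogeneous 1 ∧ ∃ n1, ∀ n ≥ n1, ∀ f ∈ Sh K r n, b * f ∈ J → f ∈ J := by
  classical
  obtain ⟨b, hb, hbr⟩ := exists_reg {Sat J} (by simpa using Sat_NS J)
  obtain ⟨n1, h1⟩ := Sat_large hJ
  refine ⟨b, hb, n1, fun n hn f hf h => h1 n hn f hf (hbr (Sat J) (by simp) f ?_)⟩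
  exact mem_Sat.2 ⟨0, fun n _ u _ => J.mul_mem_left _ h⟩

/-- freeness over the regular sequence -/
theorem freeness {ι : Type} [Fintype ι] (ρ : ι → PS K r) : ∀ (rs : List (PS K r)) (J : Ideal (PS K r)), RL J rs →
    (∀ c : ι → K, ∑ i, C (c i) * ρ i ∈ En J rs → ∀ i, c i = 0) →
    ∀ c : ι → MvPolynomial (Fin rs.length) K,
      ∑ i, aeval (fun j : Fin rs.length => rs.get j) (c i) * ρ i ∈ J → ∀ i, c i = 0
  | [], J, _, h, c, hc => by
    intro i
    have e : ∀ i, c i = C (coeff 0 (c i)) := fun i => eq_C_of_isEmpty (σ := Fin 0) (c i)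
    rw [e i, h (fun i => coeff 0 (c i)) ?_ i, map_zero]
    have e2 : ∑ i, C (coeff 0 (c i)) * ρ i =
        ∑ i, aeval (fun j : Fin ([] : List (PS K r)).length => ([] : List (PS K r)).get j) (c i) * ρ i := by
      refine Finset.sum_congr rfl fun i _ => ?_
      congr 1
      conv_rhs => rw [e i]
      exact (aeval_C _ _).symm
    rw [e2]; exact hc
  | a :: rs, J, hR, h, c, hc => by
    have ih := freeness ρ rs _ hR.2 h
    let y : Fin rs.length → PS K r := fun j => rs.get j
    have hev : ∀ p : MvPolynomial (Fin (rs.length + 1)) K,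
        aeval (fun j : Fin (rs.length + 1) => (a :: rs).get j) p =
        (finSuccEquiv K rs.length p).eval₂ ((aeval y : MvPolynomial (Fin rs.length) K →ₐ[K] PS K r) : MvPolynomial (Fin rs.length) K →+* PS K r) a := by
      intro p
      induction p using MvPolynomial.induction_on with
      | C c => simp [finSuccEquiv_apply]
      | add p q hp hq => rw [map_add, map_add, Polynomial.eval₂_add, hp, hq]
      | mul_X p i hp =>
        rw [map_mul, map_mul, Polynomial.eval₂_mul, hp]
        congr 1
        refine Fin.cases ?_ (fun i => ?_) i
        · simp [finSuccEquiv_X_zero]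
        · simp [finSuccEquiv_X_succ, y]
    have main : ∀ (N : ℕ) (p : ι → Polynomial (MvPolynomial (Fin rs.length) K)),
        (∀ i, (p i).natDegree < N) →
        ∑ i, (p i).eval₂ ((aeval y : MvPolynomial (Fin rs.length) K →ₐ[K] PS K r) : MvPolynomial (Fin rs.length) K →+* PS K r) a * ρ i ∈ J →
        ∀ i, p i = 0 := by
      intro N
      induction N with
      | zero => intro p hp; intro _ i; exact absurd (hp i) (by omega)
      | succ N ihN =>
        intro p hp hs
        set φ := ((aeval y : MvPolynomial (Fin rs.length) K →ₐ[K] PS K r) : MvPolynomial (Fin rs.length) K →+* PS K r) with hφ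
        have hdec : ∀ i, (p i).eval₂ φ a = a * (p i).divX.eval₂ φ a + φ ((p i).coeff 0) := by
          intro i
          conv_lhs => rw [← Polynomial.divX_mul_X_add (p i)]
          rw [Polynomial.eval₂_add, Polynomial.eval₂_mul, Polynomial.eval₂_X, Polynomial.eval₂_C, mul_comm]
        have hsum : ∑ i, (p i).eval₂ φ a * ρ i =
            a * (∑ i, (p i).divX.eval₂ φ a * ρ i) + ∑ i, φ ((p i).coeff 0) * ρ i := by
          rw [Finset.mul_sum, ← Finset.sum_add_distrib]
          refine Finset.sum_congr rfl fun i _ => ?_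
          rw [hdec]; ring
        have h0 : ∀ i, (p i).coeff 0 = 0 := by
          refine ih (fun i => (p i).coeff 0) ?_
          refine mem_sup_single.2 ⟨-(∑ i, (p i).divX.eval₂ φ a * ρ i), ?_⟩
          rw [hsum] at hs
          convert hs using 1
          simp only [hφ, y, RingHom.coe_coe]
          ring
        have h1 : ∀ i, (p i).divX = 0 := by
          intro i
          by_cases hN : N = 0
          · have := hp i
            have h2 : (p i).natDegree = 0 := by omega
            rw [Polynomial.eq_C_of_natDegree_eq_zero h2, Polynomial.divX_C]
          · refine ihN (fun i => (p i).divX) (fun i => ?_) (hR.1 _ ?_) i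
            · have := hp i
              rw [Polynomial.natDegree_divX_eq_natDegree_tsub_one]; omega
            · rw [hsum] at hs
              simpa [h0] using hs
        intro i
        rw [← Polynomial.divX_mul_X_add (p i), h0, h1]; simp
    intro i
    have := main (Finset.univ.sup (fun i => (finSuccEquiv K rs.length (c i)).natDegree) + 1)
      (fun i => finSuccEquiv K rs.length (c i))
      (fun i => Nat.lt_succ_of_le (Finset.le_sup (f := fun i => (finSuccEquiv K rs.length (c i)).natDegree) (Finset.mem_univ i)))
      (by simp only [← hev]; exact hc) i
    exact (finSuccEquiv K rs.length).injective (by rw [this, map_zero])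

end sat
end AMDP

open MvPolynomial
set_option linter.unusedSectionVars false
set_option linter.unusedSimpArgs false
namespace AMDP

section mkfil
variable {K : Type} [Field K] {r : ℕ}

theorem irr_deg_zero {f : PS K r} (h : f ∈ irr K r) (h0 : f ∈ Sh K r 0) : f = 0 := by
  have hx2 : homogeneousComponent 0 f = f := by
    rw [homogeneousComponent_of_mem h0]; simp
  rw [homogeneousComponent_zero] at hx2
  have : coeff 0 f = 0 := by
    unfold irr at h
    have hle : Ideal.span (Set.range (X : Fin (r+1) → PS K r)) ≤ RingHom.ker (constantCoeff (R := K) (σ := Fin (r+1))) := by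
      rw [Ideal.span_le]; rintro _ ⟨i, rfl⟩; simp
    simpa [RingHom.mem_ker, constantCoeff_eq] using hle h
  rw [this] at hx2
  simpa using hx2.symm

/-- independence modulo `J` -/
def IndMod (J : Ideal (PS K r)) {ι : Type} [Fintype ι] (ρ : ι → PS K r) : Prop :=
  ∀ c : ι → K, ∑ i, C (c i) * ρ i ∈ J → ∀ i, c i = 0

theorem exists_lift (J : Ideal (PS K r)) (n : ℕ) : ∃ ρ : Fin (q J n) → PS K r, (∀ i, ρ i ∈ Sh K r n) ∧
    IndMod J ρ ∧ ∀ f ∈ Sh K r n, ∃ c : Fin (q J n) → K, f - ∑ i, C (c i) * ρ i ∈ J := by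
  have : Module.Finite K (AMD.quotComponent K r J n) := by unfold AMD.quotComponent; infer_instance
  let b : Module.Basis (Fin (q J n)) K (AMD.quotComponent K r J n) := Module.finBasis K _
  choose ρ hρ hρ' using fun i => (b i).2
  have key : ∀ c : Fin (q J n) → K, Ideal.Quotient.mk J (∑ i, C (c i) * ρ i) =
      ((∑ i, c i • b i : AMD.quotComponent K r J n) : PS K r ⧸ J) := by
    intro c
    rw [map_sum]
    simp only [Submodule.coe_sum, Submodule.coe_smul]
    refine Finset.sum_congr rfl fun i _ => ?_
    rw [← hρ' i, ← smul_eq_C_mul]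
    rfl
  refine ⟨ρ, hρ, fun c hc => ?_, fun f hf => ?_⟩
  · have h1 := (Ideal.Quotient.eq_zero_iff_mem).2 hc
    rw [key] at h1
    have h2 : ∑ i, c i • b i = 0 := Subtype.ext h1
    exact Fintype.linearIndependent_iff.1 b.linearIndependent c h2
  · let x : AMD.quotComponent K r J n := ⟨Ideal.Quotient.mk J f, ⟨f, hf, rfl⟩⟩
    refine ⟨fun i => b.repr x i, ?_⟩
    rw [← Ideal.Quotient.eq_zero_iff_mem, map_sub, key, b.sum_repr]
    exact sub_self _

theorem indMod_graded {J : Ideal (PS K r)} (hJ : AMD.IsHomIdeal K r J) {ι : Type} [Fintype ι] (ρ : ι → PS K r)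
    (e : ι → ℕ) (hρ : ∀ i, ρ i ∈ Sh K r (e i))
    (h : ∀ j, ∀ c : ι → K, (∀ i, e i ≠ j → c i = 0) → ∑ i, C (c i) * ρ i ∈ J → ∀ i, c i = 0) :
    IndMod J ρ := by
  classical
  intro c hc i
  have h1 := hJ _ hc (e i)
  rw [map_sum] at h1
  have := h (e i) (fun i' => if e i' = e i then c i' else 0) (by intro i' h'; simp [h']) ?_ i
  · simpa using this
  · convert h1 using 2 with i'
    rw [homogeneousComponent_C_mul, homogeneousComponent_of_mem (hρ i')]
    by_cases h2 : e i' = e i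
    · simp [h2]
    · rw [if_neg h2, if_neg (by tauto)]; simp

variable {F : Type} [Field F] [Algebra K F]

abbrev LL (ev : PS K r →ₐ[K] F) (rs : List (PS K r)) : IntermediateField K F :=
  IntermediateField.adjoin K (Set.range fun j : Fin rs.length => ev (rs.get j))

theorem ev_mem_LL (ev : PS K r →ₐ[K] F) (rs : List (PS K r)) {a : PS K r} (ha : a ∈ rs) : ev a ∈ LL ev rs := by
  obtain ⟨i, rfl⟩ := List.mem_iff_get.1 ha
  exact IntermediateField.subset_adjoin K _ ⟨i, rfl⟩

open scoped IntermediateField.algebraAdjoinAdjoin in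
theorem li_LL (I : Ideal (PS K r)) (ev : PS K r →ₐ[K] F) (hev : ∀ f, ev f = 0 ↔ f ∈ I)
    (rs : List (PS K r)) (hR : RL I rs) {ι : Type} [Fintype ι] (ρ : ι → PS K r) (hρ : IndMod (En I rs) ρ) :
    LinearIndependent (LL ev rs) (fun i => ev (ρ i)) := by
  rw [← LinearIndependent.iff_fractionRing
    (R := Algebra.adjoin K (Set.range fun j : Fin rs.length => ev (rs.get j))) (K := LL ev rs)]
  rw [Fintype.linearIndependent_iff]
  intro g hg
  have h1 : ∀ i, ∃ p : MvPolynomial (Fin rs.length) K, aeval (fun j : Fin rs.length => ev (rs.get j)) p = (g i : F) := by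
    intro i
    have h2 : ∀ x : F, x ∈ Algebra.adjoin K (Set.range fun j : Fin rs.length => ev (rs.get j)) →
        ∃ p : MvPolynomial (Fin rs.length) K, aeval (fun j : Fin rs.length => ev (rs.get j)) p = x := by
      intro x hx
      rw [Algebra.adjoin_range_eq_range_aeval] at hx
      exact hx
    exact h2 _ (g i).2
  choose p hp using h1
  have hp2 : ∀ i, ev (aeval (fun j : Fin rs.length => rs.get j) (p i)) = g i := by
    intro i
    rw [← hp, ← AlgHom.comp_apply, comp_aeval]
  have h0 := freeness ρ rs I hR hρ p ?_
  · intro i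
    apply Subtype.ext
    rw [← hp, h0 i]; simp
  · rw [← hev, map_sum, ← hg]
    refine Finset.sum_congr rfl fun i _ => ?_
    rw [map_mul, hp2]; rfl

def MM (ev : PS K r →ₐ[K] F) (rs : List (PS K r)) (n : ℕ) : Submodule (LL ev rs) F :=
  Submodule.span (LL ev rs) (ev '' (Sh K r n : Set (PS K r)))

variable {ev : PS K r →ₐ[K] F} {rs : List (PS K r)}

theorem ev_mem_MM {n : ℕ} {f : PS K r} (hf : f ∈ Sh K r n) : ev f ∈ MM ev rs n :=
  Submodule.subset_span ⟨f, hf, rfl⟩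

theorem LL_mul_mem {N : Submodule (LL ev rs) F} {a x : F} (ha : a ∈ LL ev rs) (hx : x ∈ N) : a * x ∈ N :=
  N.smul_mem (⟨a, ha⟩ : LL ev rs) hx

theorem En_mem (N : Submodule (LL ev rs) F) (m : ℕ) : ∀ (l : List (PS K r)) (J : Ideal (PS K r)),
    AMD.IsHomIdeal K r J → (∀ x ∈ l, x.IsHomogeneous 1) →
    (∀ a ∈ l, ∀ g ∈ Sh K r m, ev (a * g) ∈ N) → (∀ z ∈ J, z ∈ Sh K r (m+1) → ev z ∈ N) →
    ∀ x ∈ En J l, x ∈ Sh K r (m+1) → ev x ∈ N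
  | [], J, _, _, _, h => h
  | a :: l, J, hJ, hl, h1, h2 => by
    have ha := hl a (by simp)
    refine En_mem N m l (J ⊔ Ideal.span {a}) (hom_sup hJ ha) (fun x hx => hl x (by simp [hx]))
      (fun x hx => h1 x (by simp [hx])) ?_
    intro z hz hz1
    have : z ∈ (J ⊔ Ideal.span {a}).restrictScalars K ⊓ Sh K r (m+1) := ⟨hz, hz1⟩
    rw [sup_deg hJ ha] at this
    obtain ⟨u, hu, v, ⟨w, hw, rfl⟩, rfl⟩ := Submodule.mem_sup.1 this
    rw [map_add]
    exact N.add_mem (h2 u hu.1 hu.2) (h1 a (by simp) w hw)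

theorem En_mem_MM {I : Ideal (PS K r)} (hI : AMD.IsHomIdeal K r I) (hev : ∀ f, ev f = 0 ↔ f ∈ I)
    (hrs : ∀ x ∈ rs, x.IsHomogeneous 1) {m : ℕ} {x : PS K r} (hx : x ∈ En I rs) (hx1 : x ∈ Sh K r (m+1)) :
    ev x ∈ MM ev rs m := by
  refine En_mem (MM ev rs m) m rs I hI hrs (fun a ha g hg => ?_) (fun z hz _ => ?_) x hx hx1
  · rw [map_mul]; exact LL_mul_mem (ev_mem_LL ev rs ha) (ev_mem_MM hg)
  · rw [(hev z).2 hz]; exact Submodule.zero_mem _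

theorem MM_succ (n : ℕ) : MM ev rs (n+1) = MM ev rs 1 * MM ev rs n := by
  unfold MM
  rw [Submodule.span_mul_span]
  apply le_antisymm
  · rw [Submodule.span_le]
    rintro _ ⟨f, hf, rfl⟩
    have hf : f ∈ homogeneousSubmodule (Fin (r+1)) K (n+1) := hf
    rw [← homogeneousSubmodule_one_pow, pow_succ', homogeneousSubmodule_one_pow] at hf
    refine Submodule.mul_induction_on hf (fun a ha b hb => ?_) (fun a b ha hb => ?_)
    · exact Submodule.subset_span ⟨_, ⟨a, ha, rfl⟩, _, ⟨b, hb, rfl⟩, (map_mul ev a b).symm⟩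
    · rw [map_add]; exact Submodule.add_mem _ ha hb
  · rw [Submodule.span_le]
    rintro _ ⟨_, ⟨a, ha, rfl⟩, _, ⟨b, hb, rfl⟩, rfl⟩
    exact Submodule.subset_span ⟨a * b, lin_mul_mem ha hb, map_mul ev a b⟩

theorem MM_mul {i j : ℕ} {x y : F} (hx : x ∈ MM ev rs i) (hy : y ∈ MM ev rs j) : x * y ∈ MM ev rs (i + j) := by
  have : x * y ∈ MM ev rs i * MM ev rs j := Submodule.mul_mem_mul hx hy
  unfold MM at this ⊢
  rw [Submodule.span_mul_span] at this
  refine Submodule.span_mono ?_ this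
  rintro _ ⟨_, ⟨a, ha, rfl⟩, _, ⟨b, hb, rfl⟩, rfl⟩
  exact ⟨a * b, IsHomogeneous.mul ha hb, map_mul ev a b⟩

theorem MM_le_succ {a : PS K r} (ha : a ∈ rs) (ha1 : a.IsHomogeneous 1) (ha0 : ev a ≠ 0) (n : ℕ) :
    MM ev rs n ≤ MM ev rs (n+1) := by
  unfold MM
  rw [Submodule.span_le]
  rintro _ ⟨f, hf, rfl⟩
  have h1 : ev (a * f) ∈ MM ev rs (n+1) := ev_mem_MM (lin_mul_mem ha1 hf)
  have h2 := LL_mul_mem ((LL ev rs).inv_mem (ev_mem_LL ev rs ha)) h1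
  rw [map_mul, inv_mul_cancel_left₀ ha0] at h2
  exact h2

end mkfil
end AMDP

open MvPolynomial
set_option linter.unusedSectionVars false
set_option linter.unusedSimpArgs false
namespace AMDP

section mkfil
variable {K : Type} [Field K] {r : ℕ} {F : Type} [Field F] [Algebra K F]

structure SU (I : Ideal (PS K r)) (ev : PS K r →ₐ[K] F) (rs : List (PS K r)) : Prop where
  hom : AMD.IsHomIdeal K r I
  irr : I ≤ irr K r
  hev : ∀ f, ev f = 0 ↔ f ∈ I
  lin : ∀ x ∈ rs, x.IsHomogeneous 1
  RL : RL I rs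
  ne : ∃ a ∈ rs, ev a ≠ 0

variable {I : Ideal (PS K r)} {ev : PS K r →ₐ[K] F} {rs : List (PS K r)}

namespace SU

theorem homJ (h : SU I ev rs) : AMD.IsHomIdeal K r (En I rs) := En_hom rs I h.hom h.lin
theorem irrJ (h : SU I ev rs) : En I rs ≤ AMDP.irr K r := En_irr rs I h.irr h.lin

theorem mono (h : SU I ev rs) : Monotone (MM ev rs) := by
  obtain ⟨a, ha, ha0⟩ := h.ne
  exact monotone_nat_of_le_succ (MM_le_succ ha (h.lin a ha) ha0)

theorem sigmaInd {J : Ideal (PS K r)} (hJ : AMD.IsHomIdeal K r J)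
    (ρ : ∀ n, Fin (q J n) → PS K r) (h1 : ∀ n i, ρ n i ∈ Sh K r n) (h2 : ∀ n, IndMod J (ρ n)) (n : ℕ) :
    IndMod J (fun i : (Σ j : Fin (n+1), Fin (q J j)) => ρ i.1 i.2) := by
  classical
  refine indMod_graded hJ _ (fun i => i.1) (fun i => h1 _ _) ?_
  rintro j c hc hs ⟨j', k⟩
  by_cases hj : (j' : ℕ) = j
  · refine h2 j' (fun k => c ⟨j', k⟩) ?_ k
    convert hs using 1
    rw [Fintype.sum_sigma, Finset.sum_eq_single j']
    · intro b _ hb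
      refine Finset.sum_eq_zero fun k _ => ?_
      rw [hc ⟨b, k⟩ (by
        intro h'
        exact hb (Fin.ext (by simpa using h'.trans hj.symm)))]
      simp
    · simp
  · exact hc _ hj

theorem mem_B (h : SU I ev rs) (ρ : ∀ n, Fin (q (En I rs) n) → PS K r)
    (h3 : ∀ n, ∀ f ∈ Sh K r n, ∃ c : Fin (q (En I rs) n) → K, f - ∑ i, C (c i) * ρ n i ∈ En I rs)
    (h1 : ∀ n i, ρ n i ∈ Sh K r n) (n : ℕ) : MM ev rs n =
      Submodule.span (LL ev rs) (Set.range fun i : (Σ j : Fin (n+1), Fin (q (En I rs) j)) => ev (ρ i.1 i.2)) := by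
  let B : ℕ → Submodule (LL ev rs) F := fun n =>
    Submodule.span (LL ev rs) (Set.range fun i : (Σ j : Fin (n+1), Fin (q (En I rs) j)) => ev (ρ i.1 i.2))
  have hB : ∀ n, ∀ j ≤ n, ∀ k, ev (ρ j k) ∈ B n := fun n j hj k =>
    Submodule.subset_span ⟨⟨⟨j, Nat.lt_succ_of_le hj⟩, k⟩, rfl⟩
  have hBm : ∀ n, B n ≤ B (n+1) := by
    intro n
    simp only [B]
    rw [Submodule.span_le]
    rintro _ ⟨⟨j, k⟩, rfl⟩
    exact hB (n+1) j (by omega) k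
  have hsum : ∀ n, ∀ c : Fin (q (En I rs) n) → K, ev (∑ i, C (c i) * ρ n i) ∈ B n := by
    intro n c
    rw [map_sum]
    refine Submodule.sum_mem _ fun i _ => ?_
    rw [map_mul]
    refine LL_mul_mem ?_ (hB n n le_rfl i)
    have : ev (C (c i)) = algebraMap K F (c i) := ev.commutes (c i)
    rw [this]
    exact (LL ev rs).algebraMap_mem _
  have hle : ∀ n, MM ev rs n ≤ B n := by
    intro n
    induction n with
    | zero =>
      unfold MM
      rw [Submodule.span_le]
      rintro _ ⟨f, hf, rfl⟩
      obtain ⟨c, hc⟩ := h3 0 f hf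
      have h0 := irr_deg_zero (h.irrJ hc) (Submodule.sub_mem _ hf
        (Submodule.sum_mem _ fun i _ => by rw [← smul_eq_C_mul]; exact Submodule.smul_mem _ _ (h1 0 i)))
      rw [sub_eq_zero] at h0
      rw [h0]
      exact hsum 0 c
    | succ n ih =>
      unfold MM
      rw [Submodule.span_le]
      rintro _ ⟨f, hf, rfl⟩
      obtain ⟨c, hc⟩ := h3 (n+1) f hf
      have h0 := En_mem_MM h.hom h.hev h.lin hc (Submodule.sub_mem _ hf
        (Submodule.sum_mem _ fun i _ => by rw [← smul_eq_C_mul]; exact Submodule.smul_mem _ _ (h1 (n+1) i)))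
      have h4 := (B (n+1)).add_mem (hBm n (ih h0)) (hsum (n+1) c)
      rw [← map_add, sub_add_cancel] at h4
      exact h4
  apply le_antisymm (hle n)
  rw [Submodule.span_le]
  rintro _ ⟨⟨j, k⟩, rfl⟩
  exact h.mono (Nat.le_of_lt_succ j.2) (ev_mem_MM (h1 j k))

theorem finrank_MM (h : SU I ev rs) (n : ℕ) : Module.Finite (LL ev rs) (MM ev rs n) ∧
    Module.finrank (LL ev rs) (MM ev rs n) = ∑ j ∈ Finset.range (n+1), q (En I rs) j := by
  choose ρ h1 h2 h3 using exists_lift (En I rs)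
  have hli := li_LL I ev h.hev rs h.RL _ (sigmaInd h.homJ ρ h1 h2 n)
  rw [h.mem_B ρ h3 h1 n]
  refine ⟨Module.Finite.span_of_finite _ (Set.finite_range _), ?_⟩
  rw [finrank_span_eq_card hli, Fintype.card_sigma]
  simp only [Fintype.card_fin]
  rw [Finset.sum_range]

theorem notMem_MM (h : SU I ev rs) (n : ℕ) {f : PS K r} (hf : f ∈ Sh K r (n+1)) (hfJ : f ∉ En I rs) :
    ev f ∉ MM ev rs n := by
  choose ρ h1 h2 h3 using exists_lift (En I rs)
  let ρ' : Option (Σ j : Fin (n+1), Fin (q (En I rs) j)) → PS K r :=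
    fun o => o.elim f (fun i => ρ i.1 i.2)
  have hind : IndMod (En I rs) ρ' := by
    refine indMod_graded h.homJ ρ' (fun o => o.elim (n+1) (fun i => i.1)) ?_ ?_
    · rintro (_ | i)
      · exact hf
      · exact h1 _ _
    · intro j c hc hs
      rw [Fintype.sum_option] at hs
      have hn : c none = 0 := by
        by_cases hj : n + 1 = j
        · by_contra h0
          have hz : ∀ i, c (some i) = 0 := fun i => hc (some i) (by
            have := i.1.2
            show (i.1 : ℕ) ≠ j
            omega)
          simp only [hz, map_zero, zero_mul, Finset.sum_const_zero, add_zero] at hs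
          apply hfJ
          have := (En I rs).mul_mem_left (C (c none)⁻¹) hs
          rwa [← mul_assoc, ← C_mul, inv_mul_cancel₀ h0, C_1, one_mul] at this
        · exact hc none hj
      rintro (_ | i)
      · exact hn
      · refine sigmaInd h.homJ ρ h1 h2 n (fun i => c (some i)) ?_ i
        rw [hn] at hs
        simpa [ρ'] using hs
  have hli := li_LL I ev h.hev rs h.RL _ hind
  rw [linearIndependent_option] at hli
  rw [h.mem_B ρ h3 h1 n]
  exact hli.2

theorem finite_MM (h : SU I ev rs) (n : ℕ) : Module.Finite (LL ev rs) (MM ev rs n) := (h.finrank_MM n).1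

/-- the filtered algebra -/
def fil (h : SU I ev rs) (y0 : PS K r) (hy0 : y0.IsHomogeneous 1) (n1 : ℕ)
    (hreg : ∀ n ≥ n1, ∀ f ∈ Sh K r n, y0 * f ∈ En I rs → f ∈ En I rs)
    (h5 : ∀ n ≥ n1, q (En I rs) n = 5) (hy00 : y0 ≠ 0) : Fil (LL ev rs) F where
  M := MM ev rs
  fin := h.finite_MM
  mono := h.mono
  one := by
    have : (1 : PS K r) ∈ Sh K r 0 := isHomogeneous_one _ _
    simpa using ev_mem_MM (ev := ev) (rs := rs) this
  mul := MM_mul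
  s := ev y0
  hs := ev_mem_MM hy0
  n1 := n1
  surj := by
    intro n hn x hx
    have hq := q_rec h.homJ hy0 hy00 n (hreg n hn)
    rw [h5 n hn, h5 (n+1) (by omega)] at hq
    have hq0 : q (En I rs ⊔ Ideal.span {y0}) (n+1) = 0 := by omega
    have hadd := q_add (En I rs ⊔ Ideal.span {y0}) (n+1)
    rw [hq0, zero_add] at hadd
    have heq := Submodule.eq_of_le_of_finrank_eq inf_le_right hadd
    rw [sup_deg h.homJ hy0] at heq
    unfold MM at hx
    induction hx using Submodule.span_induction with
    | mem x hx =>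
      obtain ⟨f, hf, rfl⟩ := hx
      have hf : f ∈ Sh K r (n+1) := hf
      rw [← heq] at hf
      obtain ⟨u, hu, v, ⟨w, hw, rfl⟩, rfl⟩ := Submodule.mem_sup.1 hf
      exact ⟨ev u, En_mem_MM h.hom h.hev h.lin hu.1 hu.2, ev w, ev_mem_MM hw, by
        rw [map_add, LinearMap.mulLeft_apply, map_mul]⟩
    | zero => exact ⟨0, Submodule.zero_mem _, 0, Submodule.zero_mem _, by simp⟩
    | add x y _ _ hx hy =>
      obtain ⟨a, ha, b, hb, rfl⟩ := hx
      obtain ⟨a', ha', b', hb', rfl⟩ := hy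
      exact ⟨a + a', Submodule.add_mem _ ha ha', b + b', Submodule.add_mem _ hb hb', by ring⟩
    | smul c x _ hx =>
      obtain ⟨a, ha, b, hb, rfl⟩ := hx
      exact ⟨c • a, Submodule.smul_mem _ _ ha, c • b, Submodule.smul_mem _ _ hb, by
        rw [smul_add, mul_smul_comm]⟩
  dim5 := by
    intro n hn
    rw [(h.finrank_MM n).2, (h.finrank_MM (n+1)).2, Finset.sum_range_succ _ (n+1), h5 (n+1) (by omega)]

theorem tau (h : SU I ev rs) (y0 : PS K r) (hy0 : y0.IsHomogeneous 1) (n1 : ℕ)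
    (hreg : ∀ n ≥ n1, ∀ f ∈ Sh K r n, y0 * f ∈ En I rs → f ∈ En I rs)
    (h5 : ∀ n ≥ n1, q (En I rs) n = 5) (hnreg : ¬ Reg (En I rs) y0) :
    ∃ n g, g ∈ MM ev rs (n + 1) ∧ g ∉ MM ev rs n ∧ ev y0 * g ∈ MM ev rs (n + 1) := by
  unfold Reg at hnreg
  push Not at hnreg
  obtain ⟨f, hf, hfJ⟩ := hnreg
  obtain ⟨m, hm⟩ : ∃ m, homogeneousComponent m f ∉ En I rs := by
    by_contra hcon
    push Not at hcon
    apply hfJ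
    rw [← sum_homogeneousComponent f]
    exact Submodule.sum_mem _ fun i _ => hcon i
  have h1 : y0 * homogeneousComponent m f ∈ En I rs := by
    have := h.homJ _ hf (m+1)
    rwa [mul_comm, hc_mul hy0, mul_comm] at this
  cases m with
  | zero =>
    exfalso
    rw [homogeneousComponent_zero] at h1 hm
    have hc : coeff 0 f ≠ 0 := by
      intro h0; apply hm; rw [h0]; simp
    have hy : y0 ∈ En I rs := by
      have := (En I rs).mul_mem_left (C (coeff 0 f)⁻¹) h1
      rwa [mul_left_comm, ← C_mul, inv_mul_cancel₀ hc, C_1, mul_one] at this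
    have hall : Sh K r n1 ≤ (En I rs).restrictScalars K := fun g hg =>
      hreg n1 le_rfl g hg ((En I rs).mul_mem_right _ hy)
    have h2 := q_add (En I rs) n1
    rw [inf_eq_right.2 hall, h5 n1 le_rfl] at h2
    omega
  | succ m =>
    refine ⟨m, ev (homogeneousComponent (m+1) f), ev_mem_MM (homogeneousComponent_isHomogeneous _ _),
      h.notMem_MM m (homogeneousComponent_isHomogeneous _ _) hm, ?_⟩
    rw [← map_mul]
    exact En_mem_MM h.hom h.hev h.lin h1 (lin_mul_mem hy0 (homogeneousComponent_isHomogeneous _ _))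

end SU
end mkfil
end AMDP

open MvPolynomial
set_option linter.unusedSectionVars false
set_option linter.unusedSimpArgs false
namespace AMDP

section cone
variable {K : Type} [Field K] {r : ℕ} {F : Type} [Field F] [Algebra K F]
variable {E : Type} [Field E] [Algebra K E] [Algebra E F] [IsScalarTower K E F]

theorem mem_K_of_bound [IsAlgClosed K] (α : E) (V : Submodule K E) [Module.Finite K V]
    (hV : Module.finrank K V ≤ 5) (h : ∀ k ≤ 5, α ^ k ∈ V) : ∃ a : K, algebraMap K E a = α := by
  have halg : IsAlgebraic K α := by
    let v : Fin 6 → V := fun k => ⟨α ^ (k : ℕ), h k (by omega)⟩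
    have hv : ¬ LinearIndependent K v := by
      intro hli
      have := hli.fintype_card_le_finrank
      simp at this
      omega
    rw [Fintype.not_linearIndependent_iff] at hv
    obtain ⟨g, hg, i, hi⟩ := hv
    refine ⟨∑ k : Fin 6, Polynomial.monomial (k : ℕ) (g k), ?_, ?_⟩
    · intro h0
      apply hi
      have := congrArg (fun p => Polynomial.coeff p (i : ℕ)) h0
      simpa [Polynomial.finsetSum_coeff, Polynomial.coeff_monomial, Fin.val_inj] using this
    · have := congrArg (Subtype.val) hg
      rw [map_sum]
      simpa [v, Polynomial.aeval_monomial, Algebra.smul_def] using this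
  have hIntg := halg.isIntegral
  have := IsAlgClosed.degree_eq_one_of_irreducible K (minpoly.irreducible hIntg)
  exact minpoly.mem_range_of_degree_eq_one K α this

/-- the polynomial lift -/
def PhiP (α β : Fin (r+1) → E) : PS K r →ₐ[K] Polynomial E :=
  aeval (fun i => Polynomial.C (α i) * Polynomial.X + Polynomial.C (β i))

theorem PhiP_ev (ev : PS K r →ₐ[K] F) (s : F) (α β : Fin (r+1) → E)
    (hX : ∀ i, ev (X i) = algebraMap E F (α i) * s + algebraMap E F (β i)) (f : PS K r) :
    Polynomial.aeval s (PhiP α β f) = ev f := by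
  have : ((Polynomial.aeval (R := E) s).restrictScalars K).comp (PhiP α β) = ev := by
    apply MvPolynomial.algHom_ext
    intro i
    simp [PhiP, hX]
  exact DFunLike.congr_fun this f

theorem PhiP_coeff (α β : Fin (r+1) → E) {n : ℕ} {f : PS K r} (hf : f ∈ Sh K r n) :
    (PhiP α β f).natDegree ≤ n ∧ (PhiP α β f).coeff n = aeval α f := by
  have hlin : ∀ l ∈ Sh K r 1, (PhiP α β l).natDegree ≤ 1 ∧ (PhiP α β l).coeff 1 = aeval α l := by
    intro l hl
    unfold Sh at hl
    rw [homogeneousSubmodule_one_eq_span_X] at hl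
    induction hl using Submodule.span_induction with
    | mem x hx =>
      obtain ⟨i, rfl⟩ := hx
      simp only [PhiP, aeval_X]
      exact ⟨Polynomial.natDegree_linear_le, by simp⟩
    | zero => simp
    | add a b _ _ ha hb =>
      rw [map_add, map_add, Polynomial.coeff_add, ha.2, hb.2]
      exact ⟨Polynomial.natDegree_add_le_of_degree_le ha.1 hb.1, rfl⟩
    | smul c a _ ha =>
      rw [map_smul, map_smul, Polynomial.coeff_smul, ha.2]
      exact ⟨(Polynomial.natDegree_smul_le _ _).trans ha.1, rfl⟩
  induction n generalizing f with
  | zero =>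
    have hf0 : f = C (coeff 0 f) := by
      rw [← homogeneousComponent_zero, homogeneousComponent_of_mem hf]; simp
    rw [hf0]
    have : PhiP α β (C (coeff 0 f)) = Polynomial.C (algebraMap K E (coeff 0 f)) :=
      (PhiP (K := K) α β).commutes _
    rw [this]
    simp
  | succ n ih =>
    unfold Sh at hf
    rw [← homogeneousSubmodule_one_pow, pow_succ, homogeneousSubmodule_one_pow] at hf
    refine Submodule.mul_induction_on hf (fun a ha b hb => ?_) (fun a b ha hb => ?_)
    · obtain ⟨h1, h2⟩ := ih ha
      obtain ⟨h3, h4⟩ := hlin b hb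
      rw [map_mul, map_mul, ← h2, ← h4]
      exact ⟨Polynomial.natDegree_mul_le_of_le h1 h3, Polynomial.coeff_mul_add_eq_of_natDegree_le h1 h3⟩
    · rw [map_add, map_add, Polynomial.coeff_add, ha.2, hb.2]
      exact ⟨Polynomial.natDegree_add_le_of_degree_le ha.1 hb.1, rfl⟩

theorem cone_case [IsAlgClosed K] (I : Ideal (PS K r)) (hI : AMD.IsHomIdeal K r I)
    (ev : PS K r →ₐ[K] F) (hev : ∀ f, ev f = 0 ↔ f ∈ I)
    (y0 : PS K r) (hy0 : y0.IsHomogeneous 1) (hs : Transcendental E (ev y0)) (α β : Fin (r+1) → E)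
    (hX : ∀ i, ev (X i) = algebraMap E F (α i) * ev y0 + algebraMap E F (β i))
    (rs : List (PS K r)) (hrs : ∀ x ∈ rs, x.IsHomogeneous 1) (hrE : ∀ x ∈ rs, ∃ c : E, ev x = algebraMap E F c)
    (n1 : ℕ) (h5 : ∀ n ≥ n1, q (En I rs) n = 5) : AMD.IsConeIdeal K r I := by
  have hinj : ∀ p : Polynomial E, Polynomial.aeval (ev y0) p = 0 → p = 0 := by
    intro p hp
    by_contra h0
    exact hs ⟨p, h0, hp⟩
  have hPhi := PhiP_ev ev (ev y0) α β hX
  have hker : ∀ f, PhiP α β f = 0 ↔ f ∈ I := by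
    intro f
    rw [← hev, ← hPhi]
    exact ⟨fun h => by rw [h, map_zero], hinj _⟩
  let θ : PS K r →ₐ[K] E := aeval α
  have hθI : ∀ f ∈ I, θ f = 0 := by
    intro f hf
    rw [← sum_homogeneousComponent f, map_sum]
    refine Finset.sum_eq_zero fun i _ => ?_
    have h1 := (PhiP_coeff α β (K := K) (homogeneousComponent_isHomogeneous i f)).2
    rw [(hker _).2 (hI f hf i)] at h1
    simpa using h1.symm
  have hPy : PhiP α β y0 = Polynomial.X := by
    rw [← sub_eq_zero]
    apply hinj
    rw [map_sub, hPhi, Polynomial.aeval_X, sub_self]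
  have hθy : θ y0 = 1 := by
    have h1 := (PhiP_coeff α β (K := K) (n := 1) hy0).2
    rw [hPy] at h1
    simpa using h1.symm
  have hθr : ∀ x ∈ rs, θ x = 0 := by
    intro x hx
    obtain ⟨c, hc⟩ := hrE x hx
    have h2 : PhiP α β x = Polynomial.C c := by
      rw [← sub_eq_zero]
      apply hinj
      rw [map_sub, hPhi, Polynomial.aeval_C, hc, sub_self]
    have h1 := (PhiP_coeff α β (K := K) (n := 1) (hrs x hx)).2
    rw [h2] at h1
    simpa using h1.symm
  have hEn : ∀ (l : List (PS K r)) (J : Ideal (PS K r)), (∀ f ∈ J, θ f = 0) → (∀ x ∈ l, θ x = 0) →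
      ∀ f ∈ En J l, θ f = 0 := by
    intro l
    induction l with
    | nil => intro J h _; exact h
    | cons a l ih =>
      intro J h h2
      refine ih (J ⊔ Ideal.span {a}) (fun f hf => ?_) (fun x hx => h2 x (by simp [hx]))
      obtain ⟨c, hc⟩ := mem_sup_single.1 hf
      have := h _ hc
      rw [map_sub, map_mul, h2 a (by simp), zero_mul, sub_zero] at this
      exact this
  have hbound : ∀ n ≥ n1, Module.finrank K ((Sh K r n).map θ.toLinearMap) ≤ 5 := by
    intro n hn
    have h1 := finrank_map_add θ.toLinearMap (Sh K r n)
    have h2 := q_add (En I rs) n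
    rw [h5 n hn] at h2
    have : Module.Finite K ↥(Sh K r n ⊓ LinearMap.ker θ.toLinearMap) := Submodule.finiteDimensional_inf_left _ _
    have h3 : Module.finrank K ↥((En I rs).restrictScalars K ⊓ Sh K r n) ≤
        Module.finrank K ↥(Sh K r n ⊓ LinearMap.ker θ.toLinearMap) := by
      apply Submodule.finrank_mono
      rintro x ⟨hx, hx1⟩
      exact ⟨hx1, hEn rs I hθI hθr x hx⟩
    omega
  have hα : ∀ i, ∃ a : K, algebraMap K E a = α i := by
    intro i
    refine mem_K_of_bound (α i) ((Sh K r (n1 + 5)).map θ.toLinearMap) (hbound _ (by omega)) fun k hk => ?_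
    refine ⟨X i ^ k * y0 ^ (n1 + 5 - k), ?_, ?_⟩
    · have h1 := ((isHomogeneous_X K i).pow k).mul (hy0.pow (n1 + 5 - k))
      have e : 1 * k + 1 * (n1 + 5 - k) = n1 + 5 := by omega
      have h2 := (mem_homogeneousSubmodule _ _).2 h1
      simp only [e] at h2
      exact h2
    · simp only [AlgHom.toLinearMap_apply, map_mul, map_pow, hθy, one_pow, mul_one]
      simp [θ]
  choose a ha using hα
  let H : Submodule K (PS K r) := Sh K r 1 ⊓ LinearMap.ker θ.toLinearMap
  have hHlt : H < Sh K r 1 := by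
    refine lt_of_le_of_ne inf_le_left fun h => ?_
    have : y0 ∈ H := by rw [h]; exact hy0
    have h2 : θ y0 = 0 := this.2
    rw [hθy] at h2
    exact one_ne_zero h2
  refine cone_of_subspace I H hHlt fun f hf => ?_
  let A := Algebra.adjoin K (H : Set (PS K r))
  have hAC : ∀ g ∈ A, ∃ c : E, PhiP α β g = Polynomial.C c := by
    intro g hg
    induction hg using Algebra.adjoin_induction with
    | mem l hl =>
      have h1 := PhiP_coeff α β (K := K) (n := 1) hl.1
      have h2 : (PhiP α β l).coeff 1 = 0 := h1.2.trans hl.2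
      refine ⟨(PhiP α β l).coeff 0, ?_⟩
      conv_lhs => rw [Polynomial.eq_X_add_C_of_natDegree_le_one h1.1, h2]
      simp
    | algebraMap c => exact ⟨algebraMap K E c, (PhiP (K := K) α β).commutes c⟩
    | add x y _ _ hx hy =>
      obtain ⟨c, hc⟩ := hx
      obtain ⟨d, hd⟩ := hy
      exact ⟨c + d, by rw [map_add, hc, hd, map_add]⟩
    | mul x y _ _ hx hy =>
      obtain ⟨c, hc⟩ := hx
      obtain ⟨d, hd⟩ := hy
      exact ⟨c * d, by rw [map_mul, hc, hd, map_mul]⟩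
  have hsurj : ∀ g : PS K r, ∃ G : Polynomial A, Polynomial.aeval y0 G = g := by
    intro g
    induction g using MvPolynomial.induction_on with
    | C c => exact ⟨Polynomial.C (algebraMap K A c), by rw [Polynomial.aeval_C]; rfl⟩
    | add p q hp hq =>
      obtain ⟨P, rfl⟩ := hp
      obtain ⟨Q, rfl⟩ := hq
      exact ⟨P + Q, map_add _ _ _⟩
    | mul_X p i hp =>
      obtain ⟨P, rfl⟩ := hp
      have hl : X i - C (a i) * y0 ∈ H := by
        refine ⟨Submodule.sub_mem _ (isHomogeneous_X K i) ?_, ?_⟩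
        · rw [← smul_eq_C_mul]; exact Submodule.smul_mem _ _ hy0
        · have hC : θ (C (a i)) = algebraMap K E (a i) := θ.commutes (a i)
          show θ (X i - C (a i) * y0) = 0
          rw [map_sub, map_mul, hθy, hC, ha]
          simp [θ]
      refine ⟨P * (Polynomial.C (⟨_, Algebra.subset_adjoin hl⟩ : A) +
        Polynomial.C (algebraMap K A (a i)) * Polynomial.X), ?_⟩
      rw [map_mul, map_add, map_mul, Polynomial.aeval_C, Polynomial.aeval_C, Polynomial.aeval_X]
      congr 1
      show (X i - C (a i) * y0) + C (a i) * y0 = X i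
      ring
  obtain ⟨G, rfl⟩ := hsurj f
  choose c hc using fun k => hAC (G.coeff k) (G.coeff k).2
  have hsum : Polynomial.aeval y0 G = ∑ k ∈ Finset.range (G.natDegree + 1), (G.coeff k : PS K r) * y0 ^ k := by
    rw [Polynomial.aeval_eq_sum_range]
    rfl
  have h0 : ∑ k ∈ Finset.range (G.natDegree + 1), Polynomial.monomial k (c k) = 0 := by
    rw [← (hker _).2 hf, hsum, map_sum]
    refine Finset.sum_congr rfl fun k _ => ?_
    rw [map_mul, map_pow, hc, hPy, Polynomial.C_mul_X_pow_eq_monomial]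
  rw [hsum]
  refine Submodule.sum_mem _ fun k hk => Ideal.mul_mem_right _ _ (Ideal.subset_span ⟨?_, (G.coeff k).2⟩)
  have h1 := congrArg (fun p => Polynomial.coeff p k) h0
  simp only [Polynomial.finsetSum_coeff, Polynomial.coeff_monomial, Finset.sum_ite_eq', hk, if_true,
    Polynomial.coeff_zero] at h1
  show (G.coeff k : PS K r) ∈ I
  rw [← hker, hc, h1, map_zero]

end cone
end AMDP

open MvPolynomial
set_option linter.unusedSectionVars false
set_option linter.unusedSimpArgs false
namespace AMDP

section final
variable {K : Type} [Field K] {r : ℕ} {F : Type} [Field F] [Algebra K F]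

theorem irr_of_pos {n : ℕ} {p : PS K r} (hn : 0 < n) (hp : p.IsHomogeneous n) : p ∈ irr K r := by
  unfold irr
  rw [p.as_sum]
  refine Submodule.sum_mem _ fun m hm => ?_
  have hd : m.degree = n := by
    have := hp (mem_support_iff.1 hm)
    rwa [show (1 : Fin (r+1) → ℕ) = fun _ => 1 from rfl, ← Finsupp.degree_eq_weight_one] at this
  have hm0 : m ≠ 0 := by
    rintro rfl
    simp at hd
    omega
  obtain ⟨i, hi⟩ := Finsupp.ne_iff.1 hm0
  have h1 : (X i : PS K r) ∣ monomial m (coeff m p) := by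
    rw [X_dvd_monomial]
    exact Or.inr hi
  exact Ideal.mem_of_dvd _ h1 (Ideal.subset_span ⟨i, rfl⟩)

theorem le_irr (I : Ideal (PS K r)) (hprime : I.IsPrime) (hhom : AMD.IsHomIdeal K r I) : I ≤ irr K r := by
  intro p hp
  rw [← sum_homogeneousComponent p]
  refine Submodule.sum_mem _ fun n _ => ?_
  rcases Nat.eq_zero_or_pos n with rfl | hn
  · have h0 := hhom p hp 0
    rw [homogeneousComponent_zero] at h0 ⊢
    by_cases hc : coeff 0 p = 0
    · rw [hc]; simp
    · exfalso
      exact hprime.ne_top (Ideal.eq_top_of_isUnit_mem _ h0 ((isUnit_iff_ne_zero.2 hc).map C))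
  · exact irr_of_pos hn (homogeneousComponent_isHomogeneous n p)

theorem finrank_Sh (n : ℕ) : Module.finrank K (Sh K r n) = (r+1).multichoose n := by
  have := finrank_hom (K := K) (ι := Fin (r+1)) n
  rwa [Fintype.card_fin] at this

theorem arith2 {d a : ℕ} (h : (6 + d * 4 + d.multichoose 2) + a = (d+4).multichoose 2) : a = 4 := by
  have h1 := multichoose_two' d
  have h2 := multichoose_two' (d+4)
  nlinarith

theorem arith3 {d a : ℕ} (h : (5 + d * 6 + d.multichoose 2 * 4 + d.multichoose 3) + a = (d+4).multichoose 3) :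
    a + 1 = 4 * (d+4) := by
  have h1 := multichoose_two' d
  have h2 := multichoose_three' (d+4)
  have h3 := multichoose_three' d
  nlinarith

theorem hilb_facts [IsAlgClosed K] (I : Ideal (PS K r)) (hprime : I.IsPrime)
    (hhom : AMD.IsHomIdeal K r I) (hnd : AMD.Nondeg K r I)
    (d : ℕ) (hcodim : d + 3 = r)
    (hdeg : AMD.DegreeEq K r I d 5)
    (hcone : ¬ AMD.IsConeIdeal K r I)
    (hdepth : AMD.DepthEq K r I d)
    (ev : PS K r →ₐ[K] F) (hev : ∀ f, ev f = 0 ↔ f ∈ I) :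
    Module.finrank K ↥((I.restrictScalars K) ⊓ homogeneousSubmodule (Fin (r+1)) K 2) = 4 ∧
    Module.finrank K ↥((I.restrictScalars K) ⊓ homogeneousSubmodule (Fin (r+1)) K 3) + 1 = 4 * (d + 4) := by
  have : Infinite K := inferInstance
  have hirr := le_irr I hprime hhom
  obtain ⟨⟨rs, hlen, hlin, hRL⟩, hmax⟩ := depth_lin I hirr d hdepth
  have hreg : ∀ a : PS K r, a ∉ I → Reg I a := fun a ha y hy => (hprime.mem_or_mem hy).resolve_left ha
  have hd1 : 1 ≤ d := by
    have hX : (X 0 : PS K r) ∉ I := fun h => X_ne_zero (R := K) 0 (hnd _ h (isHomogeneous_X K 0))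
    exact hmax [X 0] (by simpa using lin_irr (isHomogeneous_X K 0)) ⟨hreg _ hX, trivial⟩
  have hne : ∃ a ∈ rs, ev a ≠ 0 := by
    cases rs with
    | nil => simp at hlen; omega
    | cons a l =>
      refine ⟨a, by simp, fun h => ?_⟩
      rw [hev] at h
      exact (hprime.ne_top) ((Ideal.eq_top_iff_one _).2 (hRL.1 1 (by simpa using h)))
  have hSU : SU I ev rs := ⟨hhom, hirr, hev, hlin, hRL, hne⟩
  obtain ⟨h, hh, he⟩ := hdeg
  rw [pow_succ, ← mul_assoc, ← hlen, hilb_En rs I hhom hirr hlin hRL] at hh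
  have h5' := q_eventually hh he
  obtain ⟨q1, q2, q3⟩ := q_En rs I hhom hirr hlin hRL
  rw [hlen] at q1 q2 q3
  have hI1 : q I 1 = d + 4 := by
    have h1 := q_add I 1
    have h2 : I.restrictScalars K ⊓ Sh K r 1 = ⊥ := by
      rw [eq_bot_iff]
      rintro x ⟨hx1, hx2⟩
      exact hnd x hx1 hx2
    rw [h2, finrank_bot, finrank_Sh, Nat.multichoose_one_right] at h1
    omega
  have hJ1 : q (En I rs) 1 = 4 := by omega
  have hJ0 : q (En I rs) 0 = 1 := q_zero hSU.irrJ
  obtain ⟨y0, hy0, n0, hn0⟩ := exists_y0 hSU.homJ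
  set n1 := max n0 h.natDegree with hn1
  have h5 : ∀ n ≥ n1, q (En I rs) n = 5 := fun n hn => h5' n ((le_max_right _ _).trans hn)
  have hrg : ∀ n ≥ n1, ∀ f ∈ Sh K r n, y0 * f ∈ En I rs → f ∈ En I rs :=
    fun n hn => hn0 n ((le_max_left _ _).trans hn)
  have hy00 : y0 ≠ 0 := by
    rintro rfl
    have h1 := q_add (En I rs) n1
    have h2 : (En I rs).restrictScalars K ⊓ Sh K r n1 = Sh K r n1 :=
      inf_eq_right.2 fun f hf => hrg n1 le_rfl f hf (by simp)
    rw [h2, h5 n1 le_rfl] at h1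
    omega
  have hnreg : ¬ Reg (En I rs) y0 := by
    intro hR
    have := hmax (rs ++ [y0]) (fun x hx => by
      rcases List.mem_append.1 hx with hx | hx
      · exact lin_irr (hlin x hx)
      · rw [List.mem_singleton.1 hx]; exact lin_irr hy0) (RL_snoc rs I y0 hRL hR)
    simp at this
    omega
  set Φ := hSU.fil y0 hy0 n1 hrg h5 hy00 with hΦ
  have hM : ∀ n, Module.finrank (LL ev rs) (Φ.M n) = ∑ j ∈ Finset.range (n+1), q (En I rs) j :=
    fun n => (hSU.finrank_MM n).2
  rcases Φ.E_cases with hE | hE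
  · have hB := Φ.stepB (fun n => MM_succ n) hE (by rw [hM]; simp [hJ0])
      (by rw [hM]; simp [Finset.sum_range_succ, hJ0, hJ1])
      (hSU.tau y0 hy0 n1 hrg h5 hnreg)
    rw [hM, hM] at hB
    simp only [Finset.sum_range_succ, Finset.range_zero, Finset.sum_empty, hJ0, hJ1] at hB
    have hJ2 : q (En I rs) 2 = 6 := by omega
    have hJ3 : q (En I rs) 3 = 5 := by omega
    rw [hJ2, hJ1] at q2
    rw [hJ3, hJ2, hJ1] at q3
    have hq2 := q_add I 2
    have hq3 := q_add I 3
    rw [finrank_Sh] at hq2 hq3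
    replace hq2 := hq2.trans (congrArg (fun k => Nat.multichoose k 2) (show r + 1 = d + 4 by omega))
    replace hq3 := hq3.trans (congrArg (fun k => Nat.multichoose k 3) (show r + 1 = d + 4 by omega))
    rw [q2] at hq2
    rw [q3] at hq3
    exact ⟨arith2 hq2, arith3 hq3⟩
  · exfalso
    have h5c := Φ.case5 hE
    have hXM : ∀ i, ev (X i) ∈ Φ.M 1 := fun i => ev_mem_MM (isHomogeneous_X K i)
    choose α hα β hβ hαβ using fun i => h5c _ (hXM i)
    have : IsScalarTower K Φ.E F := IsScalarTower.of_algebraMap_eq fun x => rfl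
    refine hcone (cone_case (E := Φ.E) I hhom ev hev y0 hy0 Φ.transc (fun i => ⟨α i, hα i⟩)
      (fun i => ⟨β i, hβ i⟩) hαβ rs hlin (fun x hx => ?_) n1 h5)
    exact ⟨algebraMap (LL ev rs) Φ.E ⟨ev x, ev_mem_LL ev rs hx⟩, rfl⟩

end final

theorem main (K : Type) [Field K] [IsAlgClosed K] (r : ℕ)
    (I : Ideal (PS K r)) (hprime : I.IsPrime)
    (hhom : AMD.IsHomIdeal K r I) (hnd : AMD.Nondeg K r I)
    (d : ℕ) (hdim : AMD.DimEq K r I d) (hcodim : d + 3 = r)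
    (hdeg : AMD.DegreeEq K r I d 5)
    (hcone : ¬ AMD.IsConeIdeal K r I)
    (hdepth : AMD.DepthEq K r I d) : d ≤ 4 ∧ AMD.HasBettiDiagram K r I bt := by
  have := hprime
  let ev : PS K r →ₐ[K] FractionRing (PS K r ⧸ I) :=
    (IsScalarTower.toAlgHom K (PS K r ⧸ I) (FractionRing (PS K r ⧸ I))).comp (Ideal.Quotient.mkₐ K I)
  have hev : ∀ f, ev f = 0 ↔ f ∈ I := by
    intro f
    show algebraMap (PS K r ⧸ I) (FractionRing (PS K r ⧸ I)) (Ideal.Quotient.mk I f) = 0 ↔ _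
    rw [FaithfulSMul.algebraMap_eq_zero_iff, Ideal.Quotient.eq_zero_iff_mem]
  obtain ⟨hd2, hd3⟩ := hilb_facts I hprime hhom hnd d hcodim hdeg hcone hdepth ev hev
  obtain ⟨m, n, lam, hm, hn, hmi, hlam, hlamK⟩ := pencil_exists hcodim I hprime hnd ev hev hd2 hd3
  exact stepD hcodim I hprime hhom hnd hdim hcone ev hev hd2 hd3 m n hm hn hmi lam hlam hlamK

end AMDP

/-- **Theorem 2.2 (b).**  A non-degenerate variety `X ⊆ ℙ^r_K` of degree `5` and
codimension `3` which is not a cone and has `codepth A_X = 1` satisfies `dim X ≤ 4`,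
and the Betti diagram of `I_X` is `β₁₁ = 4, β₂₁ = 2, β₁₂ = 1, β₂₂ = 6, β₃₂ = 5,
β₄₂ = 1` (all other entries zero). -/
theorem degree_five_codim_three_codepth_one
    (K : Type) [Field K] [IsAlgClosed K] (r : ℕ)
    (I : Ideal (PS K r)) (hprime : I.IsPrime)
    (hhom : AMD.IsHomIdeal K r I) (hnd : AMD.Nondeg K r I)
    (d : ℕ) (hdim : AMD.DimEq K r I d) (hcodim : d + 3 = r)
    (hdeg : AMD.DegreeEq K r I d 5)
    (hcone : ¬ AMD.IsConeIdeal K r I)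
    (t : ℕ) (hdepth : AMD.DepthEq K r I t) (hcodepth : t + 1 = d + 1) :
    d ≤ 4 ∧ AMD.HasBettiDiagram K r I (fun i j => match i, j with
      | 1, 1 => 4 | 2, 1 => 2
      | 1, 2 => 1 | 2, 2 => 6 | 3, 2 => 5 | 4, 2 => 1
      | _, _ => 0) := by
  obtain rfl : t = d := by omega
  have hm := AMDP.main K r I hprime hhom hnd t hdim hcodim hdeg hcone hdepth
  refine ⟨hm.1, ?_⟩
  convert hm.2 using 1
  funext i j
  rcases i with _ | _ | _ | _ | _ | i <;> rcases j with _ | _ | _ | j <;> rfl
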